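/- Every IC-plane graph G with n vertices admits a right-angle crossing (RAC) drawing with at most two bends per edge on an integer grid whose width and height are both O(n) (hence O(n^2) area); that is, G has a drawing preserving its IC-planar embedding in which each vertex is a grid point, each edge is a polyline with at most two bends whose bend points are grid points, each edge is crossed at most once, no two crossed edges share an end-vertex, and any two crossing edges cross at a right angle. -/

import Mathlib

/-!
Common geometric framework: topological drawings of simple graphs in the plane,
IC-planar drawings, and axis-parallel visibility drawings.
-/

open Set

/-- A point of the plane. -/
abbrev Pt : Type := ℝ × ℝ

/-- A Jordan arc in the plane from `p` to `q`: a continuous injective curve. -/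
structure JArc (p q : Pt) where
  toFun : ℝ → Pt
  cont : ContinuousOn toFun (Set.Icc 0 1)
  inj : Set.InjOn toFun (Set.Icc 0 1)
  src : toFun 0 = p
  tgt : toFun 1 = q

/-- The point set of a Jordan arc. -/
def JArc.carrier {p q : Pt} (γ : JArc p q) : Set Pt := γ.toFun '' Set.Icc 0 1

/-- The points of the complement of `U` that lie in a bounded face of `U`
(i.e. whose connected component in the complement of `U` is bounded). -/
def boundedFaces (U : Set Pt) : Set Pt :=
  {q | q ∉ U ∧ Bornology.IsBounded (connectedComponentIn Uᶜ q)}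

/-- The outer (unbounded) face of `U`: points whose connected component in the
complement of `U` is unbounded. -/
def unboundedFace (U : Set Pt) : Set Pt :=
  {q | q ∉ U ∧ ¬ Bornology.IsBounded (connectedComponentIn Uᶜ q)}

/-- A (topological) drawing of a simple graph: vertices are mapped to distinct points
of the plane, each edge to a Jordan arc joining the points of its end-vertices, and
arcs pass through no vertex point other than their two endpoints. -/
structure Drawing {V : Type*} (G : SimpleGraph V) where
  pos : V → Pt
  pos_inj : Function.Injective pos
  arc : ∀ {u v : V}, G.Adj u v → JArc (pos u) (pos v)
  arc_symm : ∀ {u v : V} (h : G.Adj u v), (arc h.symm).carrier = (arc h).carrier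
  arc_avoid : ∀ {u v : V} (h : G.Adj u v) (w : V),
    pos w ∈ (arc h).carrier → w = u ∨ w = v

variable {V : Type*} {G : SimpleGraph V}

/-- Two edges cross in a drawing if their arcs share a point that is not a vertex point. -/
def Drawing.Crosses (D : Drawing G) {u v x y : V}
    (h1 : G.Adj u v) (h2 : G.Adj x y) : Prop :=
  ∃ p : Pt, p ∈ (D.arc h1).carrier ∧ p ∈ (D.arc h2).carrier ∧ p ∉ Set.range D.pos

/-- Crossing of two unordered edges. -/
def Drawing.CrossE (D : Drawing G) (e f : Sym2 V) : Prop :=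
  ∃ (u v x y : V) (h1 : G.Adj u v) (h2 : G.Adj x y),
    e = s(u, v) ∧ f = s(x, y) ∧ D.Crosses h1 h2

/-- An IC-planar drawing: a simple drawing (two distinct edges share at most one
point) in which every edge is crossed at most once and no two crossing edges share
an end-vertex.  A graph together with such a drawing is an *IC-plane graph*. -/
structure ICDrawing {V : Type*} (G : SimpleGraph V) extends Drawing G where
  simple : ∀ {u v x y : V} (h1 : G.Adj u v) (h2 : G.Adj x y), s(u, v) ≠ s(x, y) →
    ((arc h1).carrier ∩ (arc h2).carrier).Subsingleton
  indep : ∀ {u v x y : V} (h1 : G.Adj u v) (h2 : G.Adj x y), s(u, v) ≠ s(x, y) →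
    toDrawing.Crosses h1 h2 → u ≠ x ∧ u ≠ y ∧ v ≠ x ∧ v ≠ y
  once : ∀ {u v : V} (h : G.Adj u v),
    {f : Sym2 V | f ≠ s(u, v) ∧ toDrawing.CrossE s(u, v) f}.Subsingleton

/-- A point of the integer grid. -/
def IsGridPoint (p : Pt) : Prop := (∃ a : ℤ, p.1 = (a : ℝ)) ∧ (∃ b : ℤ, p.2 = (b : ℝ))

/-- The axis-parallel box `[0,W] × [0,H]`. -/
def box (W H : ℕ) : Set Pt := Set.Icc (0 : ℝ) (W : ℝ) ×ˢ Set.Icc (0 : ℝ) (H : ℝ)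

/-- The dot product of two plane vectors. -/
def dot (p q : Pt) : ℝ := p.1 * q.1 + p.2 * q.2

/-- A polyline drawing of `G` with (at most) two bends per edge: every vertex is a
point and every edge a polyline through its two (possibly coincident or degenerate)
bend points. -/
structure PolyDrawing {V : Type*} (G : SimpleGraph V) where
  pos : V → Pt
  pos_inj : Function.Injective pos
  bend : ∀ {u v : V}, G.Adj u v → Pt × Pt
  bend_symm : ∀ {u v : V} (h : G.Adj u v), bend h.symm = ((bend h).2, (bend h).1)

/-- The point set of the polyline of an edge. -/
def PolyDrawing.carrier (Δ : PolyDrawing G) {u v : V} (h : G.Adj u v) : Set Pt :=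
  segment ℝ (Δ.pos u) (Δ.bend h).1 ∪ segment ℝ (Δ.bend h).1 (Δ.bend h).2 ∪
    segment ℝ (Δ.bend h).2 (Δ.pos v)

/-- The (at most three) straight-line segments of the polyline of an edge, as pairs
of endpoints. -/
def PolyDrawing.segs (Δ : PolyDrawing G) {u v : V} (h : G.Adj u v) : Set (Pt × Pt) :=
  {((Δ.pos u), (Δ.bend h).1), ((Δ.bend h).1, (Δ.bend h).2), ((Δ.bend h).2, (Δ.pos v))}

/-- Two edges cross: their polylines share a point that is not a vertex point. -/
def PolyDrawing.Crosses (Δ : PolyDrawing G) {u v x y : V}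
    (h1 : G.Adj u v) (h2 : G.Adj x y) : Prop :=
  ∃ p : Pt, p ∈ Δ.carrier h1 ∧ p ∈ Δ.carrier h2 ∧ p ∉ Set.range Δ.pos

/-- Crossing at the level of unordered edges. -/
def PolyDrawing.CrossE (Δ : PolyDrawing G) (e f : Sym2 V) : Prop :=
  ∃ (u v x y : V) (h1 : G.Adj u v) (h2 : G.Adj x y),
    e = s(u, v) ∧ f = s(x, y) ∧ Δ.Crosses h1 h2

namespace RAC
section B1
variable {α : Type*} (R : α → α → Prop) (lo hi : α → Prop)
def GoodL (l : List α) : Prop :=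
  l.Nodup ∧ ∀ x ∈ l, (lo x ∨ ∃ y, R x y ∧ [y, x].Sublist l) ∧
    (hi x ∨ ∃ y, R x y ∧ [x, y].Sublist l)
variable {R lo hi}
theorem pair_sub_of_mem {l1 l2 : List α} {a b : α} (ha : a ∈ l1) (hb : b ∈ l2) :
    [a, b].Sublist (l1 ++ l2) :=
  (List.Sublist.append (List.singleton_sublist.2 ha) (List.singleton_sublist.2 hb) :
    ([a] ++ [b]).Sublist _)
theorem GoodL.insert (hs : ∀ x y, R x y → R y x) {l1 l2 q : List α} (h : GoodL R lo hi (l1 ++ l2))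
    (hq : q.Nodup) (hqR : q.IsChain R) (hd : ∀ x ∈ q, x ∉ l1 ++ l2)
    (h1 : ∀ x ∈ q.head?, lo x ∨ ∃ y ∈ l1, R x y)
    (h2 : ∀ x ∈ q.getLast?, hi x ∨ ∃ y ∈ l2, R x y) :
    GoodL R lo hi (l1 ++ (q ++ l2)) := by
  have hsub : (l1 ++ l2).Sublist (l1 ++ (q ++ l2)) :=
    List.Sublist.append (List.Sublist.refl _) (List.sublist_append_right _ _)
  refine ⟨?_, ?_⟩
  · have := h.1
    rw [List.nodup_append] at this ⊢
    refine ⟨this.1, ?_, ?_⟩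
    · rw [List.nodup_append]
      refine ⟨hq, this.2.1, ?_⟩
      intro a ha b hb hab
      exact hd a ha (by simp [hab, hb])
    · intro a ha b hb hab
      rcases List.mem_append.1 hb with hb | hb
      · exact hd b hb (by simp [← hab, ha])
      · exact this.2.2 a ha b hb hab
  · intro x hx
    by_cases hxq : x ∈ q
    · obtain ⟨q1, q2, rfl⟩ := List.append_of_mem hxq
      constructor
      · rcases List.eq_nil_or_concat q1 with rfl | ⟨q1', z, rfl⟩
        · rcases h1 x (by simp) with h | ⟨y, hy, hyx⟩
          · exact Or.inl h
          · exact Or.inr ⟨y, hyx, pair_sub_of_mem hy (by simp)⟩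
        · right
          refine ⟨z, hs _ _ ?_, ?_⟩
          · have : (q1' ++ ([z, x] ++ q2)).IsChain R := by simpa using hqR
            have := (List.isChain_append.1 this).2.1
            simpa using (List.isChain_append.1 this).1
          · have : [z, x].Sublist (l1 ++ q1' ++ [z] ++ ([x] ++ q2 ++ l2)) :=
              pair_sub_of_mem (by simp) (by simp)
            simpa using this
      · rcases q2 with _ | ⟨z, q2⟩
        · rcases h2 x (by simp) with h | ⟨y, hy, hyx⟩
          · exact Or.inl h
          · refine Or.inr ⟨y, hyx, ?_⟩
            have : [x, y].Sublist ((l1 ++ (q1 ++ [x])) ++ l2) := pair_sub_of_mem (by simp) hy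
            simpa using this
        · right
          refine ⟨z, ?_, ?_⟩
          · have : (q1 ++ ([x, z] ++ q2)).IsChain R := by simpa using hqR
            have := (List.isChain_append.1 this).2.1
            simpa using (List.isChain_append.1 this).1
          · have : [x, z].Sublist ((l1 ++ q1 ++ [x]) ++ ([z] ++ q2 ++ l2)) :=
              pair_sub_of_mem (by simp) (by simp)
            simpa using this
    · have hx' : x ∈ l1 ++ l2 := by
        simp only [List.mem_append] at hx ⊢; tauto
      obtain ⟨a, b⟩ := h.2 x hx'
      refine ⟨a.imp id ?_, b.imp id ?_⟩
      · rintro ⟨y, hy, hh⟩; exact ⟨y, hy, hh.trans hsub⟩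
      · rintro ⟨y, hy, hh⟩; exact ⟨y, hy, hh.trans hsub⟩
theorem path_out {l : List α} {w x y : α} (hx : x ∉ l)
    (h : Relation.ReflTransGen (fun a b => R a b ∧ b ≠ w) x y) :
    ∃ q : List α, q.Nodup ∧ q.IsChain R ∧ (∀ z ∈ q, z ∉ l) ∧ q.head? = some x ∧
      ∃ t, q.getLast? = some t ∧ (t = y ∨ ∃ v ∈ l, v ≠ w ∧ R t v) := by
  classical
  induction h using Relation.ReflTransGen.head_induction_on with
  | refl => exact ⟨[y], by simp, by simp, by simpa using hx, by simp, y, by simp, Or.inl rfl⟩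
  | @head a c hac hcy ih =>
    by_cases hc : c ∈ l
    · exact ⟨[a], by simp, by simp, by simpa using hx, by simp, a, by simp,
        Or.inr ⟨c, hc, hac.2, hac.1⟩⟩
    · obtain ⟨q, h1, h2, h3, h4, t, h5, h6⟩ := ih hc
      by_cases haq : a ∈ q
      · obtain ⟨q1, q2, rfl⟩ := List.append_of_mem haq
        refine ⟨a :: q2, (List.nodup_append.1 h1).2.1, (List.isChain_append.1 h2).2.1,
          fun z hz => h3 z (by simp at hz ⊢; tauto), by simp, t, ?_, h6⟩
        rw [← h5]
        simp [List.getLast?_cons]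
      · obtain ⟨d, q, rfl⟩ : ∃ d q', q = d :: q' := by
          cases q with
          | nil => simp at h4
          | cons d q => exact ⟨d, q, rfl⟩
        simp at h4; subst h4
        refine ⟨a :: d :: q, List.nodup_cons.2 ⟨haq, h1⟩, ?_, ?_, by simp, t, ?_, h6⟩
        · exact List.isChain_cons_cons.2 ⟨hac.1, h2⟩
        · intro z hz
          rcases List.mem_cons.1 hz with rfl | hz
          · exact hx
          · exact h3 z hz
        · rw [← h5]; simp
theorem st_order [Finite α] (hs : ∀ x y, R x y → R y x)
    (hconn : ∀ x y, Relation.ReflTransGen R x y)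
    (hlo : ∃ x, lo x) (hhi : ∃ x, hi x)
    (h : ∀ x w, x ≠ w → ∃ y, (lo y ∨ hi y) ∧
      Relation.ReflTransGen (fun a b => R a b ∧ b ≠ w) x y) :
    ∃ τ : α → ℕ, Function.Injective τ ∧ ∀ x, (lo x ∨ ∃ y, R x y ∧ τ y < τ x) ∧
      (hi x ∨ ∃ y, R x y ∧ τ x < τ y) := by
  classical
  have := Fintype.ofFinite α
  have hrev : ∀ q : List α, q.IsChain R → q.reverse.IsChain R := by
    intro q hq
    rw [List.isChain_reverse]
    exact hq.imp (fun a b hab => hs _ _ hab)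
  have h0 : ∃ l, GoodL R lo hi l ∧ l ≠ [] := by
    obtain ⟨a, ha⟩ := hlo
    obtain ⟨b, hb⟩ := hhi
    have hab := hconn a b
    have : ∃ q : List α, q.Nodup ∧ q.IsChain R ∧ q.head? = some a ∧ q.getLast? = some b := by
      · clear ha hb h
        induction hab using Relation.ReflTransGen.head_induction_on with
        | refl => exact ⟨[b], by simp⟩
        | @head a c hac hcy ih =>
          obtain ⟨q, h1, h2, h4, h5⟩ := ih
          by_cases haq : a ∈ q
          · obtain ⟨q1, q2, rfl⟩ := List.append_of_mem haq
            refine ⟨a :: q2, (List.nodup_append.1 h1).2.1, (List.isChain_append.1 h2).2.1,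
              by simp, ?_⟩
            rw [← h5]; simp [List.getLast?_cons]
          · obtain ⟨d, q, rfl⟩ : ∃ d q', q = d :: q' := by
              cases q with
              | nil => simp at h4
              | cons d q => exact ⟨d, q, rfl⟩
            simp at h4; subst h4
            refine ⟨a :: d :: q, List.nodup_cons.2 ⟨haq, h1⟩,
              List.isChain_cons_cons.2 ⟨hac, h2⟩, by simp, ?_⟩
            rw [← h5]; simp
    obtain ⟨q, h1, h2, h3, h4⟩ := this
    have hg : GoodL R lo hi ([] ++ ([] : List α)) := ⟨by simp, by simp⟩
    refine ⟨_, hg.insert hs h1 h2 (by simp) ?_ ?_, ?_⟩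
    · rw [h3]; simp [ha]
    · rw [h4]; simp [hb]
    · rintro h; simp at h; simp [h] at h3
  have hmax : ∃ l, GoodL R lo hi l ∧ l ≠ [] ∧ ∀ x, x ∈ l := by
    by_contra hcon
    push Not at hcon
    have key : ∀ n : ℕ, ∃ l, GoodL R lo hi l ∧ l ≠ [] ∧ n ≤ l.length := by
      intro n
      induction n with
      | zero => obtain ⟨l, h1, h2⟩ := h0; exact ⟨l, h1, h2, by simp⟩
      | succ n ih =>
        obtain ⟨l, hl, hne, hn⟩ := ih
        obtain ⟨x0, hx0⟩ := hcon l hl hne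
        obtain ⟨a, ha⟩ := List.exists_mem_of_ne_nil l hne
        have : ∃ x u, x ∉ l ∧ u ∈ l ∧ R x u := by
          by_contra hno
          push Not at hno
          have : ∀ y, Relation.ReflTransGen R x0 y → y ∉ l := by
            intro y hy
            induction hy with
            | refl => exact hx0
            | tail _ hbc ih => exact fun hc => hno _ _ ih hc hbc
          exact this a (hconn _ _) ha
        obtain ⟨x, u, hx, hu, hxu⟩ := this
        obtain ⟨y, hy, hxy⟩ := h x u (fun e => hx (e ▸ hu))
        obtain ⟨q, q1, q2, q3, q4, t, q5, q6⟩ := path_out hx hxy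
        have hqne : q ≠ [] := by rintro rfl; simp at q4
        have hqlen : 1 ≤ q.length := List.length_pos_iff.2 hqne
        have hrn : q.reverse.Nodup := List.nodup_reverse.2 q1
        rcases q6 with rfl | ⟨v, hv, hvu, htv⟩
        · rcases hy with hy | hy
          · have hl' : GoodL R lo hi ([] ++ l) := by simpa using hl
            refine ⟨_, hl'.insert hs hrn (hrev q q2) (by simpa using q3) ?_ ?_, by simp [hqne], by simp; omega⟩
            · rw [List.head?_reverse, q5]; simp [hy]
            · rw [List.getLast?_reverse, q4]; simp; exact Or.inr ⟨u, hu, hxu⟩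
          · have hl' : GoodL R lo hi (l ++ []) := by simpa using hl
            refine ⟨_, hl'.insert hs q1 q2 (by simpa using q3) ?_ ?_, by simp [hqne], by simp; omega⟩
            · rw [q4]; simp; exact Or.inr ⟨u, hu, hxu⟩
            · rw [q5]; simp [hy]
        · obtain ⟨l1, l2, rfl⟩ := List.append_of_mem hu
          have hv' : v ∈ l1 ∨ v ∈ l2 := by simp at hv; tauto
          rcases hv' with hv' | hv'
          · refine ⟨_, hl.insert hs hrn (hrev q q2) (by simpa using q3) ?_ ?_, by simp [hqne], by simp at hn ⊢; omega⟩
            · rw [List.head?_reverse, q5]; simp; exact Or.inr ⟨v, hv', htv⟩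
            · rw [List.getLast?_reverse, q4]; simp; exact Or.inr (Or.inl hxu)
          · have hl' : GoodL R lo hi ((l1 ++ [u]) ++ l2) := by simpa using hl
            refine ⟨_, hl'.insert hs q1 q2 (by simpa using q3) ?_ ?_, by simp, by simp at hn ⊢; omega⟩
            · rw [q4]; simp; exact Or.inr (Or.inr hxu)
            · rw [q5]; simp; exact Or.inr ⟨v, hv', htv⟩
    obtain ⟨l, h1, _, h3⟩ := key (Fintype.card α + 1)
    have := h1.1.length_le_card
    omega
  obtain ⟨l, hl, -, hall⟩ := hmax
  have hlt : ∀ a b, [a, b].Sublist l → l.idxOf a < l.idxOf b := by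
    intro a b hab
    have h2 := hl.1
    rw [show [a, b] = [a] ++ [b] from rfl, List.append_sublist_iff] at hab
    obtain ⟨r1, r2, rfl, ha, hb⟩ := hab
    rw [List.singleton_sublist] at ha hb
    rw [List.idxOf_append_of_mem ha, List.idxOf_append_of_notMem]
    · have := List.idxOf_lt_length_iff.2 ha; omega
    · intro hb'; exact (List.nodup_append.1 h2).2.2 b hb' b hb rfl
  refine ⟨fun x => l.idxOf x, ?_, ?_⟩
  · intro a b hab
    exact (List.idxOf_inj (hall a)).1 hab
  · intro x
    obtain ⟨a, b⟩ := hl.2 x (hall x)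
    refine ⟨a.imp id ?_, b.imp id ?_⟩
    · rintro ⟨y, hy, hh⟩; exact ⟨y, hy, hlt _ _ hh⟩
    · rintro ⟨y, hy, hh⟩; exact ⟨y, hy, hlt _ _ hh⟩
end B1
end RAC

namespace RAC
structure PMap (D V F : Type*) [Fintype D] [Fintype V] [Fintype F] where
  src : D → V
  al : D → D
  sg : Equiv.Perm D
  lf : D → F
  al_al : ∀ d, al (al d) = d
  src_sg : ∀ d, src (sg d) = src d
  trans : ∀ d d', src d = src d' → ∃ n : ℕ, sg^[n] d = d'
  lf_eq : ∀ d, lf (al (sg d)) = lf d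
  lf_surj : Function.Surjective lf
  euler : Fintype.card D + 4 ≤ 2 * Fintype.card V + 2 * Fintype.card F
section B3
variable {D V F : Type*} [Fintype D] [Fintype V] [Fintype F]
structure STMap (D V F : Type*) [Fintype D] [Fintype V] [Fintype F] extends PMap D V F where
  τ : V → ℕ
  τ_inj : Function.Injective τ
  noloop : ∀ d, src (al d) ≠ src d
  s0 : V
  t0 : V
  ds : D
  src_ds : src ds = s0
  tgt_ds : src (al ds) = t0
  lower : ∀ z, z ≠ s0 → ∃ d, src d = z ∧ τ (src (al d)) < τ z
  higher : ∀ z, z ≠ t0 → ∃ d, src d = z ∧ τ z < τ (src (al d))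
namespace STMap
variable (M : STMap D V F)
def up (d : D) : Prop := M.τ (M.src d) < M.τ (M.src (M.al d))
def ps : Equiv.Perm D where
  toFun d := M.sg.symm (M.al d)
  invFun d := M.al (M.sg d)
  left_inv d := by simp [M.al_al]
  right_inv d := by simp [M.al_al]
theorem lf_ps (d : D) : M.lf (M.ps d) = M.lf d := by
  have := M.lf_eq (M.ps d)
  rw [← this]; simp [ps, M.al_al]
theorem src_sgs (d : D) : M.src (M.sg.symm d) = M.src d := by
  have := M.src_sg (M.sg.symm d); simpa using this.symm
theorem src_ps (d : D) : M.src (M.ps d) = M.src (M.al d) := by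
  simp [ps, src_sgs]
theorem up_al (d : D) : M.up (M.al d) ↔ ¬ M.up d := by
  unfold up
  rw [M.al_al]
  have : M.τ (M.src (M.al d)) ≠ M.τ (M.src d) := fun h => M.noloop d (M.τ_inj h)
  omega
theorem lt_of_not_up {d : D} (h : ¬ M.up d) : M.τ (M.src (M.al d)) < M.τ (M.src d) := by
  have : M.τ (M.src (M.al d)) ≠ M.τ (M.src d) := fun h => M.noloop d (M.τ_inj h)
  unfold up at h
  omega
theorem exists_change {Q : D → Prop} (f : D → D) {a b : D} (n : ℕ) (hn : f^[n] a = b) (ha : Q a) (hb : ¬ Q b) :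
    ∃ m, (∀ i ≤ m, Q (f^[i] a)) ∧ ¬ Q (f^[m+1] a) := by
  classical
  have hex : ∃ n, ¬ Q (f^[n] a) := ⟨n, by rwa [hn]⟩
  have h0 : Nat.find hex ≠ 0 := by
    intro h
    have := Nat.find_spec hex
    rw [h] at this
    exact this ha
  refine ⟨Nat.find hex - 1, ?_, ?_⟩
  · intro i hi
    have := Nat.find_min hex (m := i) (by omega)
    simpa using this
  · have := Nat.find_spec hex
    rwa [show Nat.find hex - 1 + 1 = Nat.find hex by omega]
theorem face_change (f : F) : ∃ d, M.lf d = f ∧ M.up d ∧ ¬ M.up (M.ps d) := by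
  classical
  obtain ⟨d0, hd0⟩ := M.lf_surj f
  obtain ⟨e, he, hmax⟩ := Finset.exists_max_image (Finset.univ.filter (fun d => M.lf d = f))
    (fun d => M.τ (M.src d)) ⟨d0, by simp [hd0]⟩
  simp at he hmax
  have h1 : M.lf (M.ps.symm e) = f := by rw [← M.lf_ps]; simpa using he
  have h2 : M.src (M.al (M.ps.symm e)) = M.src e := by rw [← M.src_ps]; simp
  refine ⟨M.ps.symm e, h1, ?_, ?_⟩
  · by_contra h
    have := M.lt_of_not_up h
    rw [h2] at this
    have := hmax _ h1
    omega
  · simp only [Equiv.apply_symm_apply]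
    intro h
    unfold up at h
    rw [← M.src_ps] at h
    have := hmax (M.ps e) (by rw [M.lf_ps, he])
    omega
theorem vert_change (z : V) (h1 : z ≠ M.s0) (h2 : z ≠ M.t0) :
    ∃ d, M.src d = z ∧ M.up d ∧ ¬ M.up (M.sg d) := by
  obtain ⟨d, hd, hd'⟩ := M.higher z h2
  obtain ⟨e, he, he'⟩ := M.lower z h1
  obtain ⟨n, hn⟩ := M.trans d e (hd.trans he.symm)
  have hu : M.up d := by unfold up; rw [hd]; exact hd'
  have hu' : ¬ M.up e := by unfold up; rw [he]; omega
  obtain ⟨m, hm, hm'⟩ := exists_change (Q := M.up) M.sg n hn hu hu'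
  refine ⟨M.sg^[m] d, ?_, hm m le_rfl, ?_⟩
  · rw [← hd]
    clear hm hm'
    induction m with
    | zero => rfl
    | succ m ih => rw [Function.iterate_succ_apply', M.src_sg, ih]
  · rwa [Function.iterate_succ_apply'] at hm'
theorem s0_min (z : V) (h : z ≠ M.s0) : M.τ M.s0 < M.τ z := by
  classical
  obtain ⟨e, -, hmin⟩ := Finset.exists_min_image Finset.univ M.τ ⟨z, by simp⟩
  have : e = M.s0 := by
    by_contra he
    obtain ⟨d, hd, hd'⟩ := M.lower e he
    have := hmin (M.src (M.al d)) (by simp)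
    omega
  have h3 := hmin z (by simp)
  rw [this] at h3
  have h2 : M.τ M.s0 ≠ M.τ z := fun h' => h (M.τ_inj h').symm
  omega
theorem t0_max (z : V) (h : z ≠ M.t0) : M.τ z < M.τ M.t0 := by
  classical
  obtain ⟨e, -, hmin⟩ := Finset.exists_max_image Finset.univ M.τ ⟨z, by simp⟩
  have : e = M.t0 := by
    by_contra he
    obtain ⟨d, hd, hd'⟩ := M.higher e he
    have := hmin (M.src (M.al d)) (by simp)
    omega
  have h3 := hmin z (by simp)
  rw [this] at h3
  have h2 : M.τ M.t0 ≠ M.τ z := fun h' => h (M.τ_inj h').symm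
  omega
theorem s0_ne_t0 : M.s0 ≠ M.t0 := by
  have := M.noloop M.ds
  rw [M.src_ds, M.tgt_ds] at this
  exact this.symm
theorem counting :
    (∀ d d', M.src d = M.src d' → M.up d → M.up d' → ¬ M.up (M.sg d) → ¬ M.up (M.sg d') → d = d') ∧
    (∀ d d', M.lf d = M.lf d' → M.up d → M.up d' → ¬ M.up (M.ps d) → ¬ M.up (M.ps d') → d = d') := by
  classical
  set SA := Finset.univ.filter (fun d => M.up d ∧ ¬ M.up (M.sg d)) with hSA
  set SB := Finset.univ.filter (fun d => M.up d ∧ ¬ M.up (M.ps d)) with hSB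
  set Dn := Finset.univ.filter (fun d => ¬ M.up d) with hDn
  set Up := Finset.univ.filter (fun d => M.up d) with hUp
  have al_inj : Function.Injective M.al := fun a b h => by
    rw [← M.al_al a, h, M.al_al]
  have c1 : Up.card = Dn.card := by
    apply Finset.card_nbij' M.al M.al
    · intro d hd; simp [hUp, hDn] at hd ⊢; rw [M.up_al]; simpa using hd
    · intro d hd; simp [hUp, hDn] at hd ⊢; rw [M.up_al]; simpa using hd
    · intro d _; exact M.al_al d
    · intro d _; exact M.al_al d
  have c2 : Up.card + Dn.card = Fintype.card D := by
    rw [← Finset.card_univ (α := D)]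
    exact Finset.card_filter_add_card_filter_not _
  have c3 : SA.card + SB.card = Dn.card := by
    have e1 : SA.card = (Dn.filter (fun e => M.up (M.sg.symm e))).card := by
      apply Finset.card_nbij' M.sg M.sg.symm
      · intro d hd; simp [hSA, hDn] at hd ⊢; tauto
      · intro d hd; simp [hSA, hDn] at hd ⊢; tauto
      · intro d _; simp
      · intro d _; simp
    have e2 : SB.card = (Dn.filter (fun e => ¬ M.up (M.sg.symm e))).card := by
      apply Finset.card_nbij' M.al M.al
      · intro d hd; simp [hSB, hDn] at hd ⊢; rw [M.up_al]; simpa [ps] using hd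
      · intro d hd; simp [hSB, hDn] at hd ⊢; rw [M.up_al]; simpa [ps, M.al_al] using hd
      · intro d _; exact M.al_al d
      · intro d _; exact M.al_al d
    rw [e1, e2]
    exact Finset.card_filter_add_card_filter_not _
  have s1 : (Finset.univ \ {M.s0, M.t0} : Finset V) ⊆ SA.image M.src := by
    intro z hz
    simp at hz
    obtain ⟨d, h1, h2, h3⟩ := M.vert_change z hz.1 hz.2
    exact Finset.mem_image.2 ⟨d, by simp [hSA, h2, h3], h1⟩
  have s2 : (Finset.univ : Finset F) ⊆ SB.image M.lf := by
    intro z hz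
    obtain ⟨d, h1, h2, h3⟩ := M.face_change z
    exact Finset.mem_image.2 ⟨d, by simp [hSB, h2, h3], h1⟩
  have c4 := Finset.card_le_card s1
  have c5 := Finset.card_le_card s2
  have c6 : (Finset.univ \ {M.s0, M.t0} : Finset V).card + 2 = Fintype.card V := by
    have := Finset.card_sdiff_add_card_eq_card (Finset.subset_univ {M.s0, M.t0})
    rwa [Finset.card_pair M.s0_ne_t0] at this
  have c7 : (SA.image M.src).card ≤ SA.card := Finset.card_image_le
  have c8 : (SB.image M.lf).card ≤ SB.card := Finset.card_image_le
  rw [Finset.card_univ] at c5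
  have := M.euler
  have i1 : (SA.image M.src).card = SA.card := by omega
  have i2 : (SB.image M.lf).card = SB.card := by omega
  rw [Finset.card_image_iff] at i1 i2
  constructor
  · intro d d' h h1 h2 h3 h4
    exact i1 (by simp [hSA, h1, h3]) (by simp [hSA, h2, h4]) h
  · intro d d' h h1 h2 h3 h4
    exact i2 (by simp [hSB, h1, h3]) (by simp [hSB, h2, h4]) h
theorem up_run (d : D) (hd : M.up d) :
    ∃ m, (∀ i ≤ m, M.up (M.ps^[i] d)) ∧ ¬ M.up (M.ps^[m+1] d) := by
  by_cases h : ∃ n, ¬ M.up (M.ps^[n] d)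
  · obtain ⟨n, hn⟩ := h
    exact exists_change M.ps n rfl hd hn
  · push Not at h
    exfalso
    have : StrictMono (fun n => M.τ (M.src (M.ps^[n] d))) := by
      apply strictMono_nat_of_lt_succ
      intro n
      rw [Function.iterate_succ_apply', M.src_ps]
      exact h n
    have h2 : Function.Injective (fun n => M.ps^[n] d) := by
      intro a b hab
      apply this.injective
      simp only at hab ⊢
      rw [hab]
    exact not_injective_infinite_finite _ h2
theorem mono_run (d : D) (m : ℕ) (h : ∀ i ≤ m, M.up (M.ps^[i] d)) :
    M.τ (M.src (M.al d)) ≤ M.τ (M.src (M.ps^[m+1] d)) := by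
  induction m with
  | zero => simp [M.src_ps]
  | succ m ih =>
    have := ih (fun i hi => h i (by omega))
    have h2 := h (m+1) le_rfl
    unfold up at h2
    rw [← M.src_ps, ← Function.iterate_succ_apply' (f := M.ps)] at h2
    exact this.trans h2.le
theorem uniq_level {d d' : D} {k : ℕ} (h : M.lf d = M.lf d') (h1 : M.τ (M.src d) < k) (h2 : k ≤ M.τ (M.src (M.al d)))
    (h3 : M.τ (M.src d') < k) (h4 : k ≤ M.τ (M.src (M.al d'))) : d = d' := by
  have hu : M.up d := by unfold up; omega
  have hu' : M.up d' := by unfold up; omega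
  obtain ⟨m, hm, hm'⟩ := M.up_run d hu
  obtain ⟨m', hn, hn'⟩ := M.up_run d' hu'
  have lfi : ∀ (i : ℕ) (e : D), M.lf (M.ps^[i] e) = M.lf e := by
    intro i e
    induction i with
    | zero => rfl
    | succ m ih => rw [Function.iterate_succ_apply', M.lf_ps, ih]
  have heq : M.ps^[m] d = M.ps^[m'] d' := by
    apply M.counting.2
    · rw [lfi, lfi, h]
    · exact hm m le_rfl
    · exact hn m' le_rfl
    · rwa [Function.iterate_succ_apply'] at hm'
    · rwa [Function.iterate_succ_apply'] at hn'
  have aux : ∀ (d d' : D) (m m' : ℕ), m ≤ m' → (∀ i ≤ m', M.up (M.ps^[i] d')) →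
      M.ps^[m] d = M.ps^[m'] d' → M.τ (M.src d) < k → k ≤ M.τ (M.src (M.al d')) → d = d' := by
    intro d d' m m' hmm hn heq h1 h4
    obtain ⟨j, rfl⟩ := Nat.exists_eq_add_of_le hmm
    rw [Function.iterate_add_apply] at heq
    have hdd := (M.ps.injective.iterate m) heq
    rcases j with _ | j
    · simpa using hdd
    · have := M.mono_run d' j (fun i hi => hn i (by omega))
      rw [← hdd] at this
      omega
  rcases le_total m m' with hmm | hmm
  · exact aux d d' m m' hmm hn heq h1 h4
  · exact (aux d' d m' m hmm hm heq.symm h3 h2).symm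
end STMap
end B3
end RAC

namespace RAC
section B4
theorem idx_lt_of_sub {α : Type*} [DecidableEq α] {l : List α} (hl : l.Nodup) {a b : α}
    (hab : [a, b].Sublist l) : l.idxOf a < l.idxOf b := by
  rw [show [a, b] = [a] ++ [b] from rfl, List.append_sublist_iff] at hab
  obtain ⟨r1, r2, rfl, ha, hb⟩ := hab
  rw [List.singleton_sublist] at ha hb
  rw [List.idxOf_append_of_mem ha, List.idxOf_append_of_notMem]
  · have := List.idxOf_lt_length_iff.2 ha; omega
  · intro hb'; exact (List.nodup_append.1 hl).2.2 b hb' b hb rfl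
theorem no_swap {α : Type*} {l : List α} (hl : l.Nodup) {a b : α}
    (hab : [a, b].Sublist l) (hba : [b, a].Sublist l) : False := by
  classical
  have := idx_lt_of_sub hl hab
  have := idx_lt_of_sub hl hba
  omega
theorem run_list {α : Type*} (ρ : Equiv.Perm α) (Q : α → Prop) (a : α) (m : ℕ)
    (hm : ∀ i ≤ m, Q (ρ^[i] a)) (hm' : ¬ Q (ρ^[m+1] a)) :
    ((List.range (m+1)).map (fun i => ρ^[i] a)).Nodup := by
  have key : ∀ i j, i < j → j ≤ m → ρ^[i] a ≠ ρ^[j] a := by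
    intro i j hij hj h
    obtain ⟨t, rfl⟩ := Nat.exists_eq_add_of_lt hij
    rw [show i + t + 1 = i + (t+1) by ring, Function.iterate_add_apply] at h
    have h := (ρ.injective.iterate i) h
    apply hm'
    rw [show m + 1 = (m - t) + (t+1) by omega, Function.iterate_add_apply, ← h]
    exact hm _ (by omega)
  refine List.Nodup.map_on ?_ List.nodup_range
  intro i hi j hj h
  simp at hi hj
  rcases lt_trichotomy i j with h1 | h1 | h1
  · exact absurd h (key i j h1 (by omega))
  · exact h1
  · exact absurd h.symm (key j i h1 (by omega))
theorem chain_run {α : Type*} (ρ : α → α) (R : α → α → Prop) (a : α) (m : ℕ)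
    (h : ∀ i < m, R (ρ^[i] a) (ρ^[i+1] a)) :
    ((List.range (m+1)).map (fun i => ρ^[i] a)).IsChain R := by
  rw [List.isChain_iff_getElem]
  intro i hi
  simp at hi
  simp only [List.getElem_map, List.getElem_range]
  exact h i (by omega)
variable {D V F : Type*} [Fintype D] [Fintype V] [Fintype F] (M : STMap D V F)
namespace STMap
def RR (a b : D) : Prop := M.lf (M.al a) = M.lf b
theorem src_iter_sg (n : ℕ) (d : D) : M.src (M.sg^[n] d) = M.src d := by
  induction n with
  | zero => rfl
  | succ m ih => rw [Function.iterate_succ_apply', M.src_sg, ih]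
theorem src_iter_sgs (n : ℕ) (d : D) : M.src (M.sg.symm^[n] d) = M.src d := by
  induction n with
  | zero => rfl
  | succ m ih => rw [Function.iterate_succ_apply', M.src_sgs, ih]
theorem sgs_sg_iter (n : ℕ) (d : D) : M.sg.symm^[n] (M.sg^[n] d) = d :=
  (Function.LeftInverse.iterate M.sg.left_inv n) d
theorem sg_sgs_iter (n : ℕ) (d : D) : M.sg^[n] (M.sg.symm^[n] d) = d :=
  (Function.LeftInverse.iterate M.sg.right_inv n) d
theorem trans_symm (d d' : D) (h : M.src d = M.src d') : ∃ n : ℕ, M.sg.symm^[n] d = d' := by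
  obtain ⟨n, hn⟩ := M.trans d' d h.symm
  exact ⟨n, by rw [← hn, M.sgs_sg_iter]⟩
theorem lf_sgs (d : D) : M.lf (M.sg.symm d) = M.lf (M.al d) := by
  have := M.lf_eq (M.sg.symm d)
  simpa using this.symm
theorem local_lists (z : V) (h1 : z ≠ M.s0) (h2 : z ≠ M.t0) :
    ∃ (i0 o0 i1 o1 : D) (I O : List D), (i0 :: I).Nodup ∧ (o0 :: O).Nodup ∧
      (∀ d, d ∈ i0 :: I ↔ M.up d ∧ M.src (M.al d) = z) ∧
      (∀ d, d ∈ o0 :: O ↔ M.up d ∧ M.src d = z) ∧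
      (i0 :: I).IsChain M.RR ∧ (o0 :: O).IsChain M.RR ∧ M.lf i0 = M.lf o0 ∧
      (i0 :: I).getLast? = some i1 ∧ (o0 :: O).getLast? = some o1 ∧
      M.lf (M.al i1) = M.lf (M.al o1) := by
  classical
  obtain ⟨u, hu, hup, hdn⟩ := M.vert_change z h1 h2
  set e := M.sg u with he
  have hez : M.src e = z := by rw [he, M.src_sg, hu]
  obtain ⟨n, hn⟩ := M.trans e u (hez.trans hu.symm)
  obtain ⟨m, hm, hm'⟩ := exists_change (Q := fun d => ¬ M.up d) M.sg n hn hdn (by simpa using hup)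
  obtain ⟨n', hn'⟩ := M.trans_symm u e (hu.trans hez.symm)
  obtain ⟨l, hl, hl'⟩ := exists_change (Q := M.up) M.sg.symm n' hn' hup hdn
  have al_inj : Function.Injective M.al := fun a b h => by
    rw [← M.al_al a, h, M.al_al]
  have covI : ∀ d, M.src d = z → ¬ M.up d → ∃ j ≤ m, M.sg^[j] e = d := by
    intro d hd hdu
    obtain ⟨n, hn⟩ := M.trans_symm d u (hd.trans hu.symm)
    obtain ⟨j, hj, hj'⟩ := exists_change (Q := fun d => ¬ M.up d) M.sg.symm n hn hdu (by simpa using hup)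
    have h3 : M.sg.symm^[j+1] d = u := by
      apply M.counting.1
      · rw [M.src_iter_sgs, hd, hu]
      · simpa using hj'
      · exact hup
      · rw [Function.iterate_succ_apply', Equiv.apply_symm_apply]; exact hj j le_rfl
      · exact hdn
    have h4 : ∀ i ≤ j, M.sg^[i] e = M.sg.symm^[j - i] d := by
      intro i hi
      rw [he, ← h3, ← Function.iterate_succ_apply, show j + 1 = (i+1) + (j-i) by omega,
        Function.iterate_add_apply, Nat.succ_eq_add_one, M.sg_sgs_iter]
    refine ⟨j, ?_, by rw [h4 j le_rfl]; simp⟩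
    by_contra hjm
    apply hm'
    rw [h4 (m+1) (by omega)]
    exact hj _ (by omega)
  have covO : ∀ d, M.src d = z → M.up d → ∃ j ≤ l, M.sg.symm^[j] u = d := by
    intro d hd hdu
    obtain ⟨n, hn⟩ := M.trans d e (hd.trans hez.symm)
    obtain ⟨j, hj, hj'⟩ := exists_change (Q := M.up) M.sg n hn hdu hdn
    have h3 : M.sg^[j] d = u := by
      apply M.counting.1
      · rw [M.src_iter_sg, hd, hu]
      · exact hj j le_rfl
      · exact hup
      · rwa [Function.iterate_succ_apply'] at hj'
      · exact hdn
    have h4 : ∀ i ≤ j, M.sg.symm^[i] u = M.sg^[j - i] d := by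
      intro i hi
      rw [← h3]
      conv_lhs => rw [show j = i + (j-i) by omega, Function.iterate_add_apply, M.sgs_sg_iter]
    refine ⟨j, ?_, by rw [h4 j le_rfl]; simp⟩
    by_contra hjm
    apply hl'
    rw [h4 (l+1) (by omega)]
    exact hj _ (by omega)
  have hlast : M.sg (M.sg^[m] e) = M.sg.symm^[l] u := by
    rw [Function.iterate_succ_apply'] at hm' hl'
    obtain ⟨j, hj, hj'⟩ := covO (M.sg (M.sg^[m] e)) (by rw [M.src_sg, M.src_iter_sg, hez]) (by simpa using hm')
    rcases Nat.lt_or_ge j l with hjl | hjl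
    · exfalso
      have := hl (j+1) (by omega)
      rw [Function.iterate_succ_apply', hj', Equiv.symm_apply_apply] at this
      exact hm m le_rfl this
    · rw [← hj', show j = l by omega]
  have sgs_chain : ∀ i, M.RR (M.sg.symm^[i] u) (M.sg.symm^[i+1] u) := by
    intro i
    rw [Function.iterate_succ_apply']
    exact (M.lf_sgs _).symm
  have sg_chain : ∀ i, M.RR (M.al (M.sg^[i] e)) (M.al (M.sg^[i+1] e)) := by
    intro i
    rw [Function.iterate_succ_apply']
    unfold RR
    rw [M.al_al, M.lf_eq]
  refine ⟨M.al e, u, M.al (M.sg^[m] e), M.sg.symm^[l] u,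
    ((List.range m).map (fun i => M.al (M.sg^[i+1] e))),
    ((List.range l).map (fun i => M.sg.symm^[i+1] u)), ?_⟩
  have eI : M.al e :: ((List.range m).map (fun i => M.al (M.sg^[i+1] e))) =
      ((List.range (m+1)).map (fun i => M.sg^[i] e)).map M.al := by
    rw [List.range_succ_eq_map]; simp
  have eO : u :: ((List.range l).map (fun i => M.sg.symm^[i+1] u)) =
      ((List.range (l+1)).map (fun i => M.sg.symm^[i] u)) := by
    rw [List.range_succ_eq_map]; simp only [List.map_cons, List.map_map]; rfl
  rw [eI, eO]
  refine ⟨?_, ?_, ?_, ?_, ?_, ?_, ?_, ?_, ?_, ?_⟩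
  · exact (run_list M.sg (fun d => ¬ M.up d) e m hm hm').map al_inj
  · exact (run_list M.sg.symm _ u l hl hl')
  · intro d
    simp only [List.map_map, List.mem_map, List.mem_range, Function.comp]
    constructor
    · rintro ⟨i, hi, rfl⟩
      rw [M.up_al, M.al_al, M.src_iter_sg]
      exact ⟨hm i (by omega), hez⟩
    · rintro ⟨h3, h4⟩
      obtain ⟨j, hj, hj'⟩ := covI (M.al d) h4 (by rw [M.up_al]; simpa using h3)
      exact ⟨j, by omega, by rw [hj', M.al_al]⟩
  · intro d
    simp only [List.mem_map, List.mem_range]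
    constructor
    · rintro ⟨i, hi, rfl⟩
      rw [M.src_iter_sgs]
      exact ⟨hl i (by omega), hu⟩
    · rintro ⟨h3, h4⟩
      obtain ⟨j, hj, hj'⟩ := covO d h4 h3
      exact ⟨j, by omega, hj'⟩
  · rw [List.isChain_map]
    exact chain_run _ _ _ _ (fun i _ => sg_chain i)
  · exact chain_run _ _ _ _ (fun i _ => sgs_chain i)
  · rw [he, M.lf_eq]
  · rw [List.range_succ]; simp
  · rw [List.range_succ]; simp
  · rw [M.al_al, ← hlast, M.lf_eq]
def inc (d : D) (z : V) : Prop := M.src d = z ∨ M.src (M.al d) = z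
def Inv (k : ℕ) : Prop := ∃ E L : List D, E.Nodup ∧ (∀ d, d ∈ E ↔ M.up d ∧ M.τ (M.src d) < k) ∧
  L.Sublist E ∧ (∀ d, d ∈ L ↔ d ∈ E ∧ k ≤ M.τ (M.src (M.al d))) ∧ L.head? = some M.ds ∧
  (L ++ [M.ds]).IsChain M.RR ∧
  ∀ z, M.τ z < k → ∀ a b c, [a, b, c].Sublist E → M.inc a z → M.inc c z →
    M.τ (M.src b) < M.τ z → M.τ z < M.τ (M.src (M.al b)) → False
theorem contig (ds : D) (I : List D) : ∀ (A : List D) (i : D) (B : List D),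
    (A ++ i :: B ++ [ds]).IsChain M.RR → (i :: I).IsChain M.RR →
    (∀ b ∈ i :: B ++ [ds], ∀ y ∈ I, M.lf b = M.lf y → b = y) → ds ∉ I →
    ∃ B', B = I ++ B' := by
  induction I with
  | nil => intro A i B _ _ _ _; exact ⟨B, rfl⟩
  | cons y I ih =>
    intro A i B h1 h2 h3 h4
    have hR : M.RR i y := by simpa using (List.isChain_cons_cons.1 h2).1
    rcases B with _ | ⟨b, B⟩
    · exfalso
      have : (A ++ [i, ds]).IsChain M.RR := by simpa using h1
      have := (List.isChain_append.1 this).2.1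
      have : M.RR i M.ds ∨ M.RR i ds := Or.inr (by simpa using this)
      have h5 : M.RR i ds := by simpa using ‹List.IsChain M.RR [i, ds]›
      have := h3 ds (by simp) y (by simp) (h5.symm.trans hR)
      exact h4 (by simp [this])
    · have h5 : (A ++ [i] ++ (b :: B ++ [ds])).IsChain M.RR := by simpa using h1
      have h6 : M.RR i b := (List.isChain_append.1 h5).2.2 i (by simp) b (by simp)
      have : b = y := h3 b (by simp) y (by simp) (h6.symm.trans hR)
      subst this
      obtain ⟨B', rfl⟩ := ih (A ++ [i]) b B (by simpa using h1) (List.isChain_cons_cons.1 h2).2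
        (fun b' hb' y hy => h3 b' (by simp at hb' ⊢; tauto) y (by simp [hy])) (by simp at h4; tauto)
      exact ⟨B', rfl⟩
theorem inv_base : M.Inv (M.τ M.s0 + 1) := by
  classical
  obtain ⟨n, hn⟩ := M.trans_symm M.ds (M.sg M.ds) (M.src_sg _).symm
  have hex : ∃ n, M.sg.symm^[n+1] M.ds = M.ds := ⟨n, by rw [Function.iterate_succ_apply', hn]; simp⟩
  set m := Nat.find hex with hm
  have hmm : M.sg.symm^[m+1] M.ds = M.ds := Nat.find_spec hex
  have hup : ∀ d, M.src d = M.s0 → M.up d := by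
    intro d hd
    unfold up
    rw [hd]
    exact M.s0_min _ (fun h => M.noloop d (h.trans hd.symm))
  set L := (List.range (m+1)).map (fun i => M.sg.symm^[i] M.ds) with hL
  have hmemL : ∀ d, d ∈ L ↔ M.src d = M.s0 := by
    intro d
    constructor
    · intro h
      simp only [hL, List.mem_map] at h
      obtain ⟨i, -, rfl⟩ := h
      rw [M.src_iter_sgs, M.src_ds]
    · intro h
      obtain ⟨j, hj⟩ := M.trans_symm M.ds d (M.src_ds.trans h.symm)
      simp only [hL, List.mem_map, List.mem_range]
      refine ⟨j % (m+1), Nat.mod_lt _ (by omega), ?_⟩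
      rw [← hj]
      exact Function.IsPeriodicPt.iterate_mod_apply (f := M.sg.symm) (n := m+1) (x := M.ds) hmm j
  have hnd : L.Nodup := by
    refine List.Nodup.map_on ?_ List.nodup_range
    have key : ∀ i j, i < j → j ≤ m → M.sg.symm^[i] M.ds ≠ M.sg.symm^[j] M.ds := by
      intro i j hij hj h
      obtain ⟨t, rfl⟩ := Nat.exists_eq_add_of_lt hij
      rw [show i + t + 1 = i + (t+1) by ring, Function.iterate_add_apply] at h
      have h := (M.sg.symm.injective.iterate i) h
      exact Nat.find_min hex (m := t) (by omega) h.symm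
    intro i hi j hj h
    simp at hi hj
    rcases lt_trichotomy i j with h1 | h1 | h1
    · exact absurd h (key i j h1 (by omega))
    · exact h1
    · exact absurd h.symm (key j i h1 (by omega))
  have hlow : ∀ z, M.τ z < M.τ M.s0 + 1 → z = M.s0 := by
    intro z hz
    by_contra h
    have := M.s0_min z h
    omega
  refine ⟨L, L, hnd, ?_, List.Sublist.refl _, ?_, ?_, ?_, ?_⟩
  · intro d
    rw [hmemL]
    constructor
    · intro h; exact ⟨hup d h, by rw [h]; omega⟩
    · intro h; exact hlow _ h.2
  · intro d
    constructor
    · intro h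
      have := hup d ((hmemL d).1 h)
      unfold up at this
      rw [(hmemL d).1 h] at this
      exact ⟨h, this⟩
    · exact fun h => h.1
  · simp [hL, List.range_succ_eq_map]
  · have : L ++ [M.ds] = (List.range (m+1+1)).map (fun i => M.sg.symm^[i] M.ds) := by
      rw [List.range_succ (n := m+1)]; simp only [List.map_append, List.map_cons, List.map_nil, hmm, hL]
    rw [this]
    apply chain_run
    intro i _
    rw [Function.iterate_succ_apply']
    exact (M.lf_sgs _).symm
  · intro z hz a b c hs ha hc hb _
    rw [hlow z hz] at hb
    have := hlow (M.src b) (by omega)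
    rw [this] at hb; omega
theorem inv_step (k : ℕ) (h0 : M.τ M.s0 < k) (hk : k < M.τ M.t0) (h : M.Inv k) : M.Inv (k+1) := by
  classical
  obtain ⟨E, L, hE, hmE, hLE, hmL, hhd, hch, hst⟩ := h
  by_cases hz : ∃ z, M.τ z = k
  swap
  · push Not at hz
    refine ⟨E, L, hE, ?_, hLE, ?_, hhd, hch, ?_⟩
    · intro d; rw [hmE]; have := hz (M.src d); constructor <;> rintro ⟨h1, h2⟩ <;> exact ⟨h1, by omega⟩
    · intro d; rw [hmL]; have := hz (M.src (M.al d))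
      constructor <;> rintro ⟨h1, h2⟩ <;> exact ⟨h1, by omega⟩
    · intro z hz'; exact hst z (by have := hz z; omega)
  obtain ⟨z, rfl⟩ := hz
  have hs0 : z ≠ M.s0 := by rintro rfl; omega
  have ht0 : z ≠ M.t0 := by rintro rfl; omega
  obtain ⟨i0, o0, i1, o1, I, O, hI, hO, hmI, hmO, hcI, hcO, hlf, hl1, hl2, hrf⟩ := M.local_lists z hs0 ht0
  have hIL : ∀ d ∈ i0 :: I, d ∈ L := by
    intro d hd
    obtain ⟨h1, h2⟩ := (hmI d).1 hd
    rw [hmL, hmE, h2]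
    unfold up at h1; rw [h2] at h1
    exact ⟨⟨by unfold up; rwa [h2], h1⟩, le_rfl⟩
  have hds : ∀ d ∈ i0 :: I, d ≠ M.ds := by
    rintro d hd rfl
    exact ht0 (((hmI _).1 hd).2.symm.trans M.tgt_ds)
  have hdsL : M.ds ∈ L := List.mem_of_head? hhd
  have huq : ∀ b ∈ L, ∀ y ∈ L, M.lf b = M.lf y → b = y := by
    intro b hb y hy hby
    have hb' := (hmL b).1 hb
    have hy' := (hmL y).1 hy
    exact M.uniq_level hby ((hmE b).1 hb'.1).2 hb'.2 ((hmE y).1 hy'.1).2 hy'.2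
  obtain ⟨A, B, hAB⟩ := List.append_of_mem (hIL i0 (by simp))
  subst hAB
  have hcont : ∃ B', B = I ++ B' := by
    refine M.contig M.ds I A i0 B hch hcI ?_ ?_
    · intro b hb y hy
      refine huq b ?_ y (hIL y (by simp [hy]))
      rcases List.mem_append.1 hb with hb | hb
      · simp at hb ⊢; tauto
      · simp only [List.mem_singleton] at hb; rw [hb]; exact hdsL
    · intro h; exact hds M.ds (by simp [h]) rfl
  obtain ⟨B, rfl⟩ := hcont
  rw [List.append_sublist_iff] at hLE
  obtain ⟨E1, E2, rfl, hA, hB⟩ := hLE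
  rw [List.cons_sublist_iff] at hB
  obtain ⟨r1, r2, rfl, hi0, hB⟩ := hB
  have hnodL : (A ++ i0 :: (I ++ B)).Nodup := by
    refine List.Nodup.sublist (List.Sublist.append hA ?_) hE
    rw [← List.singleton_append]
    exact List.Sublist.append (List.singleton_sublist.2 hi0) hB
  have hOE : ∀ d ∈ o0 :: O, d ∉ E1 ++ (r1 ++ r2) := by
    intro d hd h
    rw [hmE, ((hmO d).1 hd).2] at h
    omega
  have hAne : ∃ A', A = M.ds :: A' := by
    cases A with
    | nil => simp at hhd; exact absurd hhd (hds i0 (by simp))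
    | cons a A => simp at hhd; exact ⟨A, by rw [hhd]⟩
  have hEnew : (E1 ++ (r1 ++ ((o0 :: O) ++ r2))).Nodup := by
    have : (E1 ++ (r1 ++ ((o0 :: O) ++ r2))).Perm ((o0 :: O) ++ (E1 ++ (r1 ++ r2))) := by
      simp only [← List.append_assoc]
      refine List.Perm.append_right _ ?_
      rw [List.append_assoc (o0 :: O)]
      exact List.perm_append_comm
    rw [this.nodup_iff, List.nodup_append]
    exact ⟨hO, hE, fun a ha b hb hab => hOE a ha (hab ▸ hb)⟩
  have hIE : ∀ d ∈ I ++ B, d ∈ r2 := fun d hd => hB.subset hd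
  refine ⟨E1 ++ (r1 ++ ((o0 :: O) ++ r2)), A ++ ((o0 :: O) ++ B), hEnew, ?_, ?_, ?_, ?_, ?_, ?_⟩
  · intro d
    have : d ∈ E1 ++ (r1 ++ ((o0 :: O) ++ r2)) ↔ d ∈ o0 :: O ∨ d ∈ E1 ++ (r1 ++ r2) := by
      simp only [List.mem_append]; tauto
    rw [this, hmO, hmE]
    constructor
    · rintro (⟨h1, h2⟩ | ⟨h1, h2⟩)
      · exact ⟨h1, by rw [h2]; omega⟩
      · exact ⟨h1, by omega⟩
    · rintro ⟨h1, h2⟩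
      rcases Nat.lt_succ_iff_lt_or_eq.1 h2 with h3 | h3
      · exact Or.inr ⟨h1, h3⟩
      · exact Or.inl ⟨h1, M.τ_inj h3⟩
  · refine List.Sublist.append hA (List.Sublist.trans ?_ (List.sublist_append_right _ _))
    exact List.Sublist.append (List.Sublist.refl _) ((List.sublist_append_right _ _).trans hB)
  · intro d
    constructor
    · intro h
      have h' : d ∈ o0 :: O ∨ (d ∈ A ∨ d ∈ B) := by
        simp only [List.mem_append] at h; tauto
      rcases h' with h' | h'
      · refine ⟨by simp only [List.mem_append]; tauto, ?_⟩
        have := (hmO d).1 h'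
        have h2 := this.1
        unfold up at h2; rw [this.2] at h2; exact h2
      · have hdL : d ∈ A ++ i0 :: (I ++ B) := by simp; tauto
        have h2 := (hmL d).1 hdL
        refine ⟨by simp only [List.mem_append] at h2 ⊢; tauto, ?_⟩
        rcases Nat.lt_or_ge (M.τ z) (M.τ (M.src (M.al d))) with h3 | h3
        · exact h3
        · exfalso
          have h4 : M.src (M.al d) = z := M.τ_inj (le_antisymm h3 h2.2)
          have h5 : d ∈ i0 :: I := (hmI d).2 ⟨((hmE d).1 h2.1).1, h4⟩
          have h6 : (A ++ ((i0 :: I) ++ B)).Nodup := by simpa using hnodL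
          rw [List.nodup_append, List.nodup_append] at h6
          rcases h' with h' | h'
          · exact h6.2.2 d h' d (List.mem_append_left _ h5) rfl
          · exact h6.2.1.2.2 d h5 d h' rfl
    · rintro ⟨h1, h2⟩
      have h1' : d ∈ o0 :: O ∨ d ∈ E1 ++ (r1 ++ r2) := by
        simp only [List.mem_append] at h1 ⊢; tauto
      rcases h1' with h1' | h1'
      · simp only [List.mem_append]; tauto
      · have h3 : d ∈ A ++ i0 :: (I ++ B) := (hmL d).2 ⟨h1', by omega⟩
        have h4 : d ∉ i0 :: I := fun h => by
          rw [((hmI d).1 h).2] at h2; omega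
        simp only [List.mem_append, List.mem_cons] at h3 h4 ⊢
        tauto
  · obtain ⟨A', rfl⟩ := hAne; simp
  · have h1 : (A ++ ((i0 :: I) ++ (B ++ [M.ds]))).IsChain M.RR := by simpa using hch
    have h2 : (A ++ ((o0 :: O) ++ (B ++ [M.ds]))).IsChain M.RR := by
      rw [List.isChain_append, List.isChain_append] at h1 ⊢
      refine ⟨h1.1, ⟨hcO, h1.2.1.2.1, ?_⟩, ?_⟩
      · intro x hx y hy
        rw [hl2] at hx
        have hx : o1 = x := by simpa using hx
        subst hx
        have := h1.2.1.2.2 i1 (by rw [hl1]; simp) y hy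
        unfold RR at this ⊢
        rw [← hrf, this]
      · intro x hx y hy
        have hy : o0 = y := by simpa using hy
        subst hy
        have := h1.2.2 x hx i0 (by simp)
        unfold RR at this ⊢
        rw [this, hlf]
    simpa using h2
  · intro z' hz' a b c hs ha hc hb1 hb2
    rcases Nat.lt_succ_iff_lt_or_eq.1 hz' with h3 | h3
    ·
      have hno : ∀ d ∈ o0 :: O, ¬ M.inc d z' := by
        intro d hd hi
        obtain ⟨h4, h5⟩ := (hmO d).1 hd
        unfold up at h4
        rcases hi with hi | hi
        · rw [hi] at h5; rw [h5] at h3; omega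
        · rw [hi, h5] at h4; omega
      have hnb : b ∉ o0 :: O := by
        intro h
        obtain ⟨h4, h5⟩ := (hmO b).1 h
        rw [h5] at hb1; omega
      have hna : a ∉ o0 :: O := fun h => hno a h ha
      have hnc : c ∉ o0 :: O := fun h => hno c h hc
      have h4 := hs.filter (fun d => decide (d ∉ o0 :: O))
      have e1 : [a, b, c].filter (fun d => decide (d ∉ o0 :: O)) = [a, b, c] := by
        rw [List.filter_eq_self]
        intro d hd
        simp only [List.mem_cons, List.not_mem_nil, or_false] at hd
        rcases hd with rfl | rfl | rfl <;> simp only [decide_eq_true_eq] <;> assumption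
      have e2 : (E1 ++ (r1 ++ ((o0 :: O) ++ r2))).filter (fun d => decide (d ∉ o0 :: O)) = E1 ++ (r1 ++ r2) := by
        have : (o0 :: O).filter (fun d => decide (d ∉ o0 :: O)) = [] := by
          rw [List.filter_eq_nil_iff]; intro d hd; simp only [decide_eq_true_eq]; exact fun h => h hd
        rw [List.filter_append, List.filter_append, List.filter_append, this, List.nil_append,
          ← List.filter_append, ← List.filter_append, List.filter_eq_self]
        intro d hd
        rw [decide_eq_true_eq]
        exact fun h => hOE d h hd
      rw [e1, e2] at h4
      exact hst z' h3 a b c h4 ha hc hb1 hb2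
    · have : z' = z := M.τ_inj h3
      subst this
      have hup : ∀ d ∈ E1 ++ (r1 ++ ((o0 :: O) ++ r2)), M.up d := by
        intro d h
        have : d ∈ o0 :: O ∨ d ∈ E1 ++ (r1 ++ r2) := by
          simp only [List.mem_append] at h ⊢; tauto
        rcases this with h | h
        · exact ((hmO d).1 h).1
        · exact ((hmE d).1 h).1
      have hmid : ∀ d ∈ E1 ++ (r1 ++ ((o0 :: O) ++ r2)), M.inc d z' → d ∈ i0 :: ((o0 :: O) ++ I) := by
        intro d hd hi
        have h5 := hup d hd
        rcases hi with hi | hi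
        · have := (hmO d).2 ⟨h5, hi⟩
          simp only [List.mem_append, List.mem_cons] at this ⊢; tauto
        · have := (hmI d).2 ⟨h5, hi⟩
          simp only [List.mem_append, List.mem_cons] at this ⊢; tauto
      have hQ : (A ++ ((i0 :: ((o0 :: O) ++ I)) ++ B)).Sublist (E1 ++ (r1 ++ ((o0 :: O) ++ r2))) := by
        refine List.Sublist.append hA ?_
        have : (i0 :: ((o0 :: O) ++ I)) ++ B = [i0] ++ ((o0 :: O) ++ (I ++ B)) := by simp
        rw [this]
        exact List.Sublist.append (List.singleton_sublist.2 hi0) (List.Sublist.append (List.Sublist.refl _) hB)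
      have haE := hs.subset (show a ∈ [a, b, c] by simp)
      have hbE := hs.subset (show b ∈ [a, b, c] by simp)
      have hcE := hs.subset (show c ∈ [a, b, c] by simp)
      have hbL : b ∈ A ++ i0 :: (I ++ B) := by
        rw [hmL, hmE]; exact ⟨⟨hup b hbE, hb1⟩, hb2.le⟩
      have hbI : b ∉ i0 :: I := fun h => by
        rw [((hmI b).1 h).2] at hb2; omega
      have hbAB : b ∈ A ∨ b ∈ B := by
        simp only [List.mem_append, List.mem_cons] at hbL hbI; tauto
      have sab : [a, b].Sublist [a, b, c] := by simp
      have sbc : [b, c].Sublist [a, b, c] := by simp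
      rcases hbAB with h | h
      · refine no_swap hEnew (sab.trans hs) ((pair_sub_of_mem h ?_).trans hQ)
        exact List.mem_append_left _ (hmid a haE ha)
      · refine no_swap hEnew (sbc.trans hs) (List.Sublist.trans ?_ hQ)
        rw [← List.append_assoc]
        exact pair_sub_of_mem (List.mem_append_right _ (hmid c hcE hc)) h
theorem exists_X : ∃ X : D → ℕ, (∀ d d', M.up d → M.up d' → X d = X d' → d = d') ∧
    ∀ z a b c, M.up a → M.up b → M.up c → M.inc a z → M.inc c z →
      M.τ (M.src b) < M.τ z → M.τ z < M.τ (M.src (M.al b)) → X a < X b → X b < X c → False := by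
  classical
  have hst := M.s0_min M.t0 M.s0_ne_t0.symm
  have : ∀ j, M.τ M.s0 + 1 + j ≤ M.τ M.t0 → M.Inv (M.τ M.s0 + 1 + j) := by
    intro j
    induction j with
    | zero => intro _; exact M.inv_base
    | succ j ih => intro h; exact M.inv_step (M.τ M.s0 + 1 + j) (by omega) (by omega) (ih (by omega))
  have := this (M.τ M.t0 - (M.τ M.s0 + 1)) (by omega)
  rw [show M.τ M.s0 + 1 + (M.τ M.t0 - (M.τ M.s0 + 1)) = M.τ M.t0 by omega] at this
  obtain ⟨E, L, hE, hmE, -, -, -, -, hst⟩ := this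
  have hle : ∀ z, M.τ z ≤ M.τ M.t0 := by
    intro z
    by_cases h : z = M.t0
    · rw [h]
    · exact (M.t0_max z h).le
  have hall : ∀ d, M.up d → d ∈ E := by
    intro d hd
    rw [hmE]
    refine ⟨hd, ?_⟩
    unfold up at hd
    have := hle (M.src (M.al d))
    omega
  refine ⟨fun d => E.idxOf d, fun d d' h h' he => (List.idxOf_inj (hall d h)).1 he, ?_⟩
  intro z a b c ha hb hc hia hic h1 h2 h3 h4
  have hzt := hle (M.src (M.al b))
  refine hst z (by omega) a b c ?_ hia hic h1 h2
  have hbE := hall b hb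
  obtain ⟨E1, E2, rfl⟩ := List.append_of_mem hbE
  have hbn : b ∉ E1 := fun h => (List.nodup_append.1 hE).2.2 b h b (by simp) rfl
  have hib : List.idxOf b (E1 ++ b :: E2) = E1.length := by
    rw [List.idxOf_append_of_notMem hbn]; simp
  have haE : a ∈ E1 := by
    by_contra h
    simp only [hib] at h3
    rw [List.idxOf_append_of_notMem h] at h3; omega
  have hcE : c ∈ E2 := by
    simp only [hib] at h4
    have hcE := hall c hc
    simp only [List.mem_append, List.mem_cons] at hcE
    rcases hcE with h | rfl | h
    · rw [List.idxOf_append_of_mem h] at h4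
      have := List.idxOf_lt_length_iff.2 h; omega
    · omega
    · exact h
  rw [show [a, b, c] = [a] ++ (b :: [c]) from rfl]
  exact List.Sublist.append (List.singleton_sublist.2 haE) (List.Sublist.cons_cons b (List.singleton_sublist.2 hcE))
end STMap
end B4
end RAC

namespace RAC
section Lat
def Sweep (T : Type*) (A : T → T → Prop) : Prop :=
  ∀ (τ : T → ℕ) (s0 t0 : T), Function.Injective τ → A s0 t0 →
    (∀ z, z ≠ s0 → ∃ y, A z y ∧ τ y < τ z) → (∀ z, z ≠ t0 → ∃ y, A z y ∧ τ z < τ y) →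
    ∃ X : T → T → ℕ,
      (∀ a a' b b', A a a' → τ a < τ a' → A b b' → τ b < τ b' → X a a' = X b b' → a = b ∧ a' = b') ∧
      ∀ z a a' b b' c c', A a a' → τ a < τ a' → A b b' → τ b < τ b' → A c c' → τ c < τ c' →
        (a = z ∨ a' = z) → (c = z ∨ c' = z) → τ b < τ z → τ z < τ b' →
        X a a' < X b b' → X b b' < X c c' → False
def nxt (S : Fin 4 → Bool) (i : Fin 4) : Fin 4 :=
  if S (i+1) then i+1 else if S (i+2) then i+2 else if S (i+3) then i+3 else i
def prv (S : Fin 4 → Bool) (i : Fin 4) : Fin 4 :=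
  if S (i+3) then i+3 else if S (i+2) then i+2 else if S (i+1) then i+1 else i
theorem nxt_S : ∀ (S : Fin 4 → Bool) (i : Fin 4), S i = true → S (nxt S i) = true := by decide
theorem prv_S : ∀ (S : Fin 4 → Bool) (i : Fin 4), S i = true → S (prv S i) = true := by decide
theorem prv_nxt : ∀ (S : Fin 4 → Bool) (i : Fin 4), S i = true → prv S (nxt S i) = i := by decide
theorem nxt_prv : ∀ (S : Fin 4 → Bool) (i : Fin 4), S i = true → nxt S (prv S i) = i := by decide
theorem nxt_trans : ∀ (S : Fin 4 → Bool) (i j : Fin 4), S i = true → S j = true →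
    j = i ∨ j = nxt S i ∨ j = nxt S (nxt S i) ∨ j = nxt S (nxt S (nxt S i)) := by decide
theorem nxt_prev : ∀ (S : Fin 4 → Bool) (i : Fin 4), S i = true → S (i+1) = false →
    (S (nxt S i + 3) = false) ∨ (S (i+2) = false ∧ S (i+3) = false) := by decide
def dx : Fin 4 → ℤ := ![1, 0, -1, 0]
def dy : Fin 4 → ℤ := ![0, 1, 0, -1]
def InB (n : ℕ) (x y : ℤ) : Prop := 0 ≤ x ∧ x ≤ n ∧ 0 ≤ y ∧ y ≤ n
instance (n : ℕ) (x y : ℤ) : Decidable (InB n x y) := by unfold InB; infer_instance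
def vld (n : ℕ) (x y : ℤ) (i : Fin 4) : Bool := decide (InB n (x + dx i) (y + dy i))
abbrev LT (n : ℕ) : Type := ↥(Finset.Icc (0:ℤ) n ×ˢ Finset.Icc (0:ℤ) n)
abbrev LD (n : ℕ) : Type :=
  ↥(((Finset.Icc (0:ℤ) n ×ˢ Finset.Icc (0:ℤ) n) ×ˢ (Finset.univ : Finset (Fin 4))).filter
    (fun d => vld n d.1.1 d.1.2 d.2 = true))
abbrev LF (n : ℕ) : Type := Option ↥(Finset.Icc (0:ℤ) (n-1) ×ˢ Finset.Icc (0:ℤ) (n-1))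
def LA {n : ℕ} (p q : LT n) : Prop := ∃ i, q.1.1 = p.1.1 + dx i ∧ q.1.2 = p.1.2 + dy i
theorem mem_LT {n : ℕ} {x y : ℤ} : (x, y) ∈ Finset.Icc (0:ℤ) n ×ˢ Finset.Icc (0:ℤ) n ↔ InB n x y := by
  simp [InB]; tauto
theorem mem_LD {n : ℕ} {x y : ℤ} {i : Fin 4} :
    ((x, y), i) ∈ (((Finset.Icc (0:ℤ) n ×ˢ Finset.Icc (0:ℤ) n) ×ˢ (Finset.univ : Finset (Fin 4))).filter
    (fun d => vld n d.1.1 d.1.2 d.2 = true)) ↔ InB n x y ∧ vld n x y i = true := by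
  rw [Finset.mem_filter, Finset.mem_product, mem_LT]; simp
def mkD {n : ℕ} (x y : ℤ) (i : Fin 4) (h : InB n x y) (h' : vld n x y i = true) : LD n :=
  ⟨((x, y), i), mem_LD.2 ⟨h, h'⟩⟩
theorem vld_iff {n : ℕ} {x y : ℤ} {i : Fin 4} : vld n x y i = true ↔ InB n (x + dx i) (y + dy i) := by
  simp [vld]
theorem opp_d : ∀ i : Fin 4, dx (i+2) = - dx i ∧ dy (i+2) = - dy i := by decide
theorem opp_opp : ∀ i : Fin 4, i + 2 + 2 = i := by decide
def ox : Fin 4 → ℤ := ![0, -1, -1, 0]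
def oy : Fin 4 → ℤ := ![0, 0, -1, -1]
theorem sq_mem {n : ℕ} {x y : ℤ} {i : Fin 4} (h : InB n x y) (h1 : vld n x y i = true)
    (h2 : vld n x y (i+1) = true) :
    (x + ox i, y + oy i) ∈ Finset.Icc (0:ℤ) (n-1) ×ˢ Finset.Icc (0:ℤ) (n-1) := by
  rw [vld_iff] at h1 h2
  simp only [Finset.mem_product, Finset.mem_Icc]
  unfold InB at *
  fin_cases i <;> simp [dx, dy, ox, oy] at * <;> omega
theorem LD_In {n : ℕ} (d : LD n) : InB n d.1.1.1 d.1.1.2 := (mem_LD.1 d.2).1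
theorem LD_v {n : ℕ} (d : LD n) : vld n d.1.1.1 d.1.1.2 d.1.2 = true := (mem_LD.1 d.2).2
theorem nxt_prev' {n : ℕ} {x y : ℤ} {i : Fin 4} (hn : 1 ≤ n) (h : InB n x y) (h1 : vld n x y i = true)
    (h2 : vld n x y (i+1) = false) : vld n x y (nxt (vld n x y) i + 3) = false := by
  rcases nxt_prev (vld n x y) i h1 h2 with h3 | ⟨h3, h4⟩
  · exact h3
  · exfalso
    simp only [vld, decide_eq_false_iff_not] at h2 h3 h4
    unfold InB at *
    fin_cases i <;> simp [dx, dy] at * <;> omega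
theorem corner_out {n : ℕ} {x y : ℤ} {j : Fin 4} (h1 : vld n x y j = true) (h : InB n x y)
   : vld n (x + dx j) (y + dy j) (j + 2 + 1) = vld n x y (j + 3) := by
  rw [vld_iff] at h1
  unfold vld
  congr 1
  unfold InB at *
  fin_cases j <;> simp [dx, dy] at * <;> omega
def lsrc {n : ℕ} (d : LD n) : LT n := ⟨(d.1.1.1, d.1.1.2), mem_LT.2 (LD_In d)⟩
def lal {n : ℕ} (d : LD n) : LD n :=
  mkD (d.1.1.1 + dx d.1.2) (d.1.1.2 + dy d.1.2) (d.1.2 + 2) (vld_iff.1 (LD_v d))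
    (by rw [vld_iff, (opp_d _).1, (opp_d _).2]; simpa using LD_In d)
def lsg {n : ℕ} : Equiv.Perm (LD n) where
  toFun := fun d => mkD d.1.1.1 d.1.1.2 (nxt (vld n d.1.1.1 d.1.1.2) d.1.2) (LD_In d) (nxt_S _ _ (LD_v d))
  invFun := fun d => mkD d.1.1.1 d.1.1.2 (prv (vld n d.1.1.1 d.1.1.2) d.1.2) (LD_In d) (prv_S _ _ (LD_v d))
  left_inv := fun d => by
    apply Subtype.ext
    exact Prod.ext rfl (prv_nxt _ _ (LD_v d))
  right_inv := fun d => by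
    apply Subtype.ext
    exact Prod.ext rfl (nxt_prv _ _ (LD_v d))
def llf {n : ℕ} (d : LD n) : LF n :=
  if h : vld n d.1.1.1 d.1.1.2 (d.1.2 + 1) = true then
      some ⟨(d.1.1.1 + ox d.1.2, d.1.1.2 + oy d.1.2), sq_mem (LD_In d) (LD_v d) h⟩ else none
theorem lal_lal {n : ℕ} (d : LD n) : lal (lal d) = d := by
  apply Subtype.ext
  refine Prod.ext (Prod.ext ?_ ?_) (opp_opp _)
  · show d.1.1.1 + dx d.1.2 + dx (d.1.2 + 2) = d.1.1.1
    rw [(opp_d _).1]; ring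
  · show d.1.1.2 + dy d.1.2 + dy (d.1.2 + 2) = d.1.1.2
    rw [(opp_d _).2]; ring
theorem lsg_trans {n : ℕ} (d d' : LD n) (h : lsrc d = lsrc d') : ∃ k : ℕ, lsg^[k] d = d' := by
  have h0 : d.1.1 = d'.1.1 := congrArg Subtype.val h
  have h' := LD_v d'
  rw [← h0] at h'
  rcases nxt_trans (vld n d.1.1.1 d.1.1.2) d.1.2 d'.1.2 (LD_v d) h' with h | h | h | h
  · exact ⟨0, Subtype.ext (Prod.ext h0 h.symm)⟩
  · exact ⟨1, Subtype.ext (Prod.ext h0 h.symm)⟩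
  · exact ⟨2, Subtype.ext (Prod.ext h0 h.symm)⟩
  · exact ⟨3, Subtype.ext (Prod.ext h0 h.symm)⟩
theorem off_id : ∀ i : Fin 4, dx (i+1) + ox (i+1+2) = ox i ∧ dy (i+1) + oy (i+1+2) = oy i := by decide
theorem four_id : ∀ i : Fin 4, i + 1 + 3 = i := by decide
theorem llf_some {n : ℕ} (d : LD n) (h : vld n d.1.1.1 d.1.1.2 (d.1.2 + 1) = true) (x y : ℤ)
    (hx : d.1.1.1 + ox d.1.2 = x) (hy : d.1.1.2 + oy d.1.2 = y) :
    ∃ hh, llf d = some ⟨(x, y), hh⟩ := by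
  subst hx hy
  exact ⟨sq_mem (LD_In d) (LD_v d) h, dif_pos h⟩
theorem llf_none {n : ℕ} (d : LD n) (h : vld n d.1.1.1 d.1.1.2 (d.1.2 + 1) = false) :
    llf d = none := dif_neg (by simp [h])
theorem llf_eq {n : ℕ} (hn : 1 ≤ n) (d : LD n) : llf (lal (lsg d)) = llf d := by
  have h1 := LD_In d
  have h2 := LD_v d
  have hc := corner_out (nxt_S _ _ h2) h1
  by_cases hv : vld n d.1.1.1 d.1.1.2 (d.1.2 + 1) = true
  · have hnx : nxt (vld n d.1.1.1 d.1.1.2) d.1.2 = d.1.2 + 1 := by unfold nxt; simp [hv]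
    rw [hnx, four_id, h2] at hc
    obtain ⟨_, e1⟩ := llf_some d hv _ _ rfl rfl
    obtain ⟨_, e2⟩ := llf_some (lal (lsg d)) (by
        show vld n (d.1.1.1 + dx (nxt (vld n d.1.1.1 d.1.1.2) d.1.2)) (d.1.1.2 + dy (nxt (vld n d.1.1.1 d.1.1.2) d.1.2)) ((nxt (vld n d.1.1.1 d.1.1.2) d.1.2) + 2 + 1) = true
        rw [hnx]; exact hc) (d.1.1.1 + ox d.1.2) (d.1.1.2 + oy d.1.2) (by
        show d.1.1.1 + dx (nxt (vld n d.1.1.1 d.1.1.2) d.1.2) + ox ((nxt (vld n d.1.1.1 d.1.1.2) d.1.2) + 2) = _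
        rw [hnx, add_assoc, (off_id _).1]) (by
        show d.1.1.2 + dy (nxt (vld n d.1.1.1 d.1.1.2) d.1.2) + oy ((nxt (vld n d.1.1.1 d.1.1.2) d.1.2) + 2) = _
        rw [hnx, add_assoc, (off_id _).2])
    rw [e1, e2]
  · have hv' : vld n d.1.1.1 d.1.1.2 (d.1.2 + 1) = false := by simpa using hv
    rw [llf_none d hv', llf_none]
    show vld n (d.1.1.1 + dx (nxt (vld n d.1.1.1 d.1.1.2) d.1.2)) (d.1.1.2 + dy (nxt (vld n d.1.1.1 d.1.1.2) d.1.2)) ((nxt (vld n d.1.1.1 d.1.1.2) d.1.2) + 2 + 1) = false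
    rw [hc, nxt_prev' hn h1 h2 hv']
theorem llf_surj {n : ℕ} (hn : 1 ≤ n) : Function.Surjective (llf (n := n)) := by
  intro f
  rcases f with _ | ⟨⟨x, y⟩, h⟩
  · refine ⟨mkD 0 n 0 (by unfold InB; omega) (by rw [vld_iff]; simp [dx, dy, InB]; omega), ?_⟩
    apply llf_none
    simp [mkD, vld, dx, dy, InB]
  · simp only [Finset.mem_product, Finset.mem_Icc] at h
    refine ⟨mkD x y 0 (by unfold InB; omega) (by rw [vld_iff]; simp [dx, dy, InB]; omega), ?_⟩
    obtain ⟨_, e⟩ := llf_some (mkD (n := n) x y 0 (by unfold InB; omega) (by rw [vld_iff]; simp [dx, dy, InB]; omega))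
      (by simp [mkD, vld, dx, dy, InB]; omega) x y (by simp [mkD, ox]) (by simp [mkD, oy])
    exact e
def gq (q : ℤ × ℤ) : Fin 4 → ℤ × ℤ := ![(q.1, q.2), (q.2, q.1), (q.1 - 1, q.2), (q.2 - 1, q.1)]
theorem gq_mem {n : ℕ} (d : LD n) : gq d.1.1 d.1.2 ∈ Finset.Icc (0:ℤ) (n-1) ×ˢ Finset.Icc (0:ℤ) n := by
  obtain ⟨⟨⟨x, y⟩, i⟩, hd⟩ := d
  have h1 := (mem_LD.1 hd).1
  have h2 := (mem_LD.1 hd).2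
  rw [vld_iff] at h2
  simp only [Finset.mem_product, Finset.mem_Icc]
  unfold InB at *
  clear hd
  fin_cases i <;> simp [dx, dy, gq] at * <;> omega
theorem gq_inj (i : Fin 4) (q q' : ℤ × ℤ) (h : gq q i = gq q' i) : q = q' := by
  obtain ⟨x, y⟩ := q
  obtain ⟨x', y'⟩ := q'
  fin_cases i <;> simp [gq] at h <;> simp <;> omega
theorem card_LD (n : ℕ) : Fintype.card (LD n) ≤ 4 * (n * (n+1)) := by
  have : Fintype.card (Fin 4 × ↥(Finset.Icc (0:ℤ) (n-1) ×ˢ Finset.Icc (0:ℤ) n)) = 4 * (n * (n+1)) := by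
    rw [Fintype.card_prod, Fintype.card_coe, Finset.card_product]; simp
  rw [← this]
  refine Fintype.card_le_of_injective (fun d => (d.1.2, ⟨gq d.1.1 d.1.2, gq_mem d⟩)) ?_
  intro d d' h
  simp only [Prod.mk.injEq, Subtype.mk.injEq] at h
  apply Subtype.ext
  refine Prod.ext (gq_inj d.1.2 _ _ ?_) h.1
  rw [h.2, h.1]
theorem lat_euler (n : ℕ) : Fintype.card (LD n) + 4 ≤ 2 * Fintype.card (LT n) + 2 * Fintype.card (LF n) := by
  have c1 : Fintype.card (LT n) = (n+1)*(n+1) := by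
    rw [Fintype.card_coe, Finset.card_product]; simp
  have c2 : Fintype.card (LF n) = n*n + 1 := by
    rw [Fintype.card_option, Fintype.card_coe, Finset.card_product]; simp
  have c3 := card_LD n
  rw [c1, c2]
  nlinarith
def latMap (n : ℕ) (hn : 1 ≤ n) : PMap (LD n) (LT n) (LF n) where
  src := lsrc
  al := lal
  sg := lsg
  lf := llf
  al_al := lal_lal
  src_sg _ := rfl
  trans := lsg_trans
  lf_eq := llf_eq hn
  lf_surj := llf_surj hn
  euler := lat_euler n
theorem l_noloop {n : ℕ} (d : LD n) : lsrc (lal d) ≠ lsrc d := by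
  intro h
  have h := congrArg Subtype.val h
  have h1 : d.1.1.1 + dx d.1.2 = d.1.1.1 := congrArg Prod.fst h
  have h2 : d.1.1.2 + dy d.1.2 = d.1.1.2 := congrArg Prod.snd h
  have key : ∀ i : Fin 4, dx i = 0 → dy i = 0 → False := by decide
  exact key d.1.2 (by omega) (by omega)
theorem l_dart {n : ℕ} (a b : LT n) (h : LA a b) : ∃ d : LD n, lsrc d = a ∧ lsrc (lal d) = b := by
  obtain ⟨⟨x, y⟩, ha⟩ := a
  obtain ⟨⟨x', y'⟩, hb⟩ := b
  obtain ⟨i, h1, h2⟩ := h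
  simp only at h1 h2
  subst h1 h2
  exact ⟨mkD x y i (mem_LT.1 ha) (vld_iff.2 (mem_LT.1 hb)), rfl, rfl⟩
theorem sweep_lat (n : ℕ) (hn : 1 ≤ n) : Sweep (LT n) (LA (n := n)) := by
  classical
  intro τ s0 t0 hτ hst hlow hhigh
  have hd : ∀ a b : LT n, LA a b → ∃ d : LD n, (latMap n hn).src d = a ∧ (latMap n hn).src ((latMap n hn).al d) = b := l_dart
  obtain ⟨ds, hds, hds'⟩ := hd s0 t0 hst
  let M : STMap (LD n) (LT n) (LF n) :=
    { latMap n hn with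
      τ := τ
      τ_inj := hτ
      noloop := l_noloop
      s0 := s0
      t0 := t0
      ds := ds
      src_ds := hds
      tgt_ds := hds'
      lower := by
        intro z hz
        obtain ⟨y, hy, hy'⟩ := hlow z hz
        obtain ⟨d, h1, h2⟩ := hd z y hy
        exact ⟨d, h1, by rw [h2]; exact hy'⟩
      higher := by
        intro z hz
        obtain ⟨y, hy, hy'⟩ := hhigh z hz
        obtain ⟨d, h1, h2⟩ := hd z y hy
        exact ⟨d, h1, by rw [h2]; exact hy'⟩ }
  obtain ⟨X, hX, hX'⟩ := M.exists_X
  have hd2 : ∀ a b : LT n, LA a b → ∃ d : LD n, lsrc d = a ∧ lsrc (lal d) = b := l_dart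
  haveI : Nonempty (LD n) := ⟨M.ds⟩
  choose! δ hδ using hd2
  have hδ1 : ∀ a b, LA a b → M.src (δ a b) = a := fun a b h => (hδ a b h).1
  have hδ2 : ∀ a b, LA a b → M.src (M.al (δ a b)) = b := fun a b h => (hδ a b h).2
  have hup : ∀ a b, LA a b → τ a < τ b → M.up (δ a b) := by
    intro a b h h'
    unfold STMap.up
    rw [hδ1 a b h, hδ2 a b h]; exact h'
  refine ⟨fun a b => X (δ a b), ?_, ?_⟩
  · intro a a' b b' h1 h2 h3 h4 he
    have := hX _ _ (hup a a' h1 h2) (hup b b' h3 h4) he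
    refine ⟨?_, ?_⟩
    · rw [← hδ1 a a' h1, this, hδ1 b b' h3]
    · rw [← hδ2 a a' h1, this, hδ2 b b' h3]
  · intro z a a' b b' c c' h1 h2 h3 h4 h5 h6 h7 h8 h9 h10 h11 h12
    refine hX' z _ _ _ (hup _ _ h1 h2) (hup _ _ h3 h4) (hup _ _ h5 h6) ?_ ?_ ?_ ?_ h11 h12
    · unfold STMap.inc; rw [hδ1 _ _ h1, hδ2 _ _ h1]; exact h7
    · unfold STMap.inc; rw [hδ1 _ _ h5, hδ2 _ _ h5]; exact h8
    · rw [hδ1 _ _ h3]; exact h9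
    · rw [hδ2 _ _ h3]; exact h10
end Lat
end RAC

namespace RAC
section C1
open Relation
theorem rtg_mono {α : Type*} {r s : α → α → Prop} {x y : α} (h : ReflTransGen r x y)
    (hrs : ∀ a b, r a b → s a b) : ReflTransGen s x y := by
  induction h with
  | refl => exact .refl
  | tail _ h ih => exact ih.tail (hrs _ _ h)
theorem st_order_on {α : Type*} [Finite α] {R : α → α → Prop} {lo hi : α → Prop} (S : Set α)
    (hs : ∀ x y, R x y → R y x)
    (hconn : ∀ x ∈ S, ∀ y ∈ S, ReflTransGen (fun a b => R a b ∧ b ∈ S) x y)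
    (hlo : ∃ x ∈ S, lo x) (hhi : ∃ x ∈ S, hi x)
    (h : ∀ x ∈ S, ∀ w ∈ S, x ≠ w → ∃ y ∈ S, (lo y ∨ hi y) ∧
      ReflTransGen (fun a b => (R a b ∧ b ∈ S) ∧ b ≠ w) x y) :
    ∃ τ : α → ℕ, InjOn τ S ∧ ∀ x ∈ S, (lo x ∨ ∃ y ∈ S, R x y ∧ τ y < τ x) ∧
      (hi x ∨ ∃ y ∈ S, R x y ∧ τ x < τ y) := by
  classical
  have key : ∀ (Q : α → Prop) (x y : α) (hx : x ∈ S) (hy : y ∈ S),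
      ReflTransGen (fun a b => (R a b ∧ b ∈ S) ∧ Q b) x y →
      ReflTransGen (fun a b : S => R a b ∧ Q b) ⟨x, hx⟩ ⟨y, hy⟩ := by
    intro Q x y hx hy hr
    induction hr with
    | refl => exact .refl
    | tail _ hbc ih =>
      rename_i b c _
      by_cases hb : b ∈ S
      · exact (ih hb).tail ⟨hbc.1.1, hbc.2⟩
      · rename_i hab
        cases hab with
        | refl => exact absurd hx hb
        | tail _ h' => exact absurd h'.1.2 hb
  obtain ⟨x0, hx0, hx0'⟩ := hlo
  obtain ⟨x1, hx1, hx1'⟩ := hhi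
  obtain ⟨τ, hτ, hτ'⟩ := st_order (α := S) (R := fun a b => R a b) (lo := fun a => lo a)
    (hi := fun a => hi a) (fun x y h => hs _ _ h)
    (fun x y => by
      have := key (fun _ => True) x y x.2 y.2 (rtg_mono (hconn x x.2 y y.2) (fun a b h => ⟨h, trivial⟩))
      exact rtg_mono this (fun a b h => h.1))
    ⟨⟨x0, hx0⟩, hx0'⟩ ⟨⟨x1, hx1⟩, hx1'⟩
    (fun x w hxw => by
      obtain ⟨y, hy, h1, h2⟩ := h x x.2 w w.2 (fun e => hxw (Subtype.ext e))
      exact ⟨⟨y, hy⟩, h1, rtg_mono (key (fun b => b ≠ w) x y x.2 hy h2)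
        (fun a b h => ⟨h.1, fun e => h.2 (congrArg _ e)⟩)⟩)
  refine ⟨fun x => if hx : x ∈ S then τ ⟨x, hx⟩ else 0, ?_, ?_⟩
  · intro x hx y hy hxy
    simp only [hx, hy, dif_pos] at hxy
    exact congrArg Subtype.val (hτ hxy)
  · intro x hx
    obtain ⟨h1, h2⟩ := hτ' ⟨x, hx⟩
    refine ⟨h1.imp id ?_, h2.imp id ?_⟩
    · rintro ⟨y, hy, hy'⟩
      refine ⟨y, y.2, hy, ?_⟩
      simp only [hx, y.2, dif_pos]; exact hy'
    · rintro ⟨y, hy, hy'⟩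
      refine ⟨y, y.2, hy, ?_⟩
      simp only [hx, y.2, dif_pos]; exact hy'
variable {T K : Type*} (A : T → T → Prop) (P : Set K)
def Gam (c : T → K) (a b : K) : Prop := a ≠ b ∧ ∃ z z', A z z' ∧ c z = a ∧ c z' = b
structure Col (c : T → K) : Prop where
  conn : ∀ z z', c z = c z' → ReflTransGen (fun a b => A a b ∧ c b = c z) z z'
  ind : ∀ p v, p ∈ P → Gam A c p v → v ∉ P
  two : ∀ p ∈ P, p ∈ range c → ∃ v v', v ≠ v' ∧ Gam A c p v ∧ Gam A c p v'
  ring : ∀ p ∈ P, ∀ q v v', Gam A c p v → Gam A c p v' → v ≠ q → v' ≠ q →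
    ReflTransGen (fun a b => Gam A c a b ∧ (Gam A c p a ∧ a ≠ q) ∧ (Gam A c p b ∧ b ≠ q)) v v'
def LayoutR (c : T → K) (r : K) : Prop :=
  ∃ y X : K → ℕ, InjOn y (range c \ P) ∧ InjOn X (range c ∩ P) ∧
    (∀ g w a b g1 g2, g ∈ P → g1 ∈ P → g2 ∈ P → w ∈ range c → w ∉ P → Gam A c g a → Gam A c g b → y a < y w →
      y w < y b → Gam A c g1 w → Gam A c g2 w → X g1 < X g → X g < X g2 → False) ∧
    ∀ v ∈ range c \ P, v ≠ r → y r < y v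
variable {A P}
theorem Gam.symm (hA : ∀ x y, A x y → A y x) {c : T → K} {a b : K} (h : Gam A c a b) : Gam A c b a := by
  obtain ⟨h0, z, z', h1, h2, h3⟩ := h
  exact ⟨h0.symm, z', z, hA _ _ h1, h3, h2⟩
theorem Gam.left {c : T → K} {a b : K} (h : Gam A c a b) : a ∈ range c := by
  obtain ⟨h0, z, z', h1, h2, h3⟩ := h
  exact ⟨z, h2⟩
theorem Gam.right {c : T → K} {a b : K} (h : Gam A c a b) : b ∈ range c := by
  obtain ⟨h0, z, z', h1, h2, h3⟩ := h
  exact ⟨z', h3⟩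
open Classical in
noncomputable def rec1 (c : T → K) (Q : Set K) (k : K) (z : T) : K := if c z ∈ Q then k else c z
theorem rec1_gam (hA : ∀ x y, A x y → A y x) {c : T → K} {Q : Set K} {k : K}
    (hcl : ∀ a b, Gam A c a b → a ∈ Q → b ∈ Q ∨ b = k) {a b : K} (ha : a ≠ k) :
    Gam A (rec1 c Q k) a b ↔ a ∉ Q ∧ Gam A c a b := by
  constructor
  · rintro ⟨h0, z, z', h1, h2, h3⟩
    unfold rec1 at h2 h3
    split_ifs at h2 with hz
    · exact absurd h2.symm ha
    · subst h2
      refine ⟨hz, h0, z, z', h1, rfl, ?_⟩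
      split_ifs at h3 with hz'
      · rcases hcl _ _ ⟨by rintro h; rw [h] at hz'; exact hz hz', z', z, hA _ _ h1, rfl, rfl⟩ hz' with h | h
        · exact absurd h hz
        · exact absurd h ha
      · exact h3
  · rintro ⟨ha', h0, z, z', h1, h2, h3⟩
    refine ⟨h0, z, z', h1, ?_, ?_⟩
    · unfold rec1; rw [h2, if_neg ha']
    · unfold rec1; rw [h3, if_neg]
      intro hb
      rcases hcl _ _ (Gam.symm hA ⟨h0, z, z', h1, h2, h3⟩) hb with h | h
      · exact ha' h
      · exact ha h
theorem rec1_range {c : T → K} {Q : Set K} {k : K} (hk : k ∉ Q) (hkr : k ∈ range c) {a : K} :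
    a ∈ range (rec1 c Q k) ↔ a ∈ range c ∧ a ∉ Q := by
  constructor
  · rintro ⟨z, hz⟩
    unfold rec1 at hz
    split_ifs at hz with h
    · subst hz; exact ⟨hkr, hk⟩
    · subst hz; exact ⟨⟨z, rfl⟩, h⟩
  · rintro ⟨⟨z, hz⟩, h⟩
    exact ⟨z, by unfold rec1; rw [hz, if_neg h]⟩
theorem rtg_symm {α : Type*} {R : α → α → Prop} (hs : ∀ x y, R x y → R y x) {x y : α}
    (h : ReflTransGen R x y) : ReflTransGen R y x := by
  induction h with
  | refl => exact .refl
  | tail _ h ih => exact .head (hs _ _ h) ih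
theorem rec1_col (hA : ∀ x y, A x y → A y x) (hTc : ∀ x y, ReflTransGen A x y)
    {c : T → K} {Q : Set K} {k : K} (hk : k ∉ Q) (hkr : k ∈ range c) (hkP : k ∉ P)
    (hcl : ∀ a b, Gam A c a b → a ∈ Q → b ∈ Q ∨ b = k) (hc : Col A P c) : Col A P (rec1 c Q k) := by
  have hg := fun {a b : K} (ha : a ≠ k) => rec1_gam hA hcl (a := a) (b := b) ha
  have hPk : ∀ p ∈ P, p ≠ k := by rintro p hp rfl; exact hkP hp
  refine ⟨?_, ?_, ?_, ?_⟩
  · intro z z' hzz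
    by_cases hzk : rec1 c Q k z = k
    · obtain ⟨z0, hz0⟩ := hkr
      have key : ∀ x, rec1 c Q k x = k →
          ReflTransGen (fun a b => A a b ∧ rec1 c Q k a = k ∧ rec1 c Q k b = k) x z0 := by
        intro x
        have := hTc x z0
        induction this using ReflTransGen.head_induction_on with
        | refl => intro _; exact .refl
        | head h1 _ ih =>
          rename_i a b _
          intro ha
          by_cases hb : rec1 c Q k b = k
          · exact .head ⟨h1, ha, hb⟩ (ih hb)
          · by_cases hak : c a = k
            · have := hc.conn a z0 (by rw [hak, hz0])
              have h2 : ∀ y, c y = k → rec1 c Q k y = k := by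
                intro y hy; unfold rec1; rw [hy, if_neg hk]
              have h3 : ∀ y, ReflTransGen (fun u v => A u v ∧ c v = c a) a y → c y = k ∧
                ReflTransGen (fun a b => A a b ∧ rec1 c Q k a = k ∧ rec1 c Q k b = k) a y := by
                intro y hy
                induction hy with
                | refl => exact ⟨hak, .refl⟩
                | tail _ h ih' =>
                  refine ⟨by rw [h.2, hak], ih'.2.tail ⟨h.1, h2 _ ih'.1, h2 _ (by rw [h.2, hak])⟩⟩
              exact (h3 z0 this).2
            · exfalso
              unfold rec1 at ha hb
              split_ifs at ha with h3
              · split_ifs at hb with h4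
                · exact hb rfl
                · rcases hcl (c a) (c b) ⟨fun e => h4 (e ▸ h3), a, b, h1, rfl, rfl⟩ h3 with h | h
                  · exact h4 h
                  · exact hb h
              · exact hak ha
      rw [hzk] at hzz ⊢
      have h1 := key z hzk
      have h2 := rtg_symm (fun x y h => ⟨hA _ _ h.1, h.2.2, h.2.1⟩) (key z' hzz.symm)
      exact rtg_mono (h1.trans h2) (fun a b h => ⟨h.1, h.2.2⟩)
    · have h1 : ∀ y, rec1 c Q k y = rec1 c Q k z → c y = c z := by
        intro y hy
        unfold rec1 at hy hzk
        split_ifs at hy hzk <;> simp_all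
      have hzQ : c z ∉ Q := by intro h; exact hzk (by unfold rec1; rw [if_pos h])
      refine rtg_mono (hc.conn z z' (h1 z' hzz.symm).symm) (fun a b h => ⟨h.1, ?_⟩)
      unfold rec1; rw [h.2]
  · intro p v hp h
    exact hc.ind p v hp ((hg (hPk p hp)).1 h).2
  · intro p hp hr
    obtain ⟨h1, h2⟩ := (rec1_range hk hkr).1 hr
    obtain ⟨v, v', h3, h4, h5⟩ := hc.two p hp h1
    exact ⟨v, v', h3, (hg (hPk p hp)).2 ⟨h2, h4⟩, (hg (hPk p hp)).2 ⟨h2, h5⟩⟩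
  · intro p hp q v v' h1 h2 h3 h4
    have hpk := hPk p hp
    obtain ⟨h5, h6⟩ := (hg hpk).1 h1
    have := hc.ring p hp q v v' h6 ((hg hpk).1 h2).2 h3 h4
    refine rtg_mono this (fun a b h => ⟨?_, ⟨(hg hpk).2 ⟨h5, h.2.1.1⟩, h.2.1.2⟩, (hg hpk).2 ⟨h5, h.2.2.1⟩, h.2.2.2⟩)
    have hnQ : ∀ a, Gam A c p a → a ∉ Q := by
      intro a ha haQ
      rcases hcl _ _ (ha.symm hA) haQ with h | h
      · exact h5 h
      · exact hpk h
    obtain ⟨⟨h0, z, z', e1, e2, e3⟩, h7, h8⟩ := h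
    refine ⟨h0, z, z', e1, ?_, ?_⟩
    · unfold rec1; rw [e2, if_neg (hnQ _ h7.1)]
    · unfold rec1; rw [e3, if_neg (hnQ _ h8.1)]
end C1
end RAC

namespace RAC
section C2
open Relation
variable {T K : Type*} {A : T → T → Prop} {P : Set K}
theorem glue [Finite K] (hA : ∀ x y, A x y → A y x) {c : T → K} {k r : K} {Q : Set K}
    (hk : k ∉ Q) (hkr : k ∈ range c) (hkP : k ∉ P) (hr : r ∉ Q)
    (hcl : ∀ a b, Gam A c a b → a ∈ Q → b ∈ Q ∨ b = k)
    (L1 : LayoutR A P (rec1 c Q k) r) (L2 : LayoutR A P (rec1 c {a | a ∉ Q ∧ a ≠ k} k) k) :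
    LayoutR A P c r := by
  classical
  have hk' : k ∉ {a | a ∉ Q ∧ a ≠ k} := fun h => h.2 rfl
  have hcl' : ∀ a b, Gam A c a b → a ∈ {a | a ∉ Q ∧ a ≠ k} → b ∈ {a | a ∉ Q ∧ a ≠ k} ∨ b = k := by
    intro a b h ha
    by_cases hb : b = k
    · exact Or.inr hb
    · left
      refine ⟨fun hb' => ?_, hb⟩
      rcases hcl _ _ (h.symm hA) hb' with h | h
      · exact ha.1 h
      · exact ha.2 h
  have g1 := fun {a b : K} (ha : a ≠ k) => rec1_gam hA hcl (a := a) (b := b) ha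
  have g2 := fun {a b : K} (ha : a ≠ k) => rec1_gam hA hcl' (a := a) (b := b) ha
  have r1 := fun {a : K} => rec1_range hk hkr (a := a)
  have r2 := fun {a : K} => rec1_range hk' hkr (a := a)
  have hPk : ∀ p ∈ P, p ≠ k := by rintro p hp rfl; exact hkP hp
  obtain ⟨y1, X1, yi1, Xi1, st1, rt1⟩ := L1
  obtain ⟨y2, X2, yi2, Xi2, st2, rt2⟩ := L2
  obtain ⟨M, hM⟩ : ∃ M, ∀ v, y2 v + 1 < M := by
    obtain ⟨B, hB⟩ := (Set.finite_range y2).bddAbove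
    exact ⟨B + 2, fun v => by have := hB ⟨v, rfl⟩; omega⟩
  obtain ⟨N, hN⟩ : ∃ M, ∀ v, X2 v + 1 < M := by
    obtain ⟨B, hB⟩ := (Set.finite_range X2).bddAbove
    exact ⟨B + 2, fun v => by have := hB ⟨v, rfl⟩; omega⟩
  obtain ⟨m, hm1, hm2⟩ : ∃ m, (∀ g ∈ P, g ∉ Q → Gam A c g k → X1 g ≤ m) ∧
      ((∃ g ∈ P, g ∉ Q ∧ Gam A c g k) → ∃ e ∈ P, e ∉ Q ∧ Gam A c e k ∧ X1 e = m) := by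
    by_cases h : ∃ g ∈ P, g ∉ Q ∧ Gam A c g k
    · have hf : Set.Finite {g | g ∈ P ∧ g ∉ Q ∧ Gam A c g k} := Set.toFinite _
      obtain ⟨e, he, he'⟩ := hf.exists_maximalFor X1 _ h
      refine ⟨X1 e, fun g h1 h2 h3 => ?_, fun _ => ⟨e, he.1, he.2.1, he.2.2, rfl⟩⟩
      by_contra hlt
      have := he' (j := g) ⟨h1, h2, h3⟩ (by omega)
      omega
    · refine ⟨0, fun g h1 h2 h3 => absurd ⟨g, h1, h2, h3⟩ h, fun h' => absurd h' h⟩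
  let y : K → ℕ := fun v => if v ∈ Q then M * y1 k + 1 + y2 v else M * y1 v
  let X : K → ℕ := fun g => if g ∈ Q then N * m + 1 + X2 g else N * (X1 g + 1)
  have y_in : ∀ v, v ∈ Q → y v = M * y1 k + 1 + y2 v := fun v h => if_pos h
  have y_out : ∀ v, v ∉ Q → y v = M * y1 v := fun v h => if_neg h
  have X_in : ∀ v, v ∈ Q → X v = N * m + 1 + X2 v := fun v h => if_pos h
  have X_out : ∀ v, v ∉ Q → X v = N * (X1 v + 1) := fun v h => if_neg h
  have M0 : 0 < M := by have := hM k; omega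
  have N0 : 0 < N := by have := hN k; omega
  have cmul : ∀ {M : ℕ}, 0 < M → ∀ {a b : ℕ}, M * a < M * b ↔ a < b := by
    intro M h a b; exact Nat.mul_lt_mul_left h
  have blk : ∀ {M a b x : ℕ}, x + 1 < M → (M * a < M * b + 1 + x ↔ a ≤ b) := by
    intro M a b x hx
    constructor
    · intro h; by_contra hlt
      have : M * (b + 1) ≤ M * a := Nat.mul_le_mul_left _ (by omega)
      rw [mul_add, mul_one] at this; omega
    · intro h; have : M * a ≤ M * b := Nat.mul_le_mul_left _ h
      omega
  have blk2 : ∀ {M a b x : ℕ}, x + 1 < M → (M * b + 1 + x < M * a ↔ b < a) := by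
    intro M a b x hx
    constructor
    · intro h; by_contra hlt
      have := (blk (a := a) (b := b) hx).2 (by omega); omega
    · intro h
      have : M * (b + 1) ≤ M * a := Nat.mul_le_mul_left _ (by omega)
      rw [mul_add, mul_one] at this; omega
  have m1 : ∀ v, v ∈ range c \ P → v ∉ Q → v ∈ range (rec1 c Q k) \ P := fun v h h' => ⟨r1.2 ⟨h.1, h'⟩, h.2⟩
  have m2 : ∀ v, v ∈ range c \ P → v ∈ Q → v ∈ range (rec1 c {a | a ∉ Q ∧ a ≠ k} k) \ P :=
    fun v h h' => ⟨r2.2 ⟨h.1, fun h => h.1 h'⟩, h.2⟩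
  have n1 : ∀ v, v ∈ range c ∩ P → v ∉ Q → v ∈ range (rec1 c Q k) ∩ P := fun v h h' => ⟨r1.2 ⟨h.1, h'⟩, h.2⟩
  have n2 : ∀ v, v ∈ range c ∩ P → v ∈ Q → v ∈ range (rec1 c {a | a ∉ Q ∧ a ≠ k} k) ∩ P :=
    fun v h h' => ⟨r2.2 ⟨h.1, fun h => h.1 h'⟩, h.2⟩
  have ne1 : ∀ v w, v ∈ Q → w ∉ Q → y v ≠ y w := by
    intro v w hv hw h
    rw [y_in v hv, y_out w hw] at h
    have a := (blk (a := y1 w) (b := y1 k) (hM v))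
    have b := (blk2 (a := y1 w) (b := y1 k) (hM v))
    omega
  have ne2 : ∀ v w, v ∈ Q → w ∉ Q → X v ≠ X w := by
    intro v w hv hw h
    rw [X_in v hv, X_out w hw] at h
    have a := (blk (a := X1 w + 1) (b := m) (hN v))
    have b := (blk2 (a := X1 w + 1) (b := m) (hN v))
    omega
  have corQ : ∀ g v, g ∈ P → Gam A c g v → v ∈ Q → g ∈ Q := by
    intro g v hg h hv
    rcases hcl _ _ (h.symm hA) hv with h | h
    · exact h
    · exact absurd h (hPk g hg)
  refine ⟨y, X, ?_, ?_, ?_, ?_⟩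
  · intro v hv w hw h
    by_cases h1 : v ∈ Q <;> by_cases h2 : w ∈ Q
    · rw [y_in v h1, y_in w h2] at h
      exact yi2 (m2 v hv h1) (m2 w hw h2) (by omega)
    · exact absurd h (ne1 v w h1 h2)
    · exact absurd h.symm (ne1 w v h2 h1)
    · rw [y_out v h1, y_out w h2] at h
      exact yi1 (m1 v hv h1) (m1 w hw h2) (Nat.eq_of_mul_eq_mul_left M0 h)
  · intro v hv w hw h
    by_cases h1 : v ∈ Q <;> by_cases h2 : w ∈ Q
    · rw [X_in v h1, X_in w h2] at h
      exact Xi2 (n2 v hv h1) (n2 w hw h2) (by omega)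
    · exact absurd h (ne2 v w h1 h2)
    · exact absurd h.symm (ne2 w v h2 h1)
    · rw [X_out v h1, X_out w h2] at h
      exact Xi1 (n1 v hv h1) (n1 w hw h2) (by have := Nat.eq_of_mul_eq_mul_left N0 h; omega)
  · intro g w a b u v hg hu hv hw hwP ha hb haw hwb huw hvw hug hgv
    have hgk := hPk g hg
    have huk := hPk u hu
    have hvk := hPk v hv
    by_cases hgQ : g ∈ Q
    ·
      have hgQ' : g ∉ {a | a ∉ Q ∧ a ≠ k} := fun h => h.1 hgQ
      have low : ∀ a, Gam A c g a → a ∈ Q ∨ a = k := fun a ha => hcl _ _ ha hgQ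
      have hwQ : w ∈ Q := by
        by_contra hwQ
        rw [y_out w hwQ] at haw hwb
        have h1 : y1 k ≤ y1 w := by
          rcases low a ha with h | h
          · rw [y_in a h, blk2 (hM a)] at haw; omega
          · subst h; rw [y_out a hk, cmul M0] at haw; omega
        have h2 : y1 w < y1 k ∨ (y1 w ≤ y1 k ∧ b ∈ Q) := by
          rcases low b hb with h | h
          · rw [y_in b h, blk (hM b)] at hwb; exact Or.inr ⟨hwb, h⟩
          · subst h; rw [y_out b hk, cmul M0] at hwb; omega
        rcases low a ha with h | h
        · rw [y_in a h, blk2 (hM a)] at haw; omega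
        · subst h; rw [y_out a hk, cmul M0] at haw; omega
      have huQ := corQ u w hu huw hwQ
      have hvQ := corQ v w hv hvw hwQ
      have hwk : w ≠ k := by rintro rfl; exact hk hwQ
      rw [X_in _ hgQ, X_in _ huQ] at hug
      rw [X_in _ hgQ, X_in _ hvQ] at hgv
      have aw : y2 a < y2 w := by
        rcases low a ha with h | h
        · rw [y_in a h, y_in w hwQ] at haw; omega
        · subst h; exact rt2 w (m2 w ⟨hw, hwP⟩ hwQ) hwk
      have wb : y2 w < y2 b := by
        rcases low b hb with h | h
        · rw [y_in b h, y_in w hwQ] at hwb; omega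
        · subst h; rw [y_out b hk, y_in w hwQ, blk2 (hM w)] at hwb; omega
      refine st2 g w a b u v hg hu hv (m2 w ⟨hw, hwP⟩ hwQ).1 hwP ((g2 hgk).2 ⟨hgQ', ha⟩)
        ((g2 hgk).2 ⟨hgQ', hb⟩) aw wb ((g2 huk).2 ⟨fun h => h.1 huQ, huw⟩)
        ((g2 hvk).2 ⟨fun h => h.1 hvQ, hvw⟩) (by omega) (by omega)
    · have haQ : a ∉ Q := fun h => hgQ (corQ g a hg ha h)
      have hbQ : b ∉ Q := fun h => hgQ (corQ g b hg hb h)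
      rw [X_out g hgQ] at hug hgv
      have uin : u ∈ Q → m ≤ X1 g := by
        intro h; rw [X_in u h, blk2 (hN u)] at hug; omega
      have vin : v ∈ Q → X1 g < m := by
        intro h; rw [X_in v h, blk (hN v)] at hgv; omega
      have uout : u ∉ Q → X1 u < X1 g := by
        intro h; rw [X_out u h, cmul N0] at hug; omega
      have vout : v ∉ Q → X1 g < X1 v := by
        intro h; rw [X_out v h, cmul N0] at hgv; omega
      by_cases hwQ : w ∈ Q
      · have huQ := corQ u w hu huw hwQ
        have hvQ := corQ v w hv hvw hwQ
        have := uin huQ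
        have := vin hvQ
        omega
      · rw [y_out a haQ, y_out w hwQ, cmul M0] at haw
        rw [y_out b hbQ, y_out w hwQ, cmul M0] at hwb
        have fin : ∀ u v, u ∈ P → v ∈ P → u ∉ Q → v ∉ Q → Gam A c u w → Gam A c v w → X1 u < X1 g → X1 g < X1 v → False := by
          intro u v hu hv huQ hvQ huw hvw h1 h2
          exact st1 g w a b u v hg hu hv (m1 w ⟨hw, hwP⟩ hwQ).1 hwP ((g1 hgk).2 ⟨hgQ, ha⟩) ((g1 hgk).2 ⟨hgQ, hb⟩)
            haw hwb ((g1 (hPk u hu)).2 ⟨huQ, huw⟩) ((g1 (hPk v hv)).2 ⟨hvQ, hvw⟩) h1 h2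
        have wk : ∀ u ∈ P, u ∈ Q → Gam A c u w → w = k := by
          intro u hu huQ h
          rcases hcl _ _ h huQ with h | h
          · exact absurd h hwQ
          · exact h
        by_cases huQ : u ∈ Q <;> by_cases hvQ : v ∈ Q
        · have := uin huQ
          have := vin hvQ
          omega
        · have hh := wk u hu huQ huw
          subst hh
          have := hm1 v hv hvQ hvw
          have := uin huQ
          have := vout hvQ
          omega
        · have hh := wk v hv hvQ hvw
          subst hh
          obtain ⟨e, he, he1, he2, he3⟩ := hm2 ⟨u, hu, huQ, huw⟩
          exact fin u e hu he huQ he1 huw he2 (uout huQ) (by rw [he3]; exact vin hvQ)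
        · exact fin u v hu hv huQ hvQ huw hvw (uout huQ) (vout hvQ)
  · intro v hv hvr
    rw [y_out r hr]
    by_cases hvQ : v ∈ Q
    · rw [y_in v hvQ, blk (hM v)]
      by_cases h : k = r
      · rw [h]
      · exact (rt1 k (m1 k ⟨hkr, hkP⟩ hk) h).le
    · rw [y_out v hvQ, cmul M0]
      exact rt1 v (m1 v hv hvQ) hvr
end C2
end RAC

namespace RAC
section C3
open Relation
variable {T K : Type*} {A : T → T → Prop} {P : Set K}
theorem vconn (hA : ∀ x y, A x y → A y x) (hTc : ∀ x y, ReflTransGen A x y)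
    {c : T → K} (hc : Col A P c) {x y : K} (hx : x ∈ range c \ P) (hy : y ∈ range c \ P) :
    ReflTransGen (fun a b => Gam A c a b ∧ b ∈ range c \ P) x y := by
  obtain ⟨⟨z, rfl⟩, hzP⟩ := hx
  obtain ⟨⟨z', rfl⟩, hzP'⟩ := hy
  have key : ∀ z, (c z ∉ P → ReflTransGen (fun a b => Gam A c a b ∧ b ∈ range c \ P) (c z) (c z')) ∧
      (c z ∈ P → ∀ v, Gam A c (c z) v → ReflTransGen (fun a b => Gam A c a b ∧ b ∈ range c \ P) v (c z')) := by
    intro z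
    have := hTc z z'
    induction this using ReflTransGen.head_induction_on with
    | refl => exact ⟨fun _ => .refl, fun h => absurd h hzP'⟩
    | head h1 _ ih =>
      rename_i a b _
      by_cases hab : c a = c b
      · rw [hab]; exact ih
      · have g : Gam A c (c a) (c b) := ⟨hab, a, b, h1, rfl, rfl⟩
        refine ⟨fun ha => ?_, fun ha v hv => ?_⟩
        · by_cases hb : c b ∈ P
          · exact ih.2 hb _ (g.symm hA)
          · exact .head ⟨g, g.right, hb⟩ (ih.1 hb)
        · have hb : c b ∉ P := hc.ind _ _ ha g
          refine ReflTransGen.trans (rtg_mono (hc.ring (c a) ha (c a) v (c b) hv g hv.1.symm g.1.symm) ?_) (ih.1 hb)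
          intro u w h
          exact ⟨h.1, h.1.right, hc.ind _ _ ha h.2.2.1⟩
  exact (key z).1 hzP
structure Lev (c : T → K) (y : K → ℕ) (κ : K → ℕ) (w0 : K → K) (r t : K) : Prop where
  inj : InjOn κ (range c)
  mono : ∀ v w, v ∈ range c \ P → w ∈ range c \ P → (κ v < κ w ↔ y v < y w)
  w0c : ∀ p ∈ P, p ∈ range c → Gam A c p (w0 p)
  w0lt : ∀ p ∈ P, p ∈ range c → κ (w0 p) < κ p
  ltc : ∀ p ∈ P, p ∈ range c → ∀ v, v ∈ range c \ P → κ (w0 p) < κ v → κ p < κ v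
  w0min : ∀ p ∈ P, ∀ v, Gam A c p v → v ≠ w0 p → κ (w0 p) < κ v
  lower : ∀ l ∈ range c, l ≠ r → ∃ l', l' ∉ P ∧ Gam A c l l' ∧ κ l' < κ l
  higher : ∀ l ∈ range c, l ≠ t → ∃ l', Gam A c l l' ∧ κ l < κ l'
theorem exists_lev [Finite K] {c : T → K} (hc : Col A P c) {y : K → ℕ} {r t : K}
    (yi : InjOn y (range c \ P))
    (ylo : ∀ x ∈ range c \ P, x = r ∨ ∃ v ∈ range c \ P, Gam A c x v ∧ y v < y x)
    (yhi : ∀ x ∈ range c \ P, x = t ∨ ∃ v ∈ range c \ P, Gam A c x v ∧ y x < y v) :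
    ∃ κ w0, Lev (A := A) (P := P) c y κ w0 r t := by
  classical
  have hw : ∀ p, ∃ w, p ∈ P → p ∈ range c → Gam A c p w ∧ ∀ v, Gam A c p v → v ≠ w → y w < y v := by
    intro p
    by_cases hp : p ∈ P ∧ p ∈ range c
    · obtain ⟨v, _, _, hv, _⟩ := hc.two p hp.1 hp.2
      have hf : Set.Finite {g | Gam A c p g} := Set.toFinite _
      obtain ⟨w, h1, h2⟩ := hf.exists_minimalFor y _ ⟨v, hv⟩
      refine ⟨w, fun _ _ => ⟨h1, fun v hv hvw => ?_⟩⟩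
      have h3 : ¬ y v < y w := fun h => by have := h2 hv h.le; omega
      rcases Nat.lt_trichotomy (y w) (y v) with h | h | h
      · exact h
      · exact absurd (yi ⟨h1.right, hc.ind _ _ hp.1 h1⟩ ⟨hv.right, hc.ind _ _ hp.1 hv⟩ h).symm hvw
      · exact absurd h h3
    · exact ⟨p, fun h1 h2 => absurd ⟨h1, h2⟩ hp⟩
  choose w0 hw0 using hw
  obtain ⟨n, ⟨e⟩⟩ := Finite.exists_equiv_fin K
  let N := n + 1
  let κ : K → ℕ := fun k => if k ∈ P then N * y (w0 k) + 1 + (e k) else N * y k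
  have κP : ∀ p, p ∈ P → κ p = N * y (w0 p) + 1 + (e p) := fun p h => if_pos h
  have κS : ∀ p, p ∉ P → κ p = N * y p := fun p h => if_neg h
  have N0 : 0 < N := Nat.succ_pos _
  have b1 : ∀ (p : K) (a b : ℕ), a ≤ b → N * a < N * b + 1 + (e p) := by
    intro p a b h
    have := Nat.mul_le_mul_left N h
    omega
  have b2 : ∀ (p : K) (a b : ℕ), a < b → N * a + 1 + (e p) < N * b + 1 := by
    intro p a b h
    have := Nat.mul_le_mul_left N (show a + 1 ≤ b from h)
    rw [mul_add, mul_one] at this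
    have := (e p).2
    omega
  have w0S : ∀ p ∈ P, p ∈ range c → w0 p ∈ range c \ P := fun p h h' =>
    ⟨(hw0 p h h').1.right, hc.ind _ _ h (hw0 p h h').1⟩
  have SN : ∀ v w, v ∈ range c \ P → w ∈ range c \ P → (κ v < κ w ↔ y v < y w) := by
    intro v w hv hw
    rw [κS v hv.2, κS w hw.2]; exact Nat.mul_lt_mul_left N0
  have PS : ∀ p ∈ P, p ∈ range c → ∀ v, v ∈ range c \ P → (κ p < κ v ↔ y (w0 p) < y v) := by
    intro p hp hpr v hv
    rw [κP p hp, κS v hv.2]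
    constructor
    · intro h; by_contra hh
      have := b1 p _ _ (show y v ≤ y (w0 p) by omega); omega
    · intro h
      have h1 := Nat.mul_le_mul_left N (show y (w0 p) + 1 ≤ y v from h)
      rw [mul_add, mul_one] at h1
      have := (e p).2
      omega
  have SP : ∀ p ∈ P, p ∈ range c → ∀ v, v ∈ range c \ P → (κ v < κ p ↔ y v ≤ y (w0 p)) := by
    intro p hp hpr v hv
    rw [κP p hp, κS v hv.2]
    constructor
    · intro h; by_contra hh
      have h1 := Nat.mul_le_mul_left N (show y (w0 p) + 1 ≤ y v by omega)
      rw [mul_add, mul_one] at h1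
      have := (e p).2
      omega
    · intro h; exact b1 p _ _ h
  refine ⟨κ, w0, ?_, SN, ?_, ?_, ?_, ?_, ?_, ?_⟩
  · intro a ha b hb hab
    by_cases h1 : a ∈ P <;> by_cases h2 : b ∈ P
    · rw [κP a h1, κP b h2] at hab
      have h3 : y (w0 a) = y (w0 b) := by
        rcases Nat.lt_trichotomy (y (w0 a)) (y (w0 b)) with h | h | h
        · have := b2 a _ _ h; omega
        · exact h
        · have := b2 b _ _ h; omega
      rw [h3] at hab
      exact e.injective (Fin.ext (by omega))
    · have := PS a h1 ha b ⟨hb, h2⟩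
      have := SP a h1 ha b ⟨hb, h2⟩
      omega
    · have := PS b h2 hb a ⟨ha, h1⟩
      have := SP b h2 hb a ⟨ha, h1⟩
      omega
    · rw [κS a h1, κS b h2] at hab
      exact yi ⟨ha, h1⟩ ⟨hb, h2⟩ (Nat.eq_of_mul_eq_mul_left N0 hab)
  · exact fun p hp hr => (hw0 p hp hr).1
  · intro p hp hr; rw [SP p hp hr _ (w0S p hp hr)]
  · intro p hp hr v hv h
    rw [PS p hp hr v hv]; rwa [SN _ _ (w0S p hp hr) hv] at h
  · intro p hp v hv hvw
    rw [SN _ _ (w0S p hp hv.left) ⟨hv.right, hc.ind _ _ hp hv⟩]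
    exact (hw0 p hp hv.left).2 v hv hvw
  · intro l hl hlr
    by_cases hP : l ∈ P
    · exact ⟨w0 l, (w0S l hP hl).2, (hw0 l hP hl).1, (SP l hP hl _ (w0S l hP hl)).2 le_rfl⟩
    · rcases ylo l ⟨hl, hP⟩ with h | ⟨v, hv, h1, h2⟩
      · exact absurd h hlr
      · exact ⟨v, hv.2, h1, (SN _ _ hv ⟨hl, hP⟩).2 h2⟩
  · intro l hl hlr
    by_cases hP : l ∈ P
    · obtain ⟨v, v', h1, h2, h3⟩ := hc.two l hP hl
      obtain ⟨u, hu, hu'⟩ : ∃ u, Gam A c l u ∧ u ≠ w0 l := by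
        by_cases h : v = w0 l
        · exact ⟨v', h3, by rw [← h]; exact h1.symm⟩
        · exact ⟨v, h2, h⟩
      exact ⟨u, hu, (PS l hP hl u ⟨hu.right, hc.ind _ _ hP hu⟩).2 ((hw0 l hP hl).2 u hu hu')⟩
    · rcases yhi l ⟨hl, hP⟩ with h | ⟨v, hv, h1, h2⟩
      · exact absurd h hlr
      · exact ⟨v, h1, (SN _ _ ⟨hl, hP⟩ hv).2 h2⟩
end C3
end RAC

namespace RAC
section C4
open Relation
variable {T K : Type*} {A : T → T → Prop} {P : Set K}
theorem first_exit {R : T → T → Prop} {F : Set T} {x y : T} (h : ReflTransGen R x y) (hx : x ∈ F)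
    (hy : y ∉ F) : ∃ u v, u ∈ F ∧ v ∉ F ∧ R u v ∧ ReflTransGen (fun a b => R a b ∧ b ∈ F) x u := by
  induction h with
  | refl => exact absurd hx hy
  | tail _ h ih =>
    rename_i b c _
    by_cases hb : b ∈ F
    ·
      by_contra hcon
      push Not at hcon
      have key : ∀ u, ReflTransGen R x u → u ∈ F ∧ ReflTransGen (fun a b => R a b ∧ b ∈ F) x u := by
        intro u hu
        induction hu with
        | refl => exact ⟨hx, .refl⟩
        | tail _ h2 ih2 =>
          rename_i d e _
          by_cases he : e ∈ F
          · exact ⟨he, ih2.2.tail ⟨h2, he⟩⟩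
          · exact absurd ih2.2 (hcon d e ih2.1 he h2)
      rename_i hxb
      exact hy (key c (hxb.tail h)).1
    · exact ih hb
theorem exists_tau [Finite T] (hA : ∀ x y, A x y → A y x)
    (hT : ∀ w x y, x ≠ w → y ≠ w → ReflTransGen (fun a b => A a b ∧ b ≠ w) x y)
    {c : T → K} (hc : Col A P c) {y κ : K → ℕ} {w0 : K → K} {r t : K} (hrt : r ≠ t)
    (L : Lev (A := A) (P := P) c y κ w0 r t) {s0 t0 : T} (hs0 : c s0 = r) (ht0 : c t0 = t) :
    ∃ τ : T → ℕ, Function.Injective τ ∧ (∀ a b, κ (c a) < κ (c b) → τ a < τ b) ∧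
    (∀ z, z ≠ s0 → ∃ y, A z y ∧ τ y < τ z) ∧ (∀ z, z ≠ t0 → ∃ y, A z y ∧ τ z < τ y) := by
  classical
  let lo : T → Prop := fun z => z = s0 ∨ ∃ z', A z z' ∧ κ (c z') < κ (c z)
  let hi : T → Prop := fun z => z = t0 ∨ ∃ z', A z z' ∧ κ (c z) < κ (c z')
  have key : ∀ l : K, ∃ σ : T → ℕ, l ∈ range c → InjOn σ {z | c z = l} ∧ ∀ x ∈ {z | c z = l},
      (lo x ∨ ∃ y ∈ {z | c z = l}, A x y ∧ σ y < σ x) ∧ (hi x ∨ ∃ y ∈ {z | c z = l}, A x y ∧ σ x < σ y) := by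
    intro l
    by_cases hl : l ∈ range c
    swap
    · exact ⟨fun _ => 0, fun h => absurd h hl⟩
    have := st_order_on (R := A) (lo := lo) (hi := hi) {z | c z = l} hA
      (by
        intro x hx y hy
        have := hc.conn x y (hx.trans hy.symm)
        refine rtg_mono this (fun a b h => ⟨h.1, h.2.trans hx⟩))
      (by
        by_cases h : l = r
        · exact ⟨s0, by rw [h]; exact hs0, Or.inl rfl⟩
        · obtain ⟨l', _, ⟨_, z, z', h1, h2, h3⟩, h4⟩ := L.lower l hl h
          exact ⟨z, h2, Or.inr ⟨z', h1, by rw [h2, h3]; exact h4⟩⟩)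
      (by
        by_cases h : l = t
        · exact ⟨t0, by rw [h]; exact ht0, Or.inl rfl⟩
        · obtain ⟨l', ⟨_, z, z', h1, h2, h3⟩, h4⟩ := L.higher l hl h
          exact ⟨z, h2, Or.inr ⟨z', h1, by rw [h2, h3]; exact h4⟩⟩)
      (by
        intro x hx w hw hxw
        obtain ⟨o, ho⟩ : ∃ o, c o ≠ l := by
          by_cases h : l = r
          · exact ⟨t0, by rw [ht0, h]; exact hrt.symm⟩
          · exact ⟨s0, by rw [hs0]; exact fun e => h e.symm⟩
        have how : o ≠ w := by rintro rfl; exact ho hw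
        obtain ⟨u, v, hu, hv, huv, hp⟩ := first_exit (F := {z | c z = l}) (hT w x o hxw how) hx ho
        refine ⟨u, hu, ?_, rtg_mono hp (fun a b h => ⟨⟨h.1.1, h.2⟩, h.1.2⟩)⟩
        have hne : κ (c v) ≠ κ (c u) := fun e => hv ((L.inj ⟨v, rfl⟩ ⟨u, rfl⟩ e).trans hu)
        rcases Nat.lt_or_gt_of_ne hne with h | h
        · exact Or.inl (Or.inr ⟨v, huv.1, h⟩)
        · exact Or.inr (Or.inr ⟨v, huv.1, h⟩))
    obtain ⟨σ, h1, h2⟩ := this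
    exact ⟨σ, fun _ => ⟨h1, h2⟩⟩
  choose σ hσ using key
  obtain ⟨B, hB⟩ : ∃ B, ∀ z, σ (c z) z < B := by
    obtain ⟨B, hB⟩ := (Set.finite_range (fun z => σ (c z) z)).bddAbove
    exact ⟨B + 1, fun v => by have := hB ⟨v, rfl⟩; simp only at this; omega⟩
  have lt : ∀ a b, κ (c a) < κ (c b) → B * κ (c a) + σ (c a) a < B * κ (c b) + σ (c b) b := by
    intro a b h
    have := Nat.mul_le_mul_left B (show κ (c a) + 1 ≤ κ (c b) from h)
    rw [mul_add, mul_one] at this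
    have := hB a
    omega
  refine ⟨fun z => B * κ (c z) + σ (c z) z, ?_, lt, ?_, ?_⟩
  · intro a b hab
    simp only at hab
    have h1 : κ (c a) = κ (c b) := by
      rcases Nat.lt_trichotomy (κ (c a)) (κ (c b)) with h | h | h
      · have := lt a b h; omega
      · exact h
      · have := lt b a h; omega
    have h2 := L.inj ⟨a, rfl⟩ ⟨b, rfl⟩ h1
    rw [h2] at hab
    exact (hσ (c b) ⟨b, rfl⟩).1 h2 rfl (by omega)
  · intro z hz
    rcases ((hσ (c z) ⟨z, rfl⟩).2 z rfl).1 with (h | ⟨z', h1, h2⟩) | ⟨y, hy, h1, h2⟩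
    · exact absurd h hz
    · exact ⟨z', h1, lt _ _ h2⟩
    · refine ⟨y, h1, ?_⟩
      have : c y = c z := hy
      simp only [this]; omega
  · intro z hz
    rcases ((hσ (c z) ⟨z, rfl⟩).2 z rfl).2 with (h | ⟨z', h1, h2⟩) | ⟨y, hy, h1, h2⟩
    · exact absurd h hz
    · exact ⟨z', h1, lt _ _ h2⟩
    · refine ⟨y, h1, ?_⟩
      have : c y = c z := hy
      simp only [this]; omega
theorem color_star (hA : ∀ x y, A x y → A y x) {c : T → K} (hc : Col A P c) {κ : K → ℕ} {τ : T → ℕ}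
    (hτ : Function.Injective τ) (hAi : ∀ x, ¬ A x x) (hlt : ∀ a b, κ (c a) < κ (c b) → τ a < τ b) {X : T → T → ℕ}
    (hX : ∀ a a' b b', A a a' → τ a < τ a' → A b b' → τ b < τ b' → X a a' = X b b' → a = b ∧ a' = b')
    (hX' : ∀ z a a' b b' c c', A a a' → τ a < τ a' → A b b' → τ b < τ b' → A c c' → τ c < τ c' →
        (a = z ∨ a' = z) → (c = z ∨ c' = z) → τ b < τ z → τ z < τ b' →
        X a a' < X b b' → X b b' < X c c' → False)
    (l : K) (a a' b b' d d' : T) (ha : A a a') (ha' : τ a < τ a') (hb : A b b')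
    (hd : A d d') (hd' : τ d < τ d') (hal : c a = l ∨ c a' = l) (hdl : c d = l ∨ c d' = l)
    (hbl : κ (c b) < κ l) (hlb : κ l < κ (c b')) : X a a' < X b b' ↔ X d d' < X b b' := by
  have hb' : τ b < τ b' := hlt _ _ (hbl.trans hlb)
  have ne : ∀ e e', A e e' → τ e < τ e' → (c e = l ∨ c e' = l) → X e e' ≠ X b b' := by
    intro e e' h1 h2 h3 h4
    obtain ⟨rfl, rfl⟩ := hX _ _ _ _ h1 h2 hb hb' h4
    rcases h3 with h | h
    · rw [h] at hbl; omega
    · rw [h] at hlb; omega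
  have one : ∀ z, c z = l → ∀ e e' f f', A e e' → τ e < τ e' → A f f' → τ f < τ f' → (e = z ∨ e' = z) →
      (f = z ∨ f' = z) → X e e' < X b b' → X f f' < X b b' := by
    intro z hz e e' f f' h1 h2 h3 h4 h5 h6 h7
    have h8 := ne f f' h3 h4 (by rcases h6 with rfl | rfl <;> simp [hz])
    by_contra h9
    exact hX' z e e' b b' f f' h1 h2 hb hb' h3 h4 h5 h6 (hlt _ _ (by rw [hz]; exact hbl))
      (hlt _ _ (by rw [hz]; exact hlb)) h7 (by omega)
  have walk : ∀ z z', c z = l → ReflTransGen (fun u v => A u v ∧ c v = c z) z z' → ∀ e e' f f', A e e' → τ e < τ e' → A f f' → τ f < τ f' → (e = z ∨ e' = z) →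
      (f = z' ∨ f' = z') → X e e' < X b b' → X f f' < X b b' := by
    intro z z' hz hzz
    induction hzz with
    | refl => exact one z hz
    | tail hxy h ih =>
      rename_i u v
      intro e e' f f' h1 h2 h3 h4 h5 h6 h7
      have hu : c u = l := by
        cases hxy with
        | refl => exact hz
        | tail _ h => exact h.2.trans hz
      rcases Nat.lt_or_gt_of_ne (fun he => hAi u (by have := hτ he; rw [← this] at h; exact h.1) : τ u ≠ τ v) with hh | hh
      · have := ih e e' u v h1 h2 h.1 hh h5 (Or.inl rfl) h7
        exact one v (h.2.trans hz) u v f f' h.1 hh h3 h4 (Or.inr rfl) h6 this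
      · have := ih e e' v u h1 h2 (hA _ _ h.1) hh h5 (Or.inr rfl) h7
        exact one v (h.2.trans hz) v u f f' (hA _ _ h.1) hh h3 h4 (Or.inl rfl) h6 this
  have main : ∀ a a' d d', A a a' → τ a < τ a' → A d d' → τ d < τ d' → (c a = l ∨ c a' = l) → (c d = l ∨ c d' = l) →
      X a a' < X b b' → X d d' < X b b' := by
    intro a a' d d' h1 h2 h3 h4 h5 h6 h7
    obtain ⟨z, hz, hz'⟩ : ∃ z, c z = l ∧ (a = z ∨ a' = z) := by
      rcases h5 with h | h
      · exact ⟨a, h, Or.inl rfl⟩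
      · exact ⟨a', h, Or.inr rfl⟩
    obtain ⟨u, hu, hu'⟩ : ∃ z, c z = l ∧ (d = z ∨ d' = z) := by
      rcases h6 with h | h
      · exact ⟨d, h, Or.inl rfl⟩
      · exact ⟨d', h, Or.inr rfl⟩
    exact walk z u hz (hc.conn z u (hz.trans hu.symm)) a a' d d' h1 h2 h3 h4 hz' hu' h7
  exact ⟨main _ _ _ _ ha ha' hd hd' hal hdl, main _ _ _ _ hd hd' ha ha' hdl hal⟩
end C4
end RAC

namespace RAC
section C5
open Relation
variable {T K : Type*} {A : T → T → Prop} {P : Set K}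
theorem base_layout [Finite T] [Finite K] (hA : ∀ x y, A x y → A y x) (hAi : ∀ x, ¬ A x x) (hS : Sweep T A)
    (hT : ∀ w x y, x ≠ w → y ≠ w → ReflTransGen (fun a b => A a b ∧ b ≠ w) x y)
    {c : T → K} (hc : Col A P c) {y : K → ℕ} {r t : K} (hrt : Gam A c r t) (hr : r ∉ P)
    (yi : InjOn y (range c \ P))
    (ylo : ∀ x ∈ range c \ P, x = r ∨ ∃ v ∈ range c \ P, Gam A c x v ∧ y v < y x)
    (yhi : ∀ x ∈ range c \ P, x = t ∨ ∃ v ∈ range c \ P, Gam A c x v ∧ y x < y v) :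
    LayoutR A P c r := by
  classical
  obtain ⟨κ, w0, L⟩ := exists_lev hc yi ylo yhi
  obtain ⟨hne, s0, t0, hst, hs0, ht0⟩ := hrt
  obtain ⟨τ, hτ, hlt, hlow, hhigh⟩ := exists_tau hA hT hc hne L hs0 ht0
  obtain ⟨X, hX, hX'⟩ := hS τ s0 t0 hτ hst hlow hhigh
  have cs := color_star hA hc hτ hAi hlt hX hX'
  have hf : ∀ p, ∃ d : T × T, p ∈ P → p ∈ range c → A d.1 d.2 ∧ c d.1 = p ∧ Gam A c p (c d.2) ∧
      κ p < κ (c d.2) ∧ ∀ v, Gam A c p v → v ≠ c d.2 → κ v < κ (c d.2) := by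
    intro p
    by_cases hp : p ∈ P ∧ p ∈ range c
    · have hfin : Set.Finite {g | Gam A c p g} := Set.toFinite _
      obtain ⟨w, h1, h2⟩ := hfin.exists_maximalFor κ _ ⟨w0 p, L.w0c p hp.1 hp.2⟩
      obtain ⟨_, z, z', h3, h4, h5⟩ := id h1
      refine ⟨(z, z'), fun _ _ => ⟨h3, h4, by rw [h5]; exact h1, ?_, ?_⟩⟩
      · simp only [h5]
        obtain ⟨u, u', hu1, hu2, hu3⟩ := hc.two p hp.1 hp.2
        have hw : w ≠ w0 p := by
          rintro rfl
          have : ∀ u, Gam A c p u → u = w0 p := by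
            intro u hu
            by_contra hne
            have := L.w0min p hp.1 u hu hne
            have := h2 hu this.le
            omega
          exact hu1 ((this u hu2).trans (this u' hu3).symm)
        exact L.ltc p hp.1 hp.2 w ⟨h1.right, hc.ind _ _ hp.1 h1⟩ (L.w0min p hp.1 w h1 hw)
      · simp only [h5]
        intro v hv hvw
        have h6 : κ v ≠ κ w := fun e => hvw (L.inj hv.right h1.right e)
        by_contra h7
        have := h2 hv (by omega)
        omega
    · obtain ⟨z⟩ : Nonempty T := ⟨s0⟩
      exact ⟨(z, z), fun h1 h2 => absurd ⟨h1, h2⟩ hp⟩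
  choose f hf using hf
  have rS : r ∈ range c \ P := ⟨⟨s0, hs0⟩, hr⟩
  have root : ∀ v ∈ range c \ P, v ≠ r → y r < y v := by
    have hfin : Set.Finite (range c \ P) := Set.toFinite _
    obtain ⟨m, hm, hm'⟩ := hfin.exists_minimalFor y _ ⟨r, rS⟩
    rcases ylo m hm with h | ⟨v, hv, _, h⟩
    · subst h
      intro v hv hvr
      have : y v ≠ y m := fun e => hvr (yi hv hm e)
      by_contra h1
      have := hm' hv (by omega)
      omega
    · have := hm' hv h.le; omega
  refine ⟨y, fun p => X (f p).1 (f p).2, yi, ?_, ?_, root⟩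
  · intro p hp q hq h
    obtain ⟨p1, p2, p3, p4, _⟩ := hf p hp.2 hp.1
    obtain ⟨q1, q2, q3, q4, _⟩ := hf q hq.2 hq.1
    have := (hX _ _ _ _ p1 (hlt _ _ (by rw [p2]; exact p4)) q1 (hlt _ _ (by rw [q2]; exact q4)) h).1
    rw [← p2, ← q2, this]
  · intro g w a b g1 g2 hg hg1 hg2 hw hwP ha hb haw hwb hw1 hw2 hx1 hx2
    have hgr := ha.left
    obtain ⟨p1, p2, p3, p4, p5⟩ := hf g hg hgr
    have hwS : w ∈ range c \ P := ⟨hw, hwP⟩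
    have haS : a ∈ range c \ P := ⟨ha.right, hc.ind _ _ hg ha⟩
    have hbS : b ∈ range c \ P := ⟨hb.right, hc.ind _ _ hg hb⟩
    rw [← L.mono _ _ haS hwS] at haw
    rw [← L.mono _ _ hwS hbS] at hwb
    have hgw : κ g < κ w := by
      refine L.ltc g hg hgr w hwS ?_
      by_cases h : a = w0 g
      · rw [← h]; exact haw
      · exact (L.w0min g hg a ha h).trans haw
    have hwt : κ w < κ (c (f g).2) := by
      by_cases h : b = c (f g).2
      · rw [← h]; exact hwb
      · exact hwb.trans (p5 b hb h)
    have claim : ∀ p ∈ P, Gam A c p w → p ≠ g → ∃ e e', A e e' ∧ τ e < τ e' ∧ (c e = w ∨ c e' = w) ∧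
        (X (f p).1 (f p).2 < X (f g).1 (f g).2 ↔ X e e' < X (f g).1 (f g).2) := by
      intro p hp hpw hpg
      have hpr := hpw.left
      obtain ⟨q1, q2, q3, q4, q5⟩ := hf p hp hpr
      have q6 : τ (f p).1 < τ (f p).2 := hlt _ _ (by rw [q2]; exact q4)
      by_cases h1 : w = c (f p).2
      · exact ⟨_, _, q1, q6, Or.inr h1.symm, Iff.rfl⟩
      by_cases h2 : w = w0 p
      · obtain ⟨hh, z, z', h3, h4, h5⟩ := hpw
        have h6 : κ w < κ p := by rw [h2]; exact L.w0lt p hp hpr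
        refine ⟨z', z, hA _ _ h3, hlt _ _ (by rw [h4, h5]; exact h6), Or.inl h5, ?_⟩
        refine cs p _ _ _ _ _ _ q1 q6 p1 (hA _ _ h3) (hlt _ _ (by rw [h4, h5]; exact h6)) (Or.inl q2)
          (Or.inr h4) (by rw [p2]; omega) ?_
        exact L.ltc p hp hpr _ ⟨⟨_, rfl⟩, hc.ind _ _ hg p3⟩ (by rw [← h2]; exact hwt)
      · obtain ⟨hh, z, z', h3, h4, h5⟩ := id hpw
        have h6 : κ p < κ w := L.ltc p hp hpr w hwS (L.w0min p hp w hpw h2)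
        have h7 : κ w < κ (c (f p).2) := q5 w hpw h1
        have h8 : τ z < τ z' := hlt _ _ (by rw [h4, h5]; exact h6)
        refine ⟨z, z', h3, h8, Or.inr h5, ?_⟩
        have desc : ∀ n a b, κ (c a) = n → A a b → κ (c a) < κ (c b) → c a ≠ p → κ p < κ (c b) → κ (c a) < κ w →
            (X (f p).1 (f p).2 < X a b ↔ X z z' < X a b) := by
          intro n
          induction n using Nat.strong_induction_on with
          | _ n ih =>
            intro a b hn hab hup hap hpb haw
            by_cases hh : κ (c a) < κ p
            · exact cs p _ _ _ _ _ _ q1 q6 hab h3 h8 (Or.inl q2) (Or.inl h4) hh hpb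
            · have hne : κ (c a) ≠ κ p := fun e => hap (L.inj ⟨a, rfl⟩ hpr e)
              have hpa : κ p < κ (c a) := by omega
              have har : c a ≠ r := by
                intro e
                have h10 := L.w0lt p hp hpr
                have h11 : w0 p ∈ range c \ P := ⟨(L.w0c p hp hpr).right, hc.ind _ _ hp (L.w0c p hp hpr)⟩
                have h12 : κ (w0 p) < κ r := by rw [← e]; omega
                rw [L.mono _ _ h11 rS] at h12
                have := root _ h11 (by rintro rfl; omega)
                omega
              obtain ⟨l', hl'P, ⟨_, a', b', k1, k2, k3⟩, hl'⟩ := L.lower (c a) ⟨a, rfl⟩ har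
              have hba : A b' a' := hA _ _ k1
              have hlt' : κ (c b') < κ (c a') := by rw [k2, k3]; exact hl'
              have hbp : c b' ≠ p := by rw [k3]; rintro rfl; exact hl'P hp
              have IH := ih (κ (c b')) (by rw [k3]; omega) b' a' rfl hba hlt' hbp (by rw [k2]; exact hpa)
                (by rw [k3]; omega)
              have t1 : τ a < τ b := hlt _ _ hup
              have t2 : τ b' < τ a' := hlt _ _ hlt'
              have B1 := cs (c a) a b (f p).1 (f p).2 b' a' hab t1 q1 hba t2 (Or.inl rfl) (Or.inr k2)
                (by rw [q2]; exact hpa) (by omega)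
              have B2 := cs (c a) a b z z' b' a' hab t1 h3 hba t2 (Or.inl rfl) (Or.inr k2)
                (by rw [h4]; exact hpa) (by rw [h5]; exact haw)
              have n1 : X a b ≠ X (f p).1 (f p).2 := fun e =>
                hap (by rw [(hX _ _ _ _ hab t1 q1 q6 e).1]; exact q2)
              have n2 : X a b ≠ X z z' := fun e =>
                hap (by rw [(hX _ _ _ _ hab t1 h3 h8 e).1]; exact h4)
              have n3 : X b' a' ≠ X (f p).1 (f p).2 := fun e =>
                hbp (by rw [(hX _ _ _ _ hba t2 q1 q6 e).1]; exact q2)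
              have n4 : X b' a' ≠ X z z' := fun e =>
                hbp (by rw [(hX _ _ _ _ hba t2 h3 h8 e).1]; exact h4)
              omega
        exact desc _ _ _ rfl p1 (by rw [p2]; exact p4) (by rw [p2]; exact hpg.symm) (by omega) (by rw [p2]; exact hgw)
    simp only at hx1 hx2
    obtain ⟨e, e', e1, e2, e3, e4⟩ := claim g1 hg1 hw1 (by rintro rfl; omega)
    obtain ⟨d, d', d1, d2, d3, d4⟩ := claim g2 hg2 hw2 (by rintro rfl; omega)
    have := cs w e e' (f g).1 (f g).2 d d' e1 e2 p1 d1 d2 e3 d3 (by rw [p2]; exact hgw) hwt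
    have h1 := e4.1 hx1
    have h2 := d4.2 (this.1 h1)
    omega
theorem layout_all [Finite T] [Finite K] (hA : ∀ x y, A x y → A y x) (hAi : ∀ x, ¬ A x x) (hS : Sweep T A)
    (hTc : ∀ x y, ReflTransGen A x y)
    (hT : ∀ w x y, x ≠ w → y ≠ w → ReflTransGen (fun a b => A a b ∧ b ≠ w) x y) :
    ∀ (n : ℕ) (c : T → K) (r : K), (range c).ncard = n → Col A P c → r ∈ range c \ P → LayoutR A P c r := by
  classical
  intro n
  induction n using Nat.strong_induction_on with
  | _ n ih =>
    intro c r hn hc hr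
    by_cases hone : ∀ v ∈ range c \ P, v = r
    · refine ⟨fun _ => 0, fun _ => 0, ?_, ?_, ?_, ?_⟩
      · intro a ha b hb _; rw [hone a ha, hone b hb]
      · intro p hp q hq _
        obtain ⟨v, v', h1, h2, h3⟩ := hc.two p hp.2 hp.1
        exact absurd ((hone v ⟨h2.right, hc.ind _ _ hp.2 h2⟩).trans (hone v' ⟨h3.right, hc.ind _ _ hp.2 h3⟩).symm) h1
      · intro g w a b g1 g2 _ _ _ _ _ _ _ h; simp at h
      · intro v hv hvr; exact absurd (hone v hv) hvr
    push Not at hone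
    obtain ⟨v0, hv0, hv0r⟩ := hone
    have vc := fun {x y : K} (hx : x ∈ range c \ P) (hy : y ∈ range c \ P) => vconn hA hTc hc hx hy
    by_cases hcut : ∃ k ∈ range c \ P, ∃ K2 : Set K, K2.Nonempty ∧ K2 ⊆ range c \ P ∧ k ∉ K2 ∧ r ∉ K2 ∧
        (∃ u ∈ range c \ P, u ≠ k ∧ u ∉ K2) ∧ ∀ a b, Gam A c a b → a ∈ K2 → b ∉ P → b ≠ k → b ∈ K2
    · obtain ⟨k, hk, K2, ⟨x2, hx2⟩, hK2, hkK, hrK, ⟨u, hu, huk, huK⟩, hcl⟩ := hcut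
      let Q : Set K := K2 ∪ {p | p ∈ P ∧ ∃ v ∈ K2, Gam A c p v}
      have hkQ : k ∉ Q := by
        rintro (h | h)
        · exact hkK h
        · exact hk.2 h.1
      have hrQ : r ∉ Q := by
        rintro (h | h)
        · exact hrK h
        · exact hr.2 h.1
      have huQ : u ∉ Q := by
        rintro (h | h)
        · exact huK h
        · exact hu.2 h.1
      have hclQ : ∀ a b, Gam A c a b → a ∈ Q → b ∈ Q ∨ b = k := by
        intro a b h ha
        by_cases hbk : b = k
        · exact Or.inr hbk
        left
        rcases ha with ha | ⟨haP, v, hv, hav⟩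
        · by_cases hb : b ∈ P
          · exact Or.inr ⟨hb, a, ha, h.symm hA⟩
          · exact Or.inl (hcl a b h ha hb hbk)
        · left
          have hvk : v ≠ k := by rintro rfl; exact hkK hv
          have := hc.ring a haP k v b hav h hvk hbk
          clear h hbk
          induction this with
          | refl => exact hv
          | tail _ hh ih' => exact hcl _ _ hh.1 ih' (hc.ind _ _ haP hh.2.2.1) hh.2.2.2
      have hclQ' : ∀ a b, Gam A c a b → a ∈ {a | a ∉ Q ∧ a ≠ k} → b ∈ {a | a ∉ Q ∧ a ≠ k} ∨ b = k := by
        intro a b h ha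
        by_cases hb : b = k
        · exact Or.inr hb
        · left
          refine ⟨fun hb' => ?_, hb⟩
          rcases hclQ _ _ (h.symm hA) hb' with h | h
          · exact ha.1 h
          · exact ha.2 h
      have hkQ' : k ∉ {a | a ∉ Q ∧ a ≠ k} := fun h => h.2 rfl
      refine glue hA hkQ hk.1 hk.2 hrQ hclQ ?_ ?_
      · refine ih _ ?_ (rec1 c Q k) r rfl (rec1_col hA hTc hkQ hk.1 hk.2 hclQ hc)
          ⟨(rec1_range hkQ hk.1).2 ⟨hr.1, hrQ⟩, hr.2⟩
        rw [← hn]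
        refine Set.ncard_lt_ncard ?_ (Set.toFinite _)
        refine (Set.ssubset_iff_of_subset (fun a ha => ((rec1_range hkQ hk.1).1 ha).1)).2
          ⟨x2, (hK2 hx2).1, fun h => ((rec1_range hkQ hk.1).1 h).2 (Or.inl hx2)⟩
      · refine ih _ ?_ (rec1 c {a | a ∉ Q ∧ a ≠ k} k) k rfl (rec1_col hA hTc hkQ' hk.1 hk.2 hclQ' hc)
          ⟨(rec1_range hkQ' hk.1).2 ⟨hk.1, hkQ'⟩, hk.2⟩
        rw [← hn]
        refine Set.ncard_lt_ncard ?_ (Set.toFinite _)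
        refine (Set.ssubset_iff_of_subset (fun a ha => ((rec1_range hkQ' hk.1).1 ha).1)).2
          ⟨u, hu.1, fun h => ((rec1_range hkQ' hk.1).1 h).2 ⟨huQ, huk⟩⟩
    · have reach : ∀ k ∈ range c \ P, ∀ x ∈ range c \ P, x ≠ k → ∀ u ∈ range c \ P, u ≠ k → (k = r ∨ u = r) →
          ReflTransGen (fun a b => (Gam A c a b ∧ b ∈ range c \ P) ∧ b ≠ k) x u := by
        intro k hk x hx hxk u hu huk hkr
        by_contra hcon
        have hK : ∀ v, ReflTransGen (fun a b => (Gam A c a b ∧ b ∈ range c \ P) ∧ b ≠ k) x v → v ∈ range c \ P ∧ v ≠ k := by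
          intro v hv
          cases hv with
          | refl => exact ⟨hx, hxk⟩
          | tail _ h => exact ⟨h.1.2, h.2⟩
        refine hcut ⟨k, hk, {v | ReflTransGen (fun a b => (Gam A c a b ∧ b ∈ range c \ P) ∧ b ≠ k) x v}, ⟨x, .refl⟩,
          fun v hv => (hK v hv).1, fun h => (hK k h).2 rfl, ?_, ⟨u, hu, huk, hcon⟩, ?_⟩
        · rcases hkr with h | h
          · subst h; exact fun h => (hK _ h).2 rfl
          · subst h; exact hcon
        · intro a b hab ha hbP hbk
          exact ReflTransGen.tail ha ⟨⟨hab, hab.right, hbP⟩, hbk⟩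
      obtain ⟨t, hrt, ht⟩ : ∃ t, Gam A c r t ∧ t ∉ P := by
        rcases (vc hr hv0).cases_head with h | ⟨t, h, _⟩
        · exact absurd h.symm hv0r
        · exact ⟨t, h.1, h.2.2⟩
      have htS : t ∈ range c \ P := ⟨hrt.right, ht⟩
      obtain ⟨y, yi, hy⟩ := st_order_on (R := Gam A c) (lo := fun x => x = r) (hi := fun x => x = t) (range c \ P)
        (fun x y h => h.symm hA) (fun x hx y hy => vc hx hy) ⟨r, hr, rfl⟩ ⟨t, htS, rfl⟩
        (by
          intro x hx w hw hxw
          by_cases hwr : w = r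
          · subst hwr
            exact ⟨t, htS, Or.inr rfl, reach w hw x hx hxw t htS hrt.1.symm (Or.inl rfl)⟩
          · exact ⟨r, hr, Or.inl rfl, reach w hw x hx hxw r hr (Ne.symm hwr) (Or.inr rfl)⟩)
      exact base_layout hA hAi hS hT hc hrt hr.2 yi (fun x hx => (hy x hx).1) (fun x hx => (hy x hx).2)
end C5
end RAC

namespace RAC
section C6
open Relation
theorem LA_iff {n : ℕ} {p q : LT n} : LA p q ↔
    (q.1.1 = p.1.1 + 1 ∧ q.1.2 = p.1.2) ∨ (q.1.1 = p.1.1 ∧ q.1.2 = p.1.2 + 1) ∨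
    (q.1.1 = p.1.1 - 1 ∧ q.1.2 = p.1.2) ∨ (q.1.1 = p.1.1 ∧ q.1.2 = p.1.2 - 1) := by
  unfold LA
  constructor
  · rintro ⟨i, h1, h2⟩
    fin_cases i <;> simp [dx, dy] at h1 h2 <;> omega
  · rintro (h | h | h | h)
    · exact ⟨0, by simp [dx]; omega, by simp [dy]; omega⟩
    · exact ⟨1, by simp [dx]; omega, by simp [dy]; omega⟩
    · exact ⟨2, by simp [dx]; omega, by simp [dy]; omega⟩
    · exact ⟨3, by simp [dx]; omega, by simp [dy]; omega⟩
theorem LA_symm {n : ℕ} (p q : LT n) (h : LA p q) : LA q p := by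
  rw [LA_iff] at *; omega
theorem LA_irr {n : ℕ} (p : LT n) : ¬ LA p p := by
  rw [LA_iff]; omega
def mkT {n : ℕ} (x y : ℤ) (h : InB n x y) : LT n := ⟨(x, y), mem_LT.2 h⟩
theorem moveH {n : ℕ} (Q : LT n → Prop) (y : ℤ) (hQ : ∀ x (h : InB n x y), Q (mkT x y h)) :
    ∀ (k : ℕ) (x : ℤ) (h : InB n x y) (h' : InB n (x + k) y),
    ReflTransGen (fun a b => LA a b ∧ Q a ∧ Q b) (mkT x y h) (mkT (x + k) y h') := by
  intro k
  induction k with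
  | zero => intro x h h'; simp only [Nat.cast_zero, add_zero]; exact .refl
  | succ k ih =>
    intro x h h'
    have h2 : InB n (x + k) y := by unfold InB at *; push_cast at h'; omega
    refine (ih x h h2).tail ⟨?_, hQ _ _, hQ _ _⟩
    rw [LA_iff]; left; simp only [mkT]; simp only [Nat.cast_succ, ← add_assoc, and_self]
theorem moveV {n : ℕ} (Q : LT n → Prop) (x : ℤ) (hQ : ∀ y (h : InB n x y), Q (mkT x y h)) :
    ∀ (k : ℕ) (y : ℤ) (h : InB n x y) (h' : InB n x (y + k)),
    ReflTransGen (fun a b => LA a b ∧ Q a ∧ Q b) (mkT x y h) (mkT x (y + k) h') := by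
  intro k
  induction k with
  | zero => intro x h h'; simp only [Nat.cast_zero, add_zero]; exact .refl
  | succ k ih =>
    intro y h h'
    have h2 : InB n x (y + k) := by unfold InB at *; push_cast at h'; omega
    refine (ih y h h2).tail ⟨?_, hQ _ _, hQ _ _⟩
    rw [LA_iff]; right; left; simp only [mkT]; simp only [Nat.cast_succ, ← add_assoc, and_self]
theorem moveH' {n : ℕ} (Q : LT n → Prop) (y : ℤ) (hQ : ∀ x (h : InB n x y), Q (mkT x y h))
    (x x' : ℤ) (h : InB n x y) (h' : InB n x' y) :
    ReflTransGen (fun a b => LA a b ∧ Q a ∧ Q b) (mkT x y h) (mkT x' y h') := by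
  have hs : ∀ a b : LT n, (LA a b ∧ Q a ∧ Q b) → (LA b a ∧ Q b ∧ Q a) := fun a b h => ⟨LA_symm _ _ h.1, h.2.2, h.2.1⟩
  rcases le_total x x' with hle | hle
  · obtain ⟨k, rfl⟩ := Int.le.dest hle
    exact moveH Q y hQ k x h h'
  · obtain ⟨k, rfl⟩ := Int.le.dest hle
    exact rtg_symm hs (moveH Q y hQ k x' h' h)
theorem moveV' {n : ℕ} (Q : LT n → Prop) (x : ℤ) (hQ : ∀ y (h : InB n x y), Q (mkT x y h))
    (y y' : ℤ) (h : InB n x y) (h' : InB n x y') :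
    ReflTransGen (fun a b => LA a b ∧ Q a ∧ Q b) (mkT x y h) (mkT x y' h') := by
  have hs : ∀ a b : LT n, (LA a b ∧ Q a ∧ Q b) → (LA b a ∧ Q b ∧ Q a) := fun a b h => ⟨LA_symm _ _ h.1, h.2.2, h.2.1⟩
  rcases le_total y y' with hle | hle
  · obtain ⟨k, rfl⟩ := Int.le.dest hle
    exact moveV Q x hQ k y h h'
  · obtain ⟨k, rfl⟩ := Int.le.dest hle
    exact rtg_symm hs (moveV Q x hQ k y' h' h)
theorem lat_conn1 {n : ℕ} (hn : 1 ≤ n) (w x y : LT n) (hx : x ≠ w) (hy : y ≠ w) :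
    ReflTransGen (fun a b => LA a b ∧ b ≠ w) x y := by
  obtain ⟨⟨a, b⟩, hw⟩ := w
  have hab := mem_LT.1 hw
  have ⟨xs, hxs, hxs'⟩ : ∃ xs : ℤ, xs ≠ a ∧ 0 ≤ xs ∧ xs ≤ n := by
    by_cases h : a = 0
    · exact ⟨1, by omega, by omega, by omega⟩
    · exact ⟨0, by omega, by omega, by omega⟩
  have ⟨ys, hys, hys'⟩ : ∃ xs : ℤ, xs ≠ b ∧ 0 ≤ xs ∧ xs ≤ n := by
    by_cases h : b = 0
    · exact ⟨1, by omega, by omega, by omega⟩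
    · exact ⟨0, by omega, by omega, by omega⟩
  have ht : InB n xs ys := ⟨hxs'.1, hxs'.2, hys'.1, hys'.2⟩
  let Q : LT n → Prop := fun c => c ≠ ⟨(a, b), hw⟩
  have hs : ∀ a b : LT n, (LA a b ∧ Q a ∧ Q b) → (LA b a ∧ Q b ∧ Q a) := fun a b h => ⟨LA_symm _ _ h.1, h.2.2, h.2.1⟩
  have col : ∀ x, x ≠ a → ∀ y (h : InB n x y), Q (mkT x y h) := by
    intro x hx y h e
    exact hx (congrArg (fun c : LT n => c.1.1) e)
  have row : ∀ y, y ≠ b → ∀ x (h : InB n x y), Q (mkT x y h) := by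
    intro x hx y h e
    exact hx (congrArg (fun c : LT n => c.1.2) e)
  have key : ∀ x : LT n, Q x → ReflTransGen (fun a b => LA a b ∧ Q a ∧ Q b) x (mkT xs ys ht) := by
    rintro ⟨⟨p, q⟩, h⟩ hQ
    have hpq := mem_LT.1 h
    by_cases hp : p = a
    · have hq : q ≠ b := by rintro rfl; exact hQ (by simp only [hp])
      have h1 : InB n xs q := ⟨hxs'.1, hxs'.2, hpq.2.2.1, hpq.2.2.2⟩
      exact (moveH' Q q (row q hq) p xs hpq h1).trans (moveV' Q xs (col xs hxs) q ys h1 ht)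
    · have h1 : InB n p ys := ⟨hpq.1, hpq.2.1, hys'.1, hys'.2⟩
      exact (moveV' Q p (col p hp) q ys hpq h1).trans (moveH' Q ys (row ys hys) p xs h1 ht)
  exact rtg_mono ((key x hx).trans (rtg_symm hs (key y hy))) (fun a b h => ⟨h.1, h.2.2⟩)
theorem lat_conn {n : ℕ} (x y : LT n) : ReflTransGen (LA (n := n)) x y := by
  obtain ⟨⟨a, b⟩, hx⟩ := x
  obtain ⟨⟨p, q⟩, hy⟩ := y
  have h1 := mem_LT.1 hx
  have h2 := mem_LT.1 hy
  have h3 : InB n p b := ⟨h2.1, h2.2.1, h1.2.2.1, h1.2.2.2⟩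
  exact rtg_mono ((moveH' (fun _ => True) b (fun _ _ => trivial) a p h1 h3).trans
    (moveV' (fun _ => True) p (fun _ _ => trivial) b q h3 h2)) (fun a b h => h.1)
theorem layout_lat {n : ℕ} (hn : 1 ≤ n) {K : Type*} [Finite K] {P : Set K} {c : LT n → K}
    (hc : Col (LA (n := n)) P c) {r : K} (hr : r ∈ range c \ P) : LayoutR (LA (n := n)) P c r :=
  layout_all LA_symm LA_irr (sweep_lat n hn) lat_conn (lat_conn1 hn) _ c r rfl hc hr
end C6
end RAC

namespace RAC
section D1
open Relation
def nr (k : ℤ) (a b : ℤ × ℤ) : Prop := a.1 ≤ b.1 + k ∧ b.1 ≤ a.1 + k ∧ a.2 ≤ b.2 + k ∧ b.2 ≤ a.2 + k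
def ad (p q : ℤ × ℤ) : Prop := (q.1 = p.1 + 1 ∧ q.2 = p.2) ∨ (q.1 = p.1 ∧ q.2 = p.2 + 1) ∨
    (q.1 = p.1 - 1 ∧ q.2 = p.2) ∨ (q.1 = p.1 ∧ q.2 = p.2 - 1)
theorem ad_symm {p q} (h : ad p q) : ad q p := by unfold ad at *; omega
theorem nr_symm {k p q} (h : nr k p q) : nr k q p := by unfold nr at *; omega
abbrev Con (S : Set (ℤ × ℤ)) (a b : ℤ × ℤ) : Prop := ReflTransGen (fun a b => ad a b ∧ a ∈ S ∧ b ∈ S) a b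
theorem Con.symm {S : Set (ℤ × ℤ)} {a b} (h : Con S a b) : Con S b a :=
  rtg_symm (fun _ _ h => ⟨ad_symm h.1, h.2.2, h.2.1⟩) h
theorem conH {S : Set (ℤ × ℤ)} {x x' y : ℤ} (h : ∀ t, (x ≤ t ∧ t ≤ x') ∨ (x' ≤ t ∧ t ≤ x) → (t, y) ∈ S) :
    Con S (x, y) (x', y) := by
  have key : ∀ (k : ℕ) (x : ℤ), (∀ t, x ≤ t → t ≤ x + k → (t, y) ∈ S) → Con S (x, y) (x + k, y) := by
    intro k
    induction k with
    | zero => intro x _; simp only [Nat.cast_zero, add_zero]; exact .refl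
    | succ k ih =>
      intro x hx
      refine (ih x (fun t h1 h2 => hx t h1 (by push_cast; omega))).tail ⟨?_, hx _ (by omega) (by push_cast; omega),
        hx _ (by omega) le_rfl⟩
      left; simp only [Nat.cast_succ, ← add_assoc, and_self]
  rcases le_total x x' with hle | hle
  · obtain ⟨k, rfl⟩ := Int.le.dest hle
    exact key k x (fun t h1 h2 => h t (Or.inl ⟨h1, h2⟩))
  · obtain ⟨k, rfl⟩ := Int.le.dest hle
    exact (key k x' (fun t h1 h2 => h t (Or.inr ⟨h1, h2⟩))).symm
theorem conV {S : Set (ℤ × ℤ)} {x y y' : ℤ} (h : ∀ t, (y ≤ t ∧ t ≤ y') ∨ (y' ≤ t ∧ t ≤ y) → (x, t) ∈ S) :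
    Con S (x, y) (x, y') := by
  have key : ∀ (k : ℕ) (y : ℤ), (∀ t, y ≤ t → t ≤ y + k → (x, t) ∈ S) → Con S (x, y) (x, y + k) := by
    intro k
    induction k with
    | zero => intro x _; simp only [Nat.cast_zero, add_zero]; exact .refl
    | succ k ih =>
      intro y hx
      refine (ih y (fun t h1 h2 => hx t h1 (by push_cast; omega))).tail ⟨?_, hx _ (by omega) (by push_cast; omega),
        hx _ (by omega) le_rfl⟩
      right; left; simp only [Nat.cast_succ, ← add_assoc, and_self]
  rcases le_total y y' with hle | hle
  · obtain ⟨k, rfl⟩ := Int.le.dest hle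
    exact key k y (fun t h1 h2 => h t (Or.inl ⟨h1, h2⟩))
  · obtain ⟨k, rfl⟩ := Int.le.dest hle
    exact (key k y' (fun t h1 h2 => h t (Or.inr ⟨h1, h2⟩))).symm
theorem box_con {S : Set (ℤ × ℤ)} {R d : ℤ} (hR : 2 * d < R) {z f u : ℤ × ℤ} (hf : ¬ nr R f z) (hu : ¬ nr R u z)
    (huf : nr d u f) (hS : ∀ w, nr d w f → ¬ nr R w z → w ∈ S) : Con S u f := by
  obtain ⟨fx, fy⟩ := f
  obtain ⟨ux, uy⟩ := u
  obtain ⟨zx, zy⟩ := z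
  simp only [nr] at *
  by_cases h : fx ≤ zx + R ∧ zx ≤ fx + R
  · refine (conV (x := ux) (y := uy) (y' := fy) ?_).trans (conH ?_)
    · intro t ht; exact hS (ux, t) (by simp only; omega) (by simp only; omega)
    · intro t ht; exact hS (t, fy) (by simp only; omega) (by simp only; omega)
  · refine (conH (x := ux) (y := uy) (x' := fx) ?_).trans (conV ?_)
    · intro t ht; exact hS (t, uy) (by simp only; omega) (by simp only; omega)
    · intro t ht; exact hS (fx, t) (by simp only; omega) (by simp only; omega)
theorem sq_con {S : Set (ℤ × ℤ)} {R : ℤ} {z u v : ℤ × ℤ} (hu : nr R u z) (hv : nr R v z)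
    (hS : ∀ w, nr R w z → w ∈ S) : Con S u v := by
  obtain ⟨fx, fy⟩ := v
  obtain ⟨ux, uy⟩ := u
  obtain ⟨zx, zy⟩ := z
  simp only [nr] at *
  refine (conV (x := ux) (y := uy) (y' := fy) ?_).trans (conH ?_)
  · intro t ht; exact hS (ux, t) (by simp only; omega)
  · intro t ht; exact hS (t, fy) (by simp only; omega)
def rg (R : ℤ) (z a : ℤ × ℤ) : Prop := nr R a z ∧ ¬ nr (R - 1) a z
def ps (R : ℤ) (z a : ℤ × ℤ) : ℤ :=
  if a.2 = z.2 - R ∧ a.1 < z.1 + R then a.1 - z.1 + R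
  else if a.1 = z.1 + R ∧ a.2 < z.2 + R then 2 * R + (a.2 - z.2 + R)
  else if a.2 = z.2 + R ∧ z.1 - R < a.1 then 4 * R + (z.1 + R - a.1)
  else 6 * R + (z.2 + R - a.2)
def nx (R : ℤ) (z a : ℤ × ℤ) : ℤ × ℤ :=
  if a.2 = z.2 - R ∧ a.1 < z.1 + R then (a.1 + 1, a.2)
  else if a.1 = z.1 + R ∧ a.2 < z.2 + R then (a.1, a.2 + 1)
  else if a.2 = z.2 + R ∧ z.1 - R < a.1 then (a.1 - 1, a.2)
  else (a.1, a.2 - 1)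
theorem ps_range {R : ℤ} (hR : 1 ≤ R) {z a : ℤ × ℤ} (h : rg R z a) : 0 ≤ ps R z a ∧ ps R z a < 8 * R := by
  simp only [rg, nr, ps] at *; split_ifs <;> omega
theorem ps_inj {R : ℤ} (hR : 1 ≤ R) {z a b : ℤ × ℤ} (h : rg R z a) (h' : rg R z b) (he : ps R z a = ps R z b) : a = b := by
  obtain ⟨a1, a2⟩ := a
  obtain ⟨b1, b2⟩ := b
  simp only [rg, nr, ps, Prod.mk.injEq] at *
  split_ifs at he <;> omega
theorem nx_rg {R : ℤ} (hR : 1 ≤ R) {z a : ℤ × ℤ} (h : rg R z a) : rg R z (nx R z a) ∧ ad a (nx R z a) ∧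
    (ps R z (nx R z a) = ps R z a + 1 ∨ (ps R z (nx R z a) = 0 ∧ ps R z a = 8 * R - 1)) := by
  obtain ⟨a1, a2⟩ := a
  by_cases c1 : a2 = z.2 - R ∧ a1 < z.1 + R
  · rw [show nx R z (a1, a2) = (a1 + 1, a2) from if_pos c1]
    simp only [rg, nr, ps, ad] at *; refine ⟨⟨?_, ?_⟩, ?_, ?_⟩ <;> first | omega | (split_ifs <;> omega) | (simp <;> omega)
  by_cases c2 : a1 = z.1 + R ∧ a2 < z.2 + R
  · rw [show nx R z (a1, a2) = (a1, a2 + 1) from (if_neg c1).trans (if_pos c2)]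
    simp only [rg, nr, ps, ad] at *; refine ⟨⟨?_, ?_⟩, ?_, ?_⟩ <;> first | omega | (split_ifs <;> omega) | (simp <;> omega)
  by_cases c3 : a2 = z.2 + R ∧ z.1 - R < a1
  · rw [show nx R z (a1, a2) = (a1 - 1, a2) from (if_neg c1).trans ((if_neg c2).trans (if_pos c3))]
    simp only [rg, nr, ps, ad] at *; refine ⟨⟨?_, ?_⟩, ?_, ?_⟩ <;> first | omega | (split_ifs <;> omega) | (simp <;> omega)
  · rw [show nx R z (a1, a2) = (a1, a2 - 1) from (if_neg c1).trans ((if_neg c2).trans (if_neg c3))]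
    simp only [rg, nr, ps, ad] at *; refine ⟨⟨?_, ?_⟩, ?_, ?_⟩ <;> first | omega | (split_ifs <;> omega) | (simp <;> omega)
def fd (R : ℤ) (z s a : ℤ × ℤ) : ℤ := if ps R z a ≤ ps R z s then ps R z s - ps R z a else ps R z s - ps R z a + 8 * R
theorem fd_range {R : ℤ} (hR : 1 ≤ R) {z s a : ℤ × ℤ} (h : rg R z s) (h' : rg R z a) : 0 ≤ fd R z s a ∧ fd R z s a < 8 * R := by
  have := ps_range hR h
  have := ps_range hR h'
  unfold fd; split_ifs <;> omega
theorem fd_nx {R : ℤ} (hR : 1 ≤ R) {z s a : ℤ × ℤ} (h : rg R z s) (h' : rg R z a) (hp : 0 < fd R z s a) :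
    fd R z s (nx R z a) = fd R z s a - 1 := by
  have := ps_range hR h
  have := ps_range hR h'
  have := (nx_rg hR h').2.2
  unfold fd at *; split_ifs at * <;> omega
theorem fd_zero {R : ℤ} (hR : 1 ≤ R) {z s a : ℤ × ℤ} (h : rg R z s) (h' : rg R z a) (hp : fd R z s a = 0) : a = s := by
  have := ps_range hR h
  have := ps_range hR h'
  refine ps_inj hR h' h ?_
  unfold fd at *; split_ifs at * <;> omega
theorem fd_self {R : ℤ} {z s : ℤ × ℤ} : fd R z s s = 0 := by unfold fd; simp
theorem fd_inj {R : ℤ} (hR : 1 ≤ R) {z s a b : ℤ × ℤ} (h : rg R z s) (ha : rg R z a) (hb : rg R z b)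
    (he : fd R z s a = fd R z s b) : a = b := by
  have := ps_range hR h
  have := ps_range hR ha
  have := ps_range hR hb
  refine ps_inj hR ha hb ?_
  unfold fd at *; split_ifs at * <;> omega
theorem fd_inj2 {R : ℤ} (hR : 1 ≤ R) {z s s' a : ℤ × ℤ} (h : rg R z s) (ha : rg R z a) (hb : rg R z s')
    (he : fd R z s a = fd R z s' a) : s = s' := by
  have := ps_range hR h
  have := ps_range hR ha
  have := ps_range hR hb
  refine ps_inj hR h hb ?_
  unfold fd at *; split_ifs at * <;> omega
theorem fd_up {R : ℤ} (hR : 1 ≤ R) {z s k a b : ℤ × ℤ} (hs : rg R z s) (hk : rg R z k) (ha : rg R z a) (hb : rg R z b)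
    (h1 : fd R z s a < fd R z k a) (h2 : fd R z k a ≤ fd R z k b) : fd R z s b < fd R z k b := by
  have := ps_range hR hs
  have := ps_range hR hk
  have := ps_range hR ha
  have := ps_range hR hb
  unfold fd at *; split_ifs at * <;> omega
theorem exists_seed {R : ℤ} (hR : 2 ≤ R) {z s : ℤ × ℤ} (h1 : ¬ nr R s z) (h2 : nr (R + 3) s z) :
    ∃ a o i, rg R z a ∧ ad a o ∧ ¬ nr R o z ∧ nr (R + 1) o z ∧ nr 6 o s ∧ nr 7 a s ∧ ad i a ∧ nr (R - 1) i z := by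
  obtain ⟨x, y⟩ := s
  obtain ⟨p, q⟩ := z
  by_cases c1 : p + R < x
  · refine ⟨(p + R, max (q - (R - 1)) (min (q + (R - 1)) y)), (p + R + 1, max (q - (R - 1)) (min (q + (R - 1)) y)),
      (p + R - 1, max (q - (R - 1)) (min (q + (R - 1)) y)), ?_⟩
    simp only [rg, nr, ad] at *; refine ⟨⟨?_, ?_⟩, ?_, ?_, ?_, ?_, ?_, ?_, ?_⟩ <;> first | omega | (simp <;> omega)
  by_cases c2 : x < p - R
  · refine ⟨(p - R, max (q - (R - 1)) (min (q + (R - 1)) y)), (p - R - 1, max (q - (R - 1)) (min (q + (R - 1)) y)),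
      (p - R + 1, max (q - (R - 1)) (min (q + (R - 1)) y)), ?_⟩
    simp only [rg, nr, ad] at *; refine ⟨⟨?_, ?_⟩, ?_, ?_, ?_, ?_, ?_, ?_, ?_⟩ <;> first | omega | (simp <;> omega)
  by_cases c3 : q + R < y
  · refine ⟨(max (p - (R - 1)) (min (p + (R - 1)) x), q + R), (max (p - (R - 1)) (min (p + (R - 1)) x), q + R + 1),
      (max (p - (R - 1)) (min (p + (R - 1)) x), q + R - 1), ?_⟩
    simp only [rg, nr, ad] at *; refine ⟨⟨?_, ?_⟩, ?_, ?_, ?_, ?_, ?_, ?_, ?_⟩ <;> first | omega | (simp <;> omega)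
  · refine ⟨(max (p - (R - 1)) (min (p + (R - 1)) x), q - R), (max (p - (R - 1)) (min (p + (R - 1)) x), q - R - 1),
      (max (p - (R - 1)) (min (p + (R - 1)) x), q - R + 1), ?_⟩
    simp only [rg, nr, ad] at *; refine ⟨⟨?_, ?_⟩, ?_, ?_, ?_, ?_, ?_, ?_, ?_⟩ <;> first | omega | (simp <;> omega)
end D1
end RAC

namespace RAC
section D2
open Relation
structure Pix (V J : Type*) (n : ℕ) (R : ℤ) where
  z : J → ℤ × ℤ
  F : V → Set (ℤ × ℤ)
  Inc : J → V → Prop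
  sd : J → V → ℤ × ℤ
  hR : 20 ≤ R
  zin : ∀ j a, nr R a (z j) → InB n a.1 a.2
  fin : ∀ v, ∀ f ∈ F v, ∀ a, nr 6 a f → InB n a.1 a.2
  ne : ∀ v, (F v).Nonempty
  ch : ∀ v, ∀ f ∈ F v, ∀ f' ∈ F v, ReflTransGen (fun a b => nr 1 a b ∧ a ∈ F v ∧ b ∈ F v) f f'
  out : ∀ v, ∀ f ∈ F v, ∀ j, ¬ nr R f (z j)
  sepV : ∀ v v', v ≠ v' → ∀ f ∈ F v, ∀ f' ∈ F v', ¬ nr 40 f f'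
  sepJ : ∀ j j', j ≠ j' → ¬ nr (2 * R + 20) (z j) (z j')
  sdp : ∀ j v, Inc j v → ∃ s ∈ F v, ∃ o i, rg R (z j) (sd j v) ∧ ad (sd j v) o ∧ ¬ nr R o (z j) ∧
    nr (R + 1) o (z j) ∧ nr 6 o s ∧ nr 7 (sd j v) s ∧ ad i (sd j v) ∧ nr (R - 1) i (z j)
  two : ∀ j, ∃ v v', v ≠ v' ∧ Inc j v ∧ Inc j v'
variable {V J : Type*} {n : ℕ} {R : ℤ} (D : Pix V J n R)
namespace Pix
def ownR (j : J) (v : V) (a : ℤ × ℤ) : Prop := rg R (D.z j) a ∧ D.Inc j v ∧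
  ∀ v', D.Inc j v' → fd R (D.z j) (D.sd j v) a ≤ fd R (D.z j) (D.sd j v') a
def own (v : V) (a : ℤ × ℤ) : Prop := (∃ j, D.ownR j v a) ∨ ((∀ j, ¬ nr R a (D.z j)) ∧ ∃ f ∈ D.F v, nr 6 a f)
def itm (j : J) (a : ℤ × ℤ) : Prop := nr (R - 1) a (D.z j)
theorem R1 {V J : Type*} {n : ℕ} {R : ℤ} (D : Pix V J n R) : 1 ≤ R := le_trans (by norm_num) D.hR
theorem j_uniq {j j' : J} {a : ℤ × ℤ} (h : nr R a (D.z j)) (h' : nr (R + 12) a (D.z j')) : j = j' := by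
  by_contra hne
  have := D.sepJ _ _ hne
  have := D.hR
  unfold nr at *; omega
theorem itm_nr {j : J} {a : ℤ × ℤ} (h : D.itm j a) : nr R a (D.z j) := by unfold itm nr at *; omega
theorem nr_mono {k l : ℤ} (hkl : k ≤ l) {a b : ℤ × ℤ} (h : nr k a b) : nr l a b := by unfold nr at *; omega
theorem itm_uniq {j j' : J} {a : ℤ × ℤ} (h : D.itm j a) (h' : D.itm j' a) : j = j' :=
  D.j_uniq (D.itm_nr h) (nr_mono (by omega) (D.itm_nr h'))
theorem sd_rg {j v} (h : D.Inc j v) : rg R (D.z j) (D.sd j v) := by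
  obtain ⟨s, hs, o, i, h1, _⟩ := D.sdp j v h; exact h1
theorem sd_inj {j v v'} (h : D.Inc j v) (h' : D.Inc j v') (he : D.sd j v = D.sd j v') : v = v' := by
  by_contra hne
  obtain ⟨s, hs, o, i, -, -, -, -, -, h1, -⟩ := D.sdp j v h
  obtain ⟨s', hs', o', i', -, -, -, -, -, h2, -⟩ := D.sdp j v' h'
  have := D.sepV _ _ hne s hs s' hs'
  rw [← he] at h2
  unfold nr at *; omega
theorem ownR_uniq {j v v' a} (h : D.ownR j v a) (h' : D.ownR j v' a) : v = v' :=
  D.sd_inj h.2.1 h'.2.1 (fd_inj2 D.R1 (D.sd_rg h.2.1) h.1 (D.sd_rg h'.2.1)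
    (le_antisymm (h.2.2 _ h'.2.1) (h'.2.2 _ h.2.1)))
theorem own_ring {j v a} (h : D.own v a) (ha : nr R a (D.z j)) : D.ownR j v a := by
  rcases h with ⟨j', h⟩ | ⟨h, _⟩
  · rwa [D.j_uniq ha (nr_mono (by omega) h.1.1)]
  · exact absurd ha (h j)
theorem own_uniq {v v' a} (h : D.own v a) (h' : D.own v' a) : v = v' := by
  by_cases hj : ∃ j, nr R a (D.z j)
  · obtain ⟨j, hj⟩ := hj
    exact D.ownR_uniq (D.own_ring h hj) (D.own_ring h' hj)
  · push Not at hj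
    rcases h with ⟨j, h⟩ | ⟨-, f, hf, h⟩
    · exact absurd h.1.1 (hj j)
    rcases h' with ⟨j, h'⟩ | ⟨-, f', hf', h'⟩
    · exact absurd h'.1.1 (hj j)
    by_contra hne
    have := D.sepV _ _ hne f hf f' hf'
    unfold nr at *; omega
theorem own_itm {v j a} (h : D.own v a) (h' : D.itm j a) : False :=
  (D.own_ring h (D.itm_nr h')).1.2 h'
theorem own_in {v a} (h : D.own v a) : InB n a.1 a.2 := by
  rcases h with ⟨j, h⟩ | ⟨-, f, hf, h⟩
  · exact D.zin j a h.1.1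
  · exact D.fin v f hf a h
theorem itm_in {j a} (h : D.itm j a) : InB n a.1 a.2 := D.zin j a (D.itm_nr h)
theorem ex_ownR [Finite V] {j a} (h : rg R (D.z j) a) : ∃ v, D.ownR j v a := by
  obtain ⟨v0, _, _, h0, _⟩ := D.two j
  obtain ⟨v, hv, hm⟩ := Set.exists_min_image {v | D.Inc j v} (fun v => fd R (D.z j) (D.sd j v) a) (Set.toFinite _) ⟨v0, h0⟩
  exact ⟨v, h, hv, hm⟩
theorem F_own {v f} (h : f ∈ D.F v) : D.own v f := Or.inr ⟨D.out v f h, f, h, by unfold nr; omega⟩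
theorem loc {v f u} (hf : f ∈ D.F v) (hu : ∀ j, ¬ nr R u (D.z j)) (huf : nr 6 u f) :
    Con {a | D.own v a} u f := by
  have hR := D.hR
  by_cases hj : ∃ j, nr (R + 6) f (D.z j)
  · obtain ⟨j, hj⟩ := hj
    refine box_con (d := 6) (by omega) (D.out v f hf j) (hu j) huf ?_
    intro w hw hw'
    refine Or.inr ⟨fun j' hj' => hw' ?_, f, hf, hw⟩
    rwa [← D.j_uniq hj' (nr_mono (k := R + 12) le_rfl (by unfold nr at *; omega) : nr (R + 12) w (D.z j))]
  · push Not at hj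
    refine box_con (d := 6) (R := R) (z := (f.1 + R + 7, f.2)) (by omega) ?_ ?_ huf ?_
    · unfold nr at *; simp only; omega
    · unfold nr at *; simp only; omega
    · intro w hw _
      refine Or.inr ⟨fun j' hj' => hj j' ?_, f, hf, hw⟩
      unfold nr at *; omega
theorem chain {v f f'} (hf : f ∈ D.F v) (hf' : f' ∈ D.F v) : Con {a | D.own v a} f f' := by
  have := D.ch v f hf f' hf'
  induction this with
  | refl => exact .refl
  | tail _ h ih => exact (ih h.2.1).trans (D.loc h.2.2 (D.out v _ h.2.1) (nr_mono (by norm_num) h.1))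
theorem ownR_nx {j v a} (h : D.ownR j v a) (h0 : 0 < fd R (D.z j) (D.sd j v) a) : D.ownR j v (nx R (D.z j) a) := by
  refine ⟨(nx_rg D.R1 h.1).1, h.2.1, fun v' hv' => ?_⟩
  have := h.2.2 v' hv'
  rw [fd_nx D.R1 (D.sd_rg h.2.1) h.1 h0, fd_nx D.R1 (D.sd_rg hv') h.1 (by omega)]
  omega
theorem walk_seed {j v} : ∀ (m : ℕ) a, D.ownR j v a → fd R (D.z j) (D.sd j v) a = m →
    Con {a | D.own v a} a (D.sd j v) := by
  intro m
  induction m with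
  | zero => intro a h h0; rw [fd_zero D.R1 (D.sd_rg h.2.1) h.1 (by simpa using h0)]
  | succ m ih =>
    intro a h h0
    have hp : 0 < fd R (D.z j) (D.sd j v) a := by rw [h0]; positivity
    have h1 := D.ownR_nx h hp
    refine (ReflTransGen.single ⟨(nx_rg D.R1 h.1).2.1, Or.inl ⟨j, h⟩, Or.inl ⟨j, h1⟩⟩).trans (ih _ h1 ?_)
    rw [fd_nx D.R1 (D.sd_rg h.2.1) h.1 hp, h0]; push_cast; ring
theorem sd_own {j v} (h : D.Inc j v) : D.ownR j v (D.sd j v) :=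
  ⟨D.sd_rg h, h, fun v' hv' => by rw [fd_self]; exact (fd_range D.R1 (D.sd_rg hv') (D.sd_rg h)).1⟩
theorem own_con {v a} (h : D.own v a) : ∃ f ∈ D.F v, Con {a | D.own v a} a f := by
  rcases h with ⟨j, h⟩ | ⟨h, f, hf, h'⟩
  · obtain ⟨s, hs, o, i, h1, h2, h3, h4, h5, h6, h7, h8⟩ := D.sdp j v h.2.1
    have h0 := (fd_range D.R1 h1 h.1).1
    have ho : ∀ j', ¬ nr R o (D.z j') := fun j' hj' => h3 (by
      rwa [← D.j_uniq hj' (nr_mono (by omega) h4 : nr (R + 12) o (D.z j))])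
    refine ⟨s, hs, (D.walk_seed (fd R (D.z j) (D.sd j v) a).toNat a h (by omega)).trans
      (ReflTransGen.head ⟨h2, Or.inl ⟨j, D.sd_own h.2.1⟩, Or.inr ⟨ho, s, hs, h5⟩⟩ (D.loc hs ho h5))⟩
  · exact ⟨f, hf, D.loc hf h h'⟩
theorem own_conn {v a b} (h : D.own v a) (h' : D.own v b) : Con {a | D.own v a} a b := by
  obtain ⟨f, hf, h1⟩ := D.own_con h
  obtain ⟨f', hf', h2⟩ := D.own_con h'
  exact (h1.trans (D.chain hf hf')).trans h2.symm
theorem lift {S : Set (ℤ × ℤ)} (hS : ∀ w ∈ S, InB n w.1 w.2) {a : LT n} {b : ℤ × ℤ} (h : Con S a.1 b) :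
    ∃ hb, ReflTransGen (fun a b : LT n => LA a b ∧ b.1 ∈ S) a ⟨b, hb⟩ := by
  induction h with
  | refl => exact ⟨a.2, .refl⟩
  | tail _ h ih =>
    obtain ⟨hb, ih⟩ := ih
    exact ⟨mem_LT.2 (hS _ h.2.2), ih.tail ⟨LA_iff.2 h.1, h.2.2⟩⟩
open Classical in
noncomputable def col (a : LT n) : (V ⊕ J) ⊕ LT n :=
  if h : ∃ v, D.own v a.1 then .inl (.inl h.choose) else if h : ∃ j, D.itm j a.1 then .inl (.inr h.choose) else .inr a
theorem col_v {a : LT n} {v} : D.col a = .inl (.inl v) ↔ D.own v a.1 := by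
  unfold col
  constructor
  · intro h
    split_ifs at h with h1 h2
    · simp only [Sum.inl.injEq] at h; rw [← h]; exact h1.choose_spec
    · simp at h
  · intro h
    rw [dif_pos ⟨v, h⟩]
    exact congrArg _ (congrArg _ (D.own_uniq (Exists.choose_spec (⟨v, h⟩ : ∃ v, D.own v a.1)) h))
theorem col_j {a : LT n} {j} : D.col a = .inl (.inr j) ↔ D.itm j a.1 := by
  unfold col
  constructor
  · intro h
    split_ifs at h with h1 h2
    · simp at h
    · simp only [Sum.inl.injEq, Sum.inr.injEq] at h; rw [← h]; exact h2.choose_spec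
  · intro h
    rw [dif_neg (fun ⟨v, hv⟩ => D.own_itm hv h), dif_pos ⟨j, h⟩]
    exact congrArg _ (congrArg _ (D.itm_uniq (Exists.choose_spec (⟨j, h⟩ : ∃ v, D.itm v a.1)) h))
theorem col_f {a b : LT n} (h : D.col a = .inr b) : a = b := by
  unfold col at h
  split_ifs at h
  exact Sum.inr.inj h
theorem gam_iff [Finite V] {j k} : Gam LA D.col (.inl (.inr j)) k ↔ ∃ v, k = .inl (.inl v) ∧ D.Inc j v := by
  constructor
  · rintro ⟨hne, a, b, hab, ha, hb⟩
    rw [col_j] at ha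
    have hb' : ¬ D.itm j b.1 := fun h => hne (by rw [← hb, D.col_j.2 h])
    have hr : rg R (D.z j) b.1 := by
      refine ⟨?_, hb'⟩
      rw [LA_iff] at hab
      unfold itm nr at *; omega
    obtain ⟨v, hv⟩ := D.ex_ownR hr
    exact ⟨v, by rw [← hb, D.col_v.2 (Or.inl ⟨j, hv⟩)], hv.2.1⟩
  · rintro ⟨v, rfl, hv⟩
    obtain ⟨s, hs, o, i, h1, h2, h3, h4, h5, h6, h7, h8⟩ := D.sdp j v hv
    have ho : D.own v (D.sd j v) := Or.inl ⟨j, D.sd_own hv⟩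
    exact ⟨by simp, ⟨i, mem_LT.2 (D.itm_in h8)⟩, ⟨D.sd j v, mem_LT.2 (D.own_in ho)⟩, LA_iff.2 h7, D.col_j.2 h8, D.col_v.2 ho⟩
theorem gam_step {j v v' a b} (ha : D.ownR j v a) (hb : D.ownR j v' b) (hab : ad a b) (hne : v ≠ v') :
    Gam LA D.col (.inl (.inl v)) (.inl (.inl v')) := by
  have h1 : D.own v a := Or.inl ⟨j, ha⟩
  have h2 : D.own v' b := Or.inl ⟨j, hb⟩
  exact ⟨by simpa using hne, ⟨a, mem_LT.2 (D.own_in h1)⟩, ⟨b, mem_LT.2 (D.own_in h2)⟩, LA_iff.2 hab, D.col_v.2 h1, D.col_v.2 h2⟩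
theorem ring_walk [Finite V] {j v a s q} (hs : rg R (D.z j) s) (ha : D.ownR j v a)
    (hg : ∀ b v', D.ownR j v' b → fd R (D.z j) s a ≤ fd R (D.z j) s b → (.inl (.inl v') : (V ⊕ J) ⊕ LT n) ≠ q) :
    ∀ (m : ℕ) b v', D.ownR j v' b → fd R (D.z j) s b = fd R (D.z j) s a + m →
    ReflTransGen (fun x y => Gam LA D.col x y ∧ (Gam LA D.col (.inl (.inr j)) x ∧ x ≠ q) ∧
      (Gam LA D.col (.inl (.inr j)) y ∧ y ≠ q)) (.inl (.inl v')) (.inl (.inl v)) := by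
  intro m
  induction m with
  | zero =>
    intro b v' hb he
    have : b = a := fd_inj D.R1 hs hb.1 ha.1 (by simpa using he)
    subst this
    rw [D.ownR_uniq hb ha]
  | succ m ih =>
    intro b v' hb he
    have h0 := (fd_range D.R1 hs ha.1).1
    push_cast at he
    have hn := nx_rg D.R1 hb.1
    have hf := fd_nx D.R1 hs hb.1 (by omega)
    obtain ⟨v1, h1⟩ := D.ex_ownR hn.1
    have := ih _ v1 h1 (by omega)
    by_cases hv : v' = v1
    · rw [hv]; exact this
    · exact ReflTransGen.head ⟨D.gam_step hb h1 hn.2.1 hv, ⟨D.gam_iff.2 ⟨_, rfl, hb.2.1⟩, hg _ _ hb (by omega)⟩,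
        ⟨D.gam_iff.2 ⟨_, rfl, h1.2.1⟩, hg _ _ h1 (by omega)⟩⟩ this
theorem isCol [Finite V] : Col LA (range (fun j : J => (.inl (.inr j) : (V ⊕ J) ⊕ LT n))) D.col where
  conn := by
    intro a b hab
    rcases hc : D.col a with (v | j) | t
    · obtain ⟨hb, h⟩ := lift (fun w hw => D.own_in hw) (D.own_conn (D.col_v.1 hc) (D.col_v.1 (hab ▸ hc)))
      exact rtg_mono h (fun x y h => ⟨h.1, D.col_v.2 h.2⟩)
    · obtain ⟨hb, h⟩ := lift (S := {a | D.itm j a}) (fun w hw => D.itm_in hw)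
        (sq_con (D.col_j.1 hc) (D.col_j.1 (hab ▸ hc)) (fun w hw => hw))
      exact rtg_mono h (fun x y h => ⟨h.1, D.col_j.2 h.2⟩)
    · have h1 := D.col_f hc
      have h2 := D.col_f (hab ▸ hc)
      rw [h1, h2]
  ind := by
    rintro p v ⟨j, rfl⟩ h
    obtain ⟨v, rfl, -⟩ := D.gam_iff.1 h
    rintro ⟨j', h'⟩; simp at h'
  two := by
    rintro p ⟨j, rfl⟩ -
    obtain ⟨v, v', h, h1, h2⟩ := D.two j
    exact ⟨_, _, by simpa using h, D.gam_iff.2 ⟨v, rfl, h1⟩, D.gam_iff.2 ⟨v', rfl, h2⟩⟩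
  ring := by
    rintro p ⟨j, rfl⟩ q k k' hk hk' hkq hkq'
    obtain ⟨v, rfl, hv⟩ := D.gam_iff.1 hk
    obtain ⟨v', rfl, hv'⟩ := D.gam_iff.1 hk'
    have hsym := fun (x y : (V ⊕ J) ⊕ LT n) (h : Gam LA D.col x y ∧ (Gam LA D.col (.inl (.inr j)) x ∧ x ≠ q) ∧
      (Gam LA D.col (.inl (.inr j)) y ∧ y ≠ q)) =>
      (⟨Gam.symm LA_symm h.1, h.2.2, h.2.1⟩ : Gam LA D.col y x ∧ (Gam LA D.col (.inl (.inr j)) y ∧ y ≠ q) ∧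
      (Gam LA D.col (.inl (.inr j)) x ∧ x ≠ q))
    by_cases hq : ∃ k, D.Inc j k ∧ q = .inl (.inl k)
    · obtain ⟨k, hk, rfl⟩ := hq
      have main : ∀ v v', D.Inc j v → D.Inc j v' → v ≠ k →
          fd R (D.z j) (D.sd j k) (D.sd j v) ≤ fd R (D.z j) (D.sd j k) (D.sd j v') →
          ReflTransGen (fun x y => Gam LA D.col x y ∧ (Gam LA D.col (.inl (.inr j)) x ∧ x ≠ .inl (.inl k)) ∧
      (Gam LA D.col (.inl (.inr j)) y ∧ y ≠ .inl (.inl k))) (.inl (.inl v')) (.inl (.inl v)) := by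
        intro v v' hv hv' hvk hle
        refine D.ring_walk (D.sd_rg hk) (D.sd_own hv) ?_
          (fd R (D.z j) (D.sd j k) (D.sd j v') - fd R (D.z j) (D.sd j k) (D.sd j v)).toNat _ _ (D.sd_own hv') (by omega)
        intro b w hw hle' he
        simp only [Sum.inl.injEq] at he
        subst he
        have h1 : fd R (D.z j) (D.sd j v) (D.sd j v) < fd R (D.z j) (D.sd j w) (D.sd j v) :=
          lt_of_le_of_ne ((D.sd_own hv).2.2 w hk) (fun e => hvk (D.sd_inj hv hk (fd_inj2 D.R1 (D.sd_rg hv) (D.sd_rg hv) (D.sd_rg hk) e)))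
        exact absurd (hw.2.2 v hv) (not_le.2 (fd_up D.R1 (D.sd_rg hv) (D.sd_rg hk) (D.sd_rg hv) hw.1 h1 hle'))
      rcases le_total (fd R (D.z j) (D.sd j k) (D.sd j v)) (fd R (D.z j) (D.sd j k) (D.sd j v')) with h | h
      · exact rtg_symm hsym (main v v' hv hv' (fun e => hkq (by rw [e])) h)
      · exact main v' v hv' hv (fun e => hkq' (by rw [e])) h
    · refine D.ring_walk (D.sd_rg hv') (D.sd_own hv') ?_ (fd R (D.z j) (D.sd j v') (D.sd j v)).toNat _ _ (D.sd_own hv) ?_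
      · intro b w hw _ he
        exact hq ⟨w, hw.2.1, he.symm⟩
      · have := (fd_range D.R1 (D.sd_rg hv') (D.sd_rg hv)).1
        rw [fd_self]; omega
theorem layout [Finite V] [Nonempty V] [Finite J] : ∃ (y : V → ℕ) (X : J → ℕ), Function.Injective y ∧ Function.Injective X ∧
    ∀ g w a b g1 g2, D.Inc g a → D.Inc g b → y a < y w → y w < y b → D.Inc g1 w → D.Inc g2 w →
      X g1 < X g → X g < X g2 → False := by
  have hV : ∀ v : V, (.inl (.inl v) : (V ⊕ J) ⊕ LT n) ∈ range D.col \ range (fun j : J => (.inl (.inr j) : (V ⊕ J) ⊕ LT n)) := by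
    intro v
    obtain ⟨f, hf⟩ := D.ne v
    have := D.F_own hf
    exact ⟨⟨⟨f, mem_LT.2 (D.own_in this)⟩, D.col_v.2 this⟩, by simp⟩
  have hJ : ∀ j : J, (.inl (.inr j) : (V ⊕ J) ⊕ LT n) ∈ range D.col ∩ range (fun j : J => (.inl (.inr j) : (V ⊕ J) ⊕ LT n)) := by
    intro j
    have h : D.itm j (D.z j) := by have := D.hR; unfold itm nr; omega
    exact ⟨⟨⟨D.z j, mem_LT.2 (D.itm_in h)⟩, D.col_j.2 h⟩, j, rfl⟩
  have hn : 1 ≤ n := by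
    obtain ⟨f, hf⟩ := D.ne (Classical.arbitrary V)
    have h1 := D.fin _ f hf f (by unfold nr; omega)
    have h2 := D.fin _ f hf (f.1 + 1, f.2) (by unfold nr; simp only; omega)
    unfold InB at *; simp only at *; omega
  obtain ⟨y, X, hy, hX, hs, -⟩ := layout_lat hn D.isCol (hV (Classical.arbitrary V))
  refine ⟨fun v => y (.inl (.inl v)), fun j => X (.inl (.inr j)), ?_, ?_, ?_⟩
  · intro a b h
    simpa using hy (hV a) (hV b) h
  · intro a b h
    simpa using hX (hJ a) (hJ b) h
  · intro g w a b g1 g2 ha hb h1 h2 hw1 hw2 h3 h4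
    exact hs _ _ _ _ _ _ ⟨g, rfl⟩ ⟨g1, rfl⟩ ⟨g2, rfl⟩ (hV w).1 (hV w).2 (D.gam_iff.2 ⟨a, rfl, ha⟩)
      (D.gam_iff.2 ⟨b, rfl, hb⟩) h1 h2 (D.gam_iff.2 ⟨w, rfl, hw1⟩) (D.gam_iff.2 ⟨w, rfl, hw2⟩) h3 h4
end Pix
end D2
end RAC

namespace RAC
section D3
open Relation Filter Topology
noncomputable def pxl (N : ℕ) (S : ℤ) (x : Pt) : ℤ × ℤ := (⌊N * x.1⌋ + S, ⌊N * x.2⌋ + S)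
theorem dist_pt (x p : Pt) : dist x p = max |x.1 - p.1| |x.2 - p.2| := rfl
theorem pxl_far {N : ℕ} {S : ℤ} {x p : Pt} {k : ℤ} (h : nr k (pxl N S x) (pxl N S p)) : N * dist x p < k + 1 := by
  unfold nr pxl at h
  simp only at h
  obtain ⟨h1, h2, h3, h4⟩ := h
  have a1 := Int.floor_le (N * x.1)
  have a2 := Int.lt_floor_add_one (N * x.1)
  have b1 := Int.floor_le (N * p.1)
  have b2 := Int.lt_floor_add_one (N * p.1)
  have c1 := Int.floor_le (N * x.2)
  have c2 := Int.lt_floor_add_one (N * x.2)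
  have d1 := Int.floor_le (N * p.2)
  have d2 := Int.lt_floor_add_one (N * p.2)
  have h1' : (⌊N * x.1⌋ : ℝ) ≤ ⌊N * p.1⌋ + k := by exact_mod_cast (by omega : ⌊N * x.1⌋ ≤ ⌊N * p.1⌋ + k)
  have h2' : (⌊N * p.1⌋ : ℝ) ≤ ⌊N * x.1⌋ + k := by exact_mod_cast (by omega : ⌊N * p.1⌋ ≤ ⌊N * x.1⌋ + k)
  have h3' : (⌊N * x.2⌋ : ℝ) ≤ ⌊N * p.2⌋ + k := by exact_mod_cast (by omega : ⌊N * x.2⌋ ≤ ⌊N * p.2⌋ + k)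
  have h4' : (⌊N * p.2⌋ : ℝ) ≤ ⌊N * x.2⌋ + k := by exact_mod_cast (by omega : ⌊N * p.2⌋ ≤ ⌊N * x.2⌋ + k)
  have hN : (0 : ℝ) ≤ N := Nat.cast_nonneg N
  have hab : ∀ a : ℝ, N * |a| = |N * a| := fun a => by rw [abs_mul, abs_of_nonneg hN]
  rw [dist_pt, mul_max_of_nonneg _ _ hN, hab, hab]
  refine max_lt (abs_lt.2 ⟨?_, ?_⟩) (abs_lt.2 ⟨?_, ?_⟩) <;> linarith
theorem pxl_near {N : ℕ} {S : ℤ} {x p : Pt} {k : ℤ} (h : N * dist x p ≤ k) : nr k (pxl N S x) (pxl N S p) := by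
  have hN : (0 : ℝ) ≤ N := Nat.cast_nonneg N
  have hab : ∀ a : ℝ, N * |a| = |N * a| := fun a => by rw [abs_mul, abs_of_nonneg hN]
  rw [dist_pt, mul_max_of_nonneg _ _ hN, hab, hab, max_le_iff,
    abs_le, abs_le] at h
  have key : ∀ a b : ℝ, N * (a - b) ≤ k → ⌊N * a⌋ ≤ ⌊N * b⌋ + k := by
    intro a b hab
    have h1 := Int.floor_le (N * a)
    have h2 := Int.lt_floor_add_one (N * b)
    have : (⌊N * a⌋ : ℝ) < ⌊N * b⌋ + k + 1 := by linarith
    have : ⌊N * a⌋ < ⌊N * b⌋ + k + 1 := by exact_mod_cast this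
    omega
  have k1 := key x.1 p.1 (by linarith)
  have k2 := key p.1 x.1 (by linarith)
  have k3 := key x.2 p.2 (by linarith)
  have k4 := key p.2 x.2 (by linarith)
  unfold nr pxl; simp only; omega
theorem pxl_in {N M : ℕ} {x : Pt} (hx : ‖x‖ ≤ M) {k : ℤ} (hk : k ≤ N) {a : ℤ × ℤ}
    (h : nr k a (pxl N (N * (M + 1)) x)) : InB (2 * (N * (M + 1))) a.1 a.2 := by
  have hN : (0 : ℝ) ≤ N := Nat.cast_nonneg N
  have key : ∀ a : ℝ, |a| ≤ M → -(N * M : ℤ) ≤ ⌊N * a⌋ ∧ ⌊N * a⌋ ≤ N * M := by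
    intro a ha
    rw [abs_le] at ha
    constructor
    · rw [Int.le_floor]; push_cast; nlinarith
    · have h1 := Int.floor_le (N * a)
      have : (⌊N * a⌋ : ℝ) ≤ N * M := by nlinarith
      exact_mod_cast this
  have e : ‖x‖ = max |x.1| |x.2| := rfl
  rw [e, max_le_iff] at hx
  have h1 := key _ hx.1
  have h2 := key _ hx.2
  unfold nr pxl at h
  simp only at h
  unfold InB
  push_cast
  have e2 : (N : ℤ) * (M + 1) = N * M + N := by ring
  rw [e2] at h ⊢
  omega
theorem sep_pos {K L : Set Pt} (hK : IsCompact K) (hL : IsCompact L) (hd : Disjoint K L) :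
    ∃ δ > 0, ∀ x ∈ K, ∀ y ∈ L, δ ≤ dist x y := by
  obtain ⟨r, hr, h⟩ := Metric.exists_pos_forall_lt_edist hK hL.isClosed hd
  refine ⟨r, hr, fun x hx y hy => ?_⟩
  have := h x hx y hy
  rw [edist_nndist] at this
  exact_mod_cast this.le
theorem ev_lt {δ : ℝ} (h : 0 < δ) : ∀ᶠ r in 𝓝[>] (0 : ℝ), r < δ :=
  eventually_nhdsWithin_of_eventually_nhds (gt_mem_nhds h)
theorem first_hit {β : ℝ → Pt} (hβ : ContinuousOn β (Icc 0 1)) {p : Pt} (h1 : β 1 = p) {r : ℝ} (hr : 0 < r)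
    (h0 : r < dist (β 0) p) : ∃ t ∈ Icc (0 : ℝ) 1, dist (β t) p ≤ r ∧ ∀ s ∈ Icc 0 t, r ≤ dist (β s) p := by
  have hc : ContinuousOn (fun t => dist (β t) p) (Icc 0 1) :=
    (continuous_id.dist continuous_const).comp_continuousOn hβ
  have hS : IsCompact (Icc (0 : ℝ) 1 ∩ (fun t => dist (β t) p) ⁻¹' Iic r) :=
    isCompact_Icc.of_isClosed_subset (hc.preimage_isClosed_of_isClosed isClosed_Icc isClosed_Iic) inter_subset_left
  obtain ⟨t, ⟨ht, ht'⟩, hm⟩ := hS.exists_isLeast ⟨1, ⟨zero_le_one, le_rfl⟩, by simp [h1, hr.le]⟩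
  have h2 : ∀ s ∈ Icc 0 t, s < t → r < dist (β s) p := by
    intro s hs hst
    by_contra hcon
    exact absurd (hm ⟨⟨hs.1, hs.2.trans ht.2⟩, not_lt.1 hcon⟩) (not_le.2 hst)
  refine ⟨t, ht, ht', fun s hs => ?_⟩
  rcases hs.2.lt_or_eq with h | h
  · exact (h2 s hs h).le
  · subst h
    obtain ⟨u, hu, hu'⟩ := intermediate_value_Icc' ht.1 (hc.mono (Icc_subset_Icc le_rfl ht.2)) ⟨ht', h0.le⟩
    rcases hu.2.lt_or_eq with h | h
    · exact absurd hu' (h2 u hu h).ne'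
    · rw [← h]; exact hu'.ge
end D3
end RAC

namespace RAC
section D4
open Relation Filter Topology
theorem top_layout {V I J : Type*} [Finite V] [Nonempty V] [Finite I] [Finite J] {pos : V → Pt} {pj : J → Pt}
    (hpos : Function.Injective pos) (hpj : Function.Injective pj) {vI : I → V} {jI : I → J} {β : I → ℝ → Pt}
    (hc : ∀ i, ContinuousOn (β i) (Icc 0 1)) (h0 : ∀ i, β i 0 = pos (vI i)) (h1 : ∀ i, β i 1 = pj (jI i))
    (ha : ∀ v j, pos v ≠ pj j) (hb : ∀ i j, ∀ t ∈ Icc (0 : ℝ) 1, β i t = pj j → j = jI i)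
    (hcr : ∀ i i', vI i ≠ vI i' → ∀ t ∈ Icc (0 : ℝ) 1, ∀ t' ∈ Icc (0 : ℝ) 1, β i t = β i' t' → β i t = pj (jI i))
    (hd : ∀ i v, ∀ t ∈ Icc (0 : ℝ) 1, β i t = pos v → v = vI i)
    (he : ∀ j, ∃ i i', jI i = j ∧ jI i' = j ∧ vI i ≠ vI i') :
    ∃ (y : V → ℕ) (X : J → ℕ), Function.Injective y ∧ Function.Injective X ∧
    ∀ g g1 g2 w a b i i' i1 i2, jI i = g → vI i = a → jI i' = g → vI i' = b → y a < y w → y w < y b →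
      jI i1 = g1 → vI i1 = w → jI i2 = g2 → vI i2 = w → X g1 < X g → X g < X g2 → False := by
  have e1 : ∀ᶠ r in 𝓝[>] (0 : ℝ), ∀ j j', j ≠ j' → 4 * r ≤ dist (pj j) (pj j') := by
    simp only [eventually_all]
    intro j j' hj
    filter_upwards [ev_lt (by have := dist_pos.2 (hpj.ne hj); linarith : 0 < dist (pj j) (pj j') / 4)] with r hr
    linarith
  have e2 : ∀ᶠ r in 𝓝[>] (0 : ℝ), ∀ i j, j ≠ jI i → ∀ t ∈ Icc (0 : ℝ) 1, r ≤ dist (β i t) (pj j) := by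
    simp only [eventually_all]
    intro i j hj
    obtain ⟨δ, hδ, h⟩ := sep_pos (isCompact_Icc.image_of_continuousOn (hc i)) (isCompact_singleton (x := pj j))
      (by rw [Set.disjoint_singleton_right]; rintro ⟨t, ht, h⟩; exact hj (hb i j t ht h))
    filter_upwards [ev_lt hδ] with r hr t ht
    exact hr.le.trans (h _ ⟨t, ht, rfl⟩ _ rfl)
  have e3 : ∀ᶠ r in 𝓝[>] (0 : ℝ), ∀ v j, r < dist (pos v) (pj j) := by
    simp only [eventually_all]
    exact fun v j => ev_lt (dist_pos.2 (ha v j))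
  obtain ⟨r, e1, e2, e3, hr1, hr0⟩ := (e1.and (e2.and (e3.and ((ev_lt one_pos).and self_mem_nhdsWithin)))).exists
  have hr0 : 0 < r := hr0
  have hit : ∀ i, ∃ t ∈ Icc (0 : ℝ) 1, dist (β i t) (pj (jI i)) ≤ r ∧ ∀ s ∈ Icc 0 t, r ≤ dist (β i s) (pj (jI i)) :=
    fun i => first_hit (hc i) (h1 i) hr0 (by rw [h0]; exact e3 _ _)
  choose τ hτ hτ1 hτ2 using hit
  let F : V → Set Pt := fun v => {pos v} ∪ ⋃ i ∈ {i | vI i = v}, β i '' Icc 0 (τ i)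
  have hsub : ∀ i, Icc 0 (τ i) ⊆ Icc 0 1 := fun i => Icc_subset_Icc le_rfl (hτ i).2
  have memF : ∀ v x, x ∈ F v ↔ x = pos v ∨ ∃ i, vI i = v ∧ ∃ t ∈ Icc 0 (τ i), β i t = x := by
    intro v x; simp [F]
  have Fcomp : ∀ v, IsCompact (F v) := fun v =>
    isCompact_singleton.union ((Set.toFinite _).isCompact_biUnion
      (fun i _ => isCompact_Icc.image_of_continuousOn ((hc i).mono (hsub i))))
  have Fconn : ∀ v, IsPreconnected (F v) := by
    intro v
    refine isPreconnected_of_forall (pos v) ?_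
    intro x hx
    rcases (memF v x).1 hx with rfl | ⟨i, hi, t, ht, rfl⟩
    · exact ⟨{pos v}, by simpa using hx, rfl, rfl, isPreconnected_singleton⟩
    · refine ⟨β i '' Icc 0 (τ i), ?_, ⟨0, ⟨le_rfl, (hτ i).1⟩, by rw [h0, hi]⟩, ⟨t, ht, rfl⟩,
        isPreconnected_Icc.image _ ((hc i).mono (hsub i))⟩
      rintro _ ⟨s, hs, rfl⟩
      exact (memF v _).2 (Or.inr ⟨i, hi, s, hs, rfl⟩)
  have Fout : ∀ v, ∀ x ∈ F v, ∀ j, r ≤ dist x (pj j) := by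
    intro v x hx j
    rcases (memF v x).1 hx with rfl | ⟨i, hi, t, ht, rfl⟩
    · exact (e3 v j).le
    · by_cases hj : j = jI i
      · rw [hj]; exact hτ2 i t ht
      · exact e2 i j hj t (hsub i ht)
  have Fdisj : ∀ v v', v ≠ v' → Disjoint (F v) (F v') := by
    intro v v' hne
    rw [Set.disjoint_left]
    intro x hx hx'
    have hox := Fout v x hx
    rcases (memF v x).1 hx with rfl | ⟨i, hi, t, ht, rfl⟩
    · rcases (memF v' _).1 hx' with h | ⟨i', hi', t', ht', h⟩
      · exact hne (hpos h)
      · exact hne ((hd i' v t' (hsub i' ht') h).trans hi')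
    · rcases (memF v' _).1 hx' with h | ⟨i', hi', t', ht', h⟩
      · exact hne ((hd i v' t (hsub i ht) h).trans hi).symm
      · have := hox (jI i)
        rw [hcr i i' (by rw [hi, hi']; exact hne) t (hsub i ht) t' (hsub i' ht') h.symm, dist_self] at this
        linarith
  have e4 : ∀ᶠ ε in 𝓝[>] (0 : ℝ), ∀ v v', v ≠ v' → ∀ x ∈ F v, ∀ x' ∈ F v', ε ≤ dist x x' := by
    simp only [eventually_all]
    intro v v' hne
    obtain ⟨δ, hδ, h⟩ := sep_pos (Fcomp v) (Fcomp v') (Fdisj v v' hne)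
    filter_upwards [ev_lt hδ] with ε hε x hx x' hx'
    exact hε.le.trans (h x hx x' hx')
  obtain ⟨ε, e4, hε⟩ := (e4.and self_mem_nhdsWithin).exists
  have hε : 0 < ε := hε
  obtain ⟨B, hB⟩ := (((isCompact_iUnion Fcomp).union (Set.finite_range pj).isCompact).isBounded).exists_norm_le
  obtain ⟨M, hM⟩ := exists_nat_ge B
  have hMF : ∀ v, ∀ x ∈ F v, ‖x‖ ≤ M := fun v x hx => (hB x (Or.inl (mem_iUnion.2 ⟨v, hx⟩))).trans hM
  have hMj : ∀ j, ‖pj j‖ ≤ M := fun j => (hB _ (Or.inr ⟨j, rfl⟩)).trans hM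
  obtain ⟨N, hN⟩ := exists_nat_ge (max (40 / r) (50 / ε))
  have hNr : 40 ≤ N * r := (div_le_iff₀ hr0).1 ((le_max_left _ _).trans hN)
  have hNe : 50 ≤ N * ε := (div_le_iff₀ hε).1 ((le_max_right _ _).trans hN)
  have hN0 : (0 : ℝ) ≤ N := Nat.cast_nonneg N
  have hN40 : (40 : ℝ) ≤ N := by nlinarith
  have hN40' : 40 ≤ N := by exact_mod_cast hN40
  have hNpos : (0 : ℝ) < N := by linarith
  set S : ℤ := N * (M + 1) with hS
  set R : ℤ := ⌊N * r⌋ - 2 with hR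
  have fl1 := Int.floor_le (N * r)
  have fl2 := Int.lt_floor_add_one (N * r)
  have hRr : (R : ℝ) = ⌊N * r⌋ - 2 := by rw [hR]; push_cast; ring
  have hR37 : 37 ≤ R := by
    have : (37 : ℝ) < R + 1 := by rw [hRr]; linarith
    have : (37 : ℤ) < R + 1 := by exact_mod_cast this
    omega
  have hRN : R ≤ N := by
    have : (R : ℝ) ≤ N := by rw [hRr]; nlinarith
    exact_mod_cast this
  have Q : ∀ j v, (∃ i, jI i = j ∧ vI i = v) → ∃ a, ∃ s ∈ pxl N S '' F v, ∃ o i, rg R (pxl N S (pj j)) a ∧ ad a o ∧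
      ¬ nr R o (pxl N S (pj j)) ∧ nr (R + 1) o (pxl N S (pj j)) ∧ nr 6 o s ∧ nr 7 a s ∧ ad i a ∧
      nr (R - 1) i (pxl N S (pj j)) := by
    rintro j v ⟨i, rfl, rfl⟩
    have hm : β i (τ i) ∈ F (vI i) := (memF _ _).2 (Or.inr ⟨i, rfl, τ i, ⟨(hτ i).1, le_rfl⟩, rfl⟩)
    have hf : ¬ nr R (pxl N S (β i (τ i))) (pxl N S (pj (jI i))) := fun h => by
      have h1 := pxl_far h
      have h2 := Fout _ _ hm (jI i)
      nlinarith
    have hn : nr (R + 3) (pxl N S (β i (τ i))) (pxl N S (pj (jI i))) := by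
      refine pxl_near ?_
      push_cast
      have := hτ1 i
      nlinarith
    obtain ⟨a, o, i', h⟩ := exists_seed (by omega) hf hn
    exact ⟨a, _, ⟨_, hm, rfl⟩, o, i', h⟩
  classical
  let D : Pix V J (2 * (N * (M + 1))) R :=
  { z := fun j => pxl N S (pj j)
    F := fun v => pxl N S '' F v
    Inc := fun j v => ∃ i, jI i = j ∧ vI i = v
    sd := fun j v => if h : ∃ i, jI i = j ∧ vI i = v then (Q j v h).choose else (0, 0)
    hR := by omega
    zin := fun j a h => pxl_in (hMj j) hRN h
    fin := by
      rintro v _ ⟨x, hx, rfl⟩ a h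
      exact pxl_in (hMF v x hx) (by omega) h
    ne := fun v => ⟨_, _, (memF v (pos v)).2 (Or.inl rfl), rfl⟩
    ch := by
      rintro v _ ⟨x, hx, rfl⟩ _ ⟨x', hx', rfl⟩
      refine (Fconn v).induction₂ (fun x x' => ReflTransGen (fun a b => nr 1 a b ∧ a ∈ pxl N S '' F v ∧ b ∈ pxl N S '' F v)
        (pxl N S x) (pxl N S x')) ?_ (fun _ _ _ _ _ _ h h' => h.trans h')
        (fun _ _ _ _ h => rtg_symm (fun _ _ h => ⟨nr_symm h.1, h.2.2, h.2.1⟩) h) hx hx'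
      intro x hx
      filter_upwards [self_mem_nhdsWithin, mem_nhdsWithin_of_mem_nhds (Metric.ball_mem_nhds x (inv_pos.2 hNpos))] with u hu hu'
      refine .single ⟨pxl_near ?_, ⟨x, hx, rfl⟩, ⟨u, hu, rfl⟩⟩
      rw [Metric.mem_ball, dist_comm] at hu'
      have := mul_le_mul_of_nonneg_left hu'.le hN0
      rw [mul_inv_cancel₀ hNpos.ne'] at this
      exact_mod_cast this
    out := by
      rintro v _ ⟨x, hx, rfl⟩ j h
      have h1 := pxl_far h
      have h2 := Fout v x hx j
      nlinarith
    sepV := by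
      rintro v v' hne _ ⟨x, hx, rfl⟩ _ ⟨x', hx', rfl⟩ h
      have h1 := pxl_far h
      have h2 := e4 v v' hne x hx x' hx'
      push_cast at h1
      nlinarith
    sepJ := by
      intro j j' hne h
      have h1 := pxl_far h
      have h2 := e1 j j' hne
      push_cast at h1
      nlinarith
    sdp := by
      intro j v h
      rw [dif_pos h]
      exact (Q j v h).choose_spec
    two := by
      intro j
      obtain ⟨i, i', hi, hi', hne⟩ := he j
      exact ⟨_, _, hne, ⟨i, hi, rfl⟩, ⟨i', hi', rfl⟩⟩ }
  obtain ⟨y, X, hy, hX, hs⟩ := D.layout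
  exact ⟨y, X, hy, hX, fun g g1 g2 w a b i i' i1 i2 a1 a2 a3 a4 a5 a6 a7 a8 a9 b1 b2 b3 =>
    hs g w a b g1 g2 ⟨i, a1, a2⟩ ⟨i', a3, a4⟩ a5 a6 ⟨i1, a7, a8⟩ ⟨i2, a9, b1⟩ b2 b3⟩
end D4
end RAC

namespace RAC
section D5
structure Lay {V : Type*} (G : SimpleGraph V) (cr : Sym2 V → Sym2 V → Prop) (y : V → ℕ) (x : Sym2 V → ℕ) : Prop where
  yinj : Function.Injective y
  cr_iff : ∀ e ∈ G.edgeSet, ∀ f ∈ G.edgeSet, e ≠ f → (x e = x f ↔ cr e f)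
  star : ∀ e ∈ G.edgeSet, ∀ e' ∈ G.edgeSet, ∀ f ∈ G.edgeSet, ∀ f' ∈ G.edgeSet, ∀ a b w, x e = x e' → a ∈ e → b ∈ e' →
    w ∈ f → w ∈ f' → y a < y w → y w < y b → x f < x e → x e < x f' → False
def carr {V : Type*} {G : SimpleGraph V} (D : Drawing G) (e : Sym2 V) : Set Pt :=
  {p | ∃ (u v : V) (h : G.Adj u v), e = s(u, v) ∧ p ∈ (D.arc h).carrier}
theorem mem_carr {V : Type*} {G : SimpleGraph V} {D : Drawing G} {u v : V} (h : G.Adj u v) {p : Pt} : p ∈ carr D s(u, v) ↔ p ∈ (D.arc h).carrier := by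
  constructor
  · rintro ⟨u', v', h', he, hp⟩
    rw [Sym2.eq_iff] at he
    rcases he with ⟨rfl, rfl⟩ | ⟨rfl, rfl⟩
    · exact hp
    · rw [← D.arc_symm h] ; exact hp
  · exact fun hp => ⟨u, v, h, rfl, hp⟩
theorem crossE_iff {V : Type*} {G : SimpleGraph V} {D : Drawing G} {e f : Sym2 V} :
    D.CrossE e f ↔ ∃ p, p ∈ carr D e ∧ p ∈ carr D f ∧ p ∉ range D.pos := by
  constructor
  · rintro ⟨u, v, x, y, h1, h2, rfl, rfl, p, hp1, hp2, hp3⟩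
    exact ⟨p, (mem_carr h1).2 hp1, (mem_carr h2).2 hp2, hp3⟩
  · rintro ⟨p, ⟨u, v, h1, rfl, hp1⟩, ⟨x, y, h2, rfl, hp2⟩, hp3⟩
    exact ⟨u, v, x, y, h1, h2, rfl, rfl, p, hp1, hp2, hp3⟩
theorem exists_lay {V : Type*} [Finite V] {G : SimpleGraph V} (D : ICDrawing G) :
    ∃ y x, Lay G D.toDrawing.CrossE y x := by
  classical
  rcases isEmpty_or_nonempty V with hV | hV
  · refine ⟨fun _ => 0, fun _ => 0, fun a => (IsEmpty.false a).elim, fun e => ?_, fun e => ?_⟩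
    · induction e with | _ a b => exact (IsEmpty.false a).elim
    · induction e with | _ a b => exact (IsEmpty.false a).elim
  have hsimp : ∀ e f : Sym2 V, e ≠ f → ∀ p q, p ∈ carr D.toDrawing e → p ∈ carr D.toDrawing f →
      q ∈ carr D.toDrawing e → q ∈ carr D.toDrawing f → p = q := by
    rintro e f hne p q ⟨u, v, h1, rfl, hp1⟩ ⟨x, y, h2, rfl, hp2⟩ hq1 hq2
    exact D.simple h1 h2 hne ⟨hp1, hp2⟩ ⟨(mem_carr h1).1 hq1, (mem_carr h2).1 hq2⟩
  have hor : ∀ e : G.edgeSet, ∃ (u v : V) (_ : G.Adj u v), e.1 = s(u, v) := by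
    rintro ⟨e, he⟩
    induction e with | _ a b => exact ⟨a, b, he, rfl⟩
  choose u v hadj huv using hor
  have hcar : ∀ e : G.edgeSet, carr D.toDrawing e.1 = (D.arc (hadj e)).carrier := by
    intro e; ext p; rw [huv e]; exact mem_carr _
  let γ : G.edgeSet → ℝ → Pt := fun e => (D.arc (hadj e)).toFun
  have γ0 : ∀ e, γ e 0 = D.pos (u e) := fun e => (D.arc (hadj e)).src
  have γ1 : ∀ e, γ e 1 = D.pos (v e) := fun e => (D.arc (hadj e)).tgt
  have γinj : ∀ e, InjOn (γ e) (Icc 0 1) := fun e => (D.arc (hadj e)).inj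
  have γmem : ∀ e, ∀ t ∈ Icc (0 : ℝ) 1, γ e t ∈ carr D.toDrawing e.1 := fun e t ht => by
    rw [hcar]; exact ⟨t, ht, rfl⟩
  have hav : ∀ e : G.edgeSet, ∀ t ∈ Icc (0 : ℝ) 1, ∀ w, γ e t = D.pos w → (w = u e ∧ t = 0) ∨ (w = v e ∧ t = 1) := by
    intro e t ht w h
    rcases D.arc_avoid (hadj e) w (h ▸ ⟨t, ht, rfl⟩) with rfl | rfl
    · exact Or.inl ⟨rfl, γinj e ht ⟨le_rfl, zero_le_one⟩ (h.trans (γ0 e).symm)⟩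
    · exact Or.inr ⟨rfl, γinj e ht ⟨zero_le_one, le_rfl⟩ (h.trans (γ1 e).symm)⟩
  have hm : ∀ e : G.edgeSet, ∃ p, p ∈ carr D.toDrawing e.1 ∧ p ∉ range D.pos ∧
      ∀ f, f ≠ e.1 → D.toDrawing.CrossE e.1 f → p ∈ carr D.toDrawing f := by
    intro e
    by_cases h : ∃ f, f ≠ e.1 ∧ D.toDrawing.CrossE e.1 f
    · obtain ⟨f, hf, hc⟩ := h
      obtain ⟨p, h1, h2, h3⟩ := crossE_iff.1 hc
      refine ⟨p, h1, h3, fun f' hf' hc' => ?_⟩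
      rw [huv e] at hf hf' hc hc'
      rwa [D.once (hadj e) ⟨hf', hc'⟩ ⟨hf, hc⟩]
    · push Not at h
      refine ⟨γ e (1 / 2), γmem e _ (by norm_num), ?_, fun f hf hc => absurd hc (h f hf)⟩
      rintro ⟨w, hw⟩
      rcases hav e (1 / 2) (by norm_num) w hw.symm with h | h <;> norm_num at h
  choose m hm1 hm2 hm3 using hm
  have hmcr : ∀ e f : G.edgeSet, e ≠ f → (m e = m f ↔ D.toDrawing.CrossE e.1 f.1) := by
    intro e f hne
    have hne' : e.1 ≠ f.1 := fun h => hne (Subtype.ext h)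
    constructor
    · exact fun h => crossE_iff.2 ⟨m e, hm1 e, h ▸ hm1 f, hm2 e⟩
    · intro h
      have h' : D.toDrawing.CrossE f.1 e.1 := by
        obtain ⟨p, h1, h2, h3⟩ := crossE_iff.1 h
        exact crossE_iff.2 ⟨p, h2, h1, h3⟩
      exact hsimp _ _ hne' _ _ (hm1 e) (hm3 e _ hne'.symm h) (hm3 f _ hne' h') (hm1 f)
  have ht0 : ∀ e, ∃ t ∈ Ioo (0 : ℝ) 1, γ e t = m e := by
    intro e
    have := hm1 e
    rw [hcar] at this
    obtain ⟨t, ht, he⟩ := this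
    have he : γ e t = m e := he
    refine ⟨t, ⟨lt_of_le_of_ne ht.1 ?_, lt_of_le_of_ne ht.2 ?_⟩, he⟩
    · rintro rfl; exact hm2 e ⟨u e, (γ0 e).symm.trans he⟩
    · rintro rfl; exact hm2 e ⟨v e, (γ1 e).symm.trans he⟩
  choose t0 ht0 hγt using ht0
  let vI : G.edgeSet × Bool → V := fun i => if i.2 then v i.1 else u i.1
  let φ : G.edgeSet × Bool → ℝ → ℝ := fun i s => if i.2 then 1 - s * (1 - t0 i.1) else s * t0 i.1
  have hφ : ∀ i, ∀ s ∈ Icc (0 : ℝ) 1, φ i s ∈ Icc (0 : ℝ) 1 := by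
    rintro ⟨e, b⟩ s ⟨hs0, hs1⟩
    have := (ht0 e).1
    have := (ht0 e).2
    cases b
    · simp only [φ]; constructor <;> simp <;> nlinarith
    · simp only [φ]; constructor <;> simp <;> nlinarith
  have hd : ∀ (i : G.edgeSet × Bool) (w : V), ∀ t ∈ Icc (0 : ℝ) 1, γ i.1 (φ i t) = D.pos w → w = vI i := by
    rintro ⟨e, b⟩ w s hs h
    have h1 := (ht0 e).1
    have h2 := (ht0 e).2
    obtain ⟨hs0, hs1⟩ := hs
    rcases hav e _ (hφ ⟨e, b⟩ s ⟨hs0, hs1⟩) w h with ⟨hw, h⟩ | ⟨hw, h⟩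
    · cases b
      · simpa [vI] using hw
      · exfalso; simp only [φ, if_true] at h; nlinarith
    · cases b
      · exfalso; simp only [φ, Bool.false_eq_true, if_false] at h; nlinarith
      · simpa [vI] using hw
  obtain ⟨y, X, hy, hX, hs⟩ := top_layout (V := V) (I := G.edgeSet × Bool) (J := range m) (pos := D.pos) (pj := fun j => j.1)
    D.pos_inj Subtype.val_injective (vI := vI) (jI := fun i => ⟨m i.1, i.1, rfl⟩) (β := fun i s => γ i.1 (φ i s))
    (by
      intro i
      refine (D.arc (hadj i.1)).cont.comp ?_ (hφ i)
      obtain ⟨e, b⟩ := i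
      cases b
      · simp only [φ, if_true, Bool.false_eq_true, if_false]; fun_prop
      · simp only [φ, if_true, Bool.false_eq_true, if_false]; fun_prop)
    (by
      rintro ⟨e, b⟩
      cases b
      · simp [φ, vI, γ0]
      · simp [φ, vI, γ1])
    (by
      rintro ⟨e, b⟩
      cases b
      · simp [φ, hγt]
      · simp [φ, hγt])
    (by
      rintro w ⟨_, e, rfl⟩ h
      exact hm2 e ⟨w, h⟩)
    (by
      rintro ⟨e, b⟩ ⟨_, f, rfl⟩ t ht h
      apply Subtype.ext
      change m f = m e
      by_cases hef : e = f
      · rw [hef]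
      · refine ((hmcr e f hef).2 (crossE_iff.2 ⟨m f, ?_, hm1 f, hm2 f⟩)).symm
        have h : γ e (φ (e, b) t) = m f := h
        rw [← h]
        exact γmem e _ (hφ _ t ht))
    (by
      intro i i' hv t ht t' ht' h
      change γ i.1 (φ i t) = m i.1
      have h : γ i.1 (φ i t) = γ i'.1 (φ i' t') := h
      by_cases hee : i.1 = i'.1
      · obtain ⟨e, b⟩ := i
        obtain ⟨e', b'⟩ := i'
        have hee : e = e' := hee
        subst hee
        have h := γinj e (hφ _ t ht) (hφ _ t' ht') h
        have h1 := (ht0 e).1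
        have h2 := (ht0 e).2
        obtain ⟨ht1, ht2⟩ := ht
        obtain ⟨ht1', ht2'⟩ := ht'
        suffices φ (e, b) t = t0 e by rw [← hγt e, ← this]
        cases b <;> cases b' <;> simp only [φ, vI, if_true, Bool.false_eq_true, if_false, ne_eq, not_true] at h hv ⊢ <;>
          nlinarith
      · have hp1 := γmem i.1 _ (hφ i t ht)
        have hp2 := γmem i'.1 _ (hφ i' t' ht')
        rw [← h] at hp2
        by_cases hp : γ i.1 (φ i t) ∈ range D.pos
        · obtain ⟨w, hw⟩ := hp
          exact absurd ((hd i w t ht hw.symm).symm.trans (hd i' w t' ht' (h.symm.trans hw.symm))) hv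
        · have hee' : i.1.1 ≠ i'.1.1 := fun h => hee (Subtype.ext h)
          have hm' := (hmcr _ _ hee).2 (crossE_iff.2 ⟨_, hp1, hp2, hp⟩)
          exact hsimp _ _ hee' _ _ hp1 hp2 (hm1 i.1) (hm' ▸ hm1 i'.1))
    hd
    (by
      rintro ⟨_, e, rfl⟩
      exact ⟨(e, false), (e, true), rfl, rfl, by simpa [vI] using (hadj e).ne⟩)
  have hinc : ∀ (e : G.edgeSet) (a : V), a ∈ e.1 → ∃ b, vI (e, b) = a := by
    intro e a ha
    rw [huv e, Sym2.mem_iff] at ha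
    rcases ha with rfl | rfl
    · exact ⟨false, rfl⟩
    · exact ⟨true, rfl⟩
  refine ⟨y, fun e => if h : e ∈ G.edgeSet then X ⟨m ⟨e, h⟩, _, rfl⟩ else 0, hy, ?_, ?_⟩
  · intro e he f hf hne
    simp only [he, hf, dif_pos]
    rw [← hmcr ⟨e, he⟩ ⟨f, hf⟩ (fun h => hne (congrArg Subtype.val h)), hX.eq_iff]
    exact Subtype.ext_iff
  · intro e he e' he' f hf f' hf' a b w hx ha hb hw hw' h1 h2 h3 h4
    simp only [he, he', hf, hf', dif_pos] at hx h3 h4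
    obtain ⟨i, hi⟩ := hinc ⟨e, he⟩ a ha
    obtain ⟨i', hi'⟩ := hinc ⟨e', he'⟩ b hb
    obtain ⟨k, hk⟩ := hinc ⟨f, hf⟩ w hw
    obtain ⟨k', hk'⟩ := hinc ⟨f', hf'⟩ w hw'
    exact hs _ _ _ w a b _ _ _ _ rfl hi (hX hx).symm hi' h1 h2 rfl hk rfl hk' h3 h4
end D5
end RAC

namespace RAC
section E1
theorem item_count {V : Type*} [Fintype V] (S : Finset ℕ) (lo hi : ℕ → V) (y : V → ℕ) (hy : Function.Injective y)
    (hlh : ∀ g ∈ S, y (lo g) < y (hi g)) (hinj : ∀ g ∈ S, ∀ g' ∈ S, lo g = lo g' → hi g = hi g' → g = g')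
    (star : ∀ g ∈ S, ∀ g1 ∈ S, ∀ g2 ∈ S, ∀ w, (w = lo g1 ∨ w = hi g1) → (w = lo g2 ∨ w = hi g2) → g1 < g → g < g2 →
      y (lo g) < y w → y w < y (hi g) → False) : S.card ≤ 3 * Fintype.card V := by
  classical
  let Rel : ℕ → V × Fin 3 → Prop := fun g p =>
    (p.2 = 0 ∧ hi g = p.1 ∧ ∀ h ∈ S, hi h = p.1 → g ≤ h) ∨
    (p.2 = 1 ∧ ((lo g = p.1 ∧ ∀ h ∈ S, lo h = p.1 → g ≤ h) ∨ ((∀ h ∈ S, lo h ≠ p.1) ∧ y (lo g) < y p.1 ∧ y p.1 < y (hi g) ∧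
      ∃ h ∈ S, p.1 = hi h ∧ h < g ∧ ∀ k ∈ S, y (lo k) < y p.1 → y p.1 < y (hi k) → h < k → g ≤ k))) ∨
    (p.2 = 2 ∧ ∃ g' ∈ S, lo g' = p.1 ∧ (∀ h ∈ S, lo h = p.1 → h ≤ g') ∧ hi g' = hi g ∧ g' < g ∧
      ∀ h ∈ S, hi h = hi g → g' < h → g ≤ h)
  have ex : ∀ g ∈ S, ∃ p, Rel g p := by
    intro g hg
    by_cases hP : ∃ h ∈ S, hi h = hi g ∧ h < g
    swap
    · push Not at hP
      exact ⟨(hi g, 0), Or.inl ⟨rfl, rfl, hP⟩⟩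
    obtain ⟨g', hg', hmax⟩ := Finset.exists_max_image (S.filter (fun h => hi h = hi g ∧ h < g)) id
      (by obtain ⟨h, h1, h2⟩ := hP; exact ⟨h, Finset.mem_filter.2 ⟨h1, h2⟩⟩)
    rw [Finset.mem_filter] at hg'
    obtain ⟨hg', hhi, hlt⟩ := hg'
    have hsucc : ∀ h ∈ S, hi h = hi g → g' < h → g ≤ h := by
      intro h hh h1 h2
      by_contra h3
      exact absurd (hmax h (Finset.mem_filter.2 ⟨hh, h1, not_le.1 h3⟩)) (not_le.2 h2)
    obtain ⟨c, hc, hcm⟩ := Finset.exists_max_image (Finset.univ.filter (fun w => y w < y (hi g) ∧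
      ∃ h ∈ S, g' ≤ h ∧ h ≤ g ∧ (w = lo h ∨ w = hi h))) y
      ⟨lo g, Finset.mem_filter.2 ⟨Finset.mem_univ _, hlh g hg, g, hg, hlt.le, le_rfl, Or.inl rfl⟩⟩
    have hcm : ∀ w, y w < y (hi g) → ∀ h ∈ S, g' ≤ h → h ≤ g → (w = lo h ∨ w = hi h) → y w ≤ y c :=
      fun w h1 h h2 h3 h4 h5 => hcm w (Finset.mem_filter.2 ⟨Finset.mem_univ _, h1, h, h2, h3, h4, h5⟩)
    obtain ⟨-, hcb, h0, hh0, hh1, hh2, hct⟩ := Finset.mem_filter.1 hc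
    have hno : ∀ k ∈ S, g' < k → k < g → y (lo k) ≤ y c → y c < y (hi k) → False := by
      intro k hk h1 h2 h3 h4
      rcases lt_trichotomy (y (hi k)) (y (hi g)) with h | h | h
      · exact absurd (hcm _ h k hk h1.le h2.le (Or.inr rfl)) (not_le.2 h4)
      · exact absurd (hsucc k hk (hy h) h1) (not_le.2 h2)
      · exact star k hk g' hg' g hg (hi g) (Or.inr hhi.symm) (Or.inr rfl) h1 h2 (lt_of_le_of_lt h3 hcb) h
    have ha : y (lo g) ≤ y c := hcm _ (hlh g hg) g hg hlt.le le_rfl (Or.inl rfl)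
    have ha' : y (lo g') ≤ y c := hcm _ (hhi ▸ hlh g' hg') g' hg' le_rfl hlt.le (Or.inl rfl)
    have hne : lo g' ≠ lo g := fun h => absurd (hinj g' hg' g hg h hhi) hlt.ne
    by_cases h1 : lo g = c
    · refine ⟨(c, 1), Or.inr (Or.inl ⟨rfl, Or.inl ⟨h1, fun h hh hl => ?_⟩⟩)⟩
      have hl : lo h = c := hl
      by_contra hlt'
      rw [not_le] at hlt'
      rcases lt_trichotomy h g' with h2 | h2 | h2
      · refine star g' hg' h hh g hg c (Or.inl hl.symm) (Or.inl h1.symm) h2 hlt (lt_of_le_of_ne ha' (fun e => hne ?_)) (hhi ▸ hcb)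
        rw [h1]; exact hy e
      · subst h2; exact hne (hl.trans h1.symm)
      · exact hno h hh h2 hlt' (hl ▸ le_rfl) (hl ▸ hlh h hh)
    by_cases h2 : lo g' = c
    · refine ⟨(c, 2), Or.inr (Or.inr ⟨rfl, g', hg', h2, fun h hh hl => ?_, hhi, hlt, hsucc⟩)⟩
      have hl : lo h = c := hl
      by_contra hlt'
      rw [not_le] at hlt'
      rcases lt_trichotomy h g with h3 | h3 | h3
      · exact hno h hh hlt' h3 (hl ▸ le_rfl) (hl ▸ hlh h hh)
      · subst h3; exact h1 hl
      · exact star g hg g' hg' h hh c (Or.inl h2.symm) (Or.inl hl.symm) hlt h3 (lt_of_le_of_ne ha (fun e => h1 (hy e))) hcb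
    have pg : y (lo g) < y c := lt_of_le_of_ne ha (fun e => h1 (hy e))
    have pg' : y (lo g') < y c := lt_of_le_of_ne ha' (fun e => h2 (hy e))
    have hin : ∀ k ∈ S, (c = lo k ∨ c = hi k) → k ≠ g ∧ k ≠ g' := by
      intro k hk hck
      constructor
      · rintro rfl
        rcases hck with e | e
        · exact h1 e.symm
        · rw [e] at hcb; exact lt_irrefl _ hcb
      · rintro rfl
        rcases hck with e | e
        · exact h2 e.symm
        · rw [e, hhi] at hcb; exact lt_irrefl _ hcb
    have hh0' := hin h0 hh0 hct
    have hlt0 : h0 < g := lt_of_le_of_ne hh2 hh0'.1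
    have hgt0 : g' < h0 := lt_of_le_of_ne hh1 (Ne.symm hh0'.2)
    have hout : ∀ h ∈ S, lo h ≠ c := by
      intro h hh hl
      have h3 := hin h hh (Or.inl hl.symm)
      rcases lt_or_gt_of_ne h3.1 with h4 | h4
      · rcases lt_or_gt_of_ne h3.2 with h5 | h5
        · exact star g' hg' h hh h0 hh0 c (Or.inl hl.symm) hct h5 hgt0 pg' (hhi ▸ hcb)
        · exact hno h hh h5 h4 (hl ▸ le_rfl) (hl ▸ hlh h hh)
      · exact star g hg h0 hh0 h hh c hct (Or.inl hl.symm) hlt0 h4 pg hcb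
    refine ⟨(c, 1), Or.inr (Or.inl ⟨rfl, Or.inr ⟨hout, pg, hcb, h0, hh0, hct.resolve_left (fun e => hout _ hh0 e.symm), hlt0, ?_⟩⟩)⟩
    intro k hk h3 h4 h5
    by_contra h6
    exact hno k hk (hgt0.trans h5) (not_le.1 h6) h3.le h4
  have uq : ∀ g ∈ S, ∀ h ∈ S, ∀ p, Rel g p → Rel h p → g = h := by
    rintro g hg h hh ⟨c, i⟩ r1 r2
    rcases r1 with ⟨hi1, r1⟩ | ⟨hi1, r1⟩ | ⟨hi1, r1⟩ <;> rcases r2 with ⟨hi2, r2⟩ | ⟨hi2, r2⟩ | ⟨hi2, r2⟩ <;>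
      simp only at hi1 hi2 <;> first | (exfalso; rw [hi1] at hi2; exact absurd hi2 (by decide)) | skip
    · exact le_antisymm (r1.2 h hh r2.1) (r2.2 g hg r1.1)
    · rcases r1 with r1 | r1 <;> rcases r2 with r2 | r2
      · exact le_antisymm (r1.2 h hh r2.1) (r2.2 g hg r1.1)
      · exact absurd r1.1 (r2.1 g hg)
      · exact absurd r2.1 (r1.1 h hh)
      · obtain ⟨-, a1, a2, k1, hk1, e1, l1, m1⟩ := r1
        obtain ⟨-, b1, b2, k2, hk2, e2, l2, m2⟩ := r2
        have key : ∀ g ∈ S, ∀ k ∈ S, c = hi k → y (lo g) < y c → y c < y (hi g) → ∀ k' ∈ S, c = hi k' → k' < g → k < g := by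
          intro g hg k hk e a1 a2 k' hk' e' l
          by_contra hc
          rcases (not_lt.1 hc).lt_or_eq with h | h
          · exact star g hg k' hk' k hk c (Or.inr e') (Or.inr e) l h a1 a2
          · subst h; rw [← e] at a2; exact lt_irrefl _ a2
        exact le_antisymm (m1 h hh b1 b2 (key h hh k1 hk1 e1 b1 b2 k2 hk2 e2 l2))
          (m2 g hg a1 a2 (key g hg k2 hk2 e2 a1 a2 k1 hk1 e1 l1))
    · obtain ⟨k1, hk1, e1, m1, h1, l1, s1⟩ := r1
      obtain ⟨k2, hk2, e2, m2, h2, l2, s2⟩ := r2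
      have : k1 = k2 := le_antisymm (m2 k1 hk1 e1) (m1 k2 hk2 e2)
      subst this
      exact le_antisymm (s1 h hh (h2.symm.trans h1) l2) (s2 g hg (h1.symm.trans h2) l1)
  rcases S.eq_empty_or_nonempty with rfl | ⟨g0, -⟩
  · simp
  have : Nonempty (V × Fin 3) := ⟨(lo g0, 0)⟩
  choose! f hf using ex
  have := Finset.card_le_card_of_injOn (s := S) (t := (Finset.univ : Finset (V × Fin 3))) f (fun _ _ => Finset.mem_univ _)
    (fun g hg h hh e => uq g hg h hh (f g) (hf g hg) (e ▸ hf h hh))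
  rw [Finset.card_univ, Fintype.card_prod, Fintype.card_fin] at this
  omega
structure LayZ {V : Type*} (G : SimpleGraph V) (cr : Sym2 V → Sym2 V → Prop) (n : ℕ) (Y : V → ℤ) (X : Sym2 V → ℤ) : Prop where
  yinj : Function.Injective Y
  ygap : ∀ u v, Y u < Y v → Y u + 4 ≤ Y v
  xgap : ∀ e ∈ G.edgeSet, ∀ f ∈ G.edgeSet, X e < X f → X e + 8 ≤ X f
  ybd : ∀ v, 2 ≤ Y v ∧ Y v + 2 ≤ 40 * n
  xbd : ∀ e ∈ G.edgeSet, 8 ≤ X e ∧ X e + 2 ≤ 40 * n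
  cr_iff : ∀ e ∈ G.edgeSet, ∀ f ∈ G.edgeSet, e ≠ f → (X e = X f ↔ cr e f)
  star : ∀ e ∈ G.edgeSet, ∀ e' ∈ G.edgeSet, ∀ f ∈ G.edgeSet, ∀ f' ∈ G.edgeSet, ∀ a b w, X e = X e' → a ∈ e → b ∈ e' →
    w ∈ f → w ∈ f' → Y a < Y w → Y w < Y b → X f < X e → X e < X f' → False
theorem rank_lt {S : Finset ℕ} {a b : ℕ} (ha : a ∈ S) (h : a < b) : (S.filter (· < a)).card < (S.filter (· < b)).card := by
  apply Finset.card_lt_card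
  refine ⟨fun c hc => ?_, fun hs => ?_⟩
  · rw [Finset.mem_filter] at *; exact ⟨hc.1, hc.2.trans h⟩
  · have := hs (Finset.mem_filter.2 ⟨ha, h⟩)
    rw [Finset.mem_filter] at this; exact lt_irrefl _ this.2
theorem exists_layZ {V : Type*} [Fintype V] {G : SimpleGraph V} {cr : Sym2 V → Sym2 V → Prop} {y : V → ℕ} {x : Sym2 V → ℕ}
    (L : Lay G cr y x) : ∃ Y X, LayZ G cr (Fintype.card V) Y X := by
  classical
  rcases isEmpty_or_nonempty V with hV | hV
  · have hE : ∀ e : Sym2 V, False := fun e => by induction e with | _ a b => exact hV.elim a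
    exact ⟨fun _ => 0, fun _ => 0, fun a => hV.elim a, fun a => hV.elim a, fun e => (hE e).elim, fun a => hV.elim a,
      fun e => (hE e).elim, fun e => (hE e).elim, fun e => (hE e).elim⟩
  let S := G.edgeFinset.image x
  have hS : ∀ e ∈ G.edgeSet, x e ∈ S := fun e he => Finset.mem_image_of_mem _ (SimpleGraph.mem_edgeFinset.2 he)
  have hex : ∀ g ∈ S, ∃ p : V × V, y p.1 < y p.2 ∧ s(p.1, p.2) ∈ G.edgeSet ∧ x s(p.1, p.2) = g := by
    intro g hg
    obtain ⟨e, he, hx⟩ := Finset.mem_image.1 hg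
    rw [SimpleGraph.mem_edgeFinset] at he
    induction e with
    | _ a b =>
      rcases lt_trichotomy (y a) (y b) with h | h | h
      · exact ⟨(a, b), h, he, hx⟩
      · exact absurd (L.yinj h) (G.ne_of_adj he)
      · exact ⟨(b, a), h, by rwa [Sym2.eq_swap], by rwa [Sym2.eq_swap]⟩
  choose! p hp1 hp2 hp3 using hex
  have hc : S.card ≤ 3 * Fintype.card V := by
    refine item_count S (fun g => (p g).1) (fun g => (p g).2) y L.yinj hp1 (fun g hg g' hg' h1 h2 => ?_) ?_
    · rw [← hp3 g hg, ← hp3 g' hg']; rw [h1, h2]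
    · intro g hg g1 hg1 g2 hg2 w hw1 hw2 l1 l2 l3 l4
      refine L.star _ (hp2 g hg) _ (hp2 g hg) _ (hp2 g1 hg1) _ (hp2 g2 hg2) _ _ w rfl (Sym2.mem_mk_left _ _)
        (Sym2.mem_mk_right _ _) ?_ ?_ l3 l4 ?_ ?_
      · rcases hw1 with rfl | rfl <;> simp
      · rcases hw2 with rfl | rfl <;> simp
      · rwa [hp3 g hg, hp3 g1 hg1]
      · rwa [hp3 g hg, hp3 g2 hg2]
  have hn : 1 ≤ Fintype.card V := Fintype.card_pos
  let Q := (Finset.univ : Finset V).image y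
  have hQ : ∀ v, y v ∈ Q := fun v => Finset.mem_image_of_mem _ (Finset.mem_univ v)
  have hQc : Q.card ≤ Fintype.card V := Finset.card_image_le
  let X : Sym2 V → ℤ := fun e => 8 * ((S.filter (· < x e)).card : ℤ) + 8
  let Y : V → ℤ := fun v => 4 * ((Q.filter (· < y v)).card : ℤ) + 2
  have hY : ∀ u v, y u < y v → Y u + 4 ≤ Y v := by
    intro u v h
    have := rank_lt (hQ u) h
    simp only [Y]; omega
  have hX : ∀ e ∈ G.edgeSet, ∀ f ∈ G.edgeSet, x e < x f → X e + 8 ≤ X f := by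
    intro e he f hf h
    have := rank_lt (hS e he) h
    simp only [X]; omega
  have hY' : ∀ u v, Y u < Y v → y u < y v := by
    intro u v h
    by_contra h1
    rcases (not_lt.1 h1).lt_or_eq with h2 | h2
    · have := hY _ _ h2; omega
    · simp only [Y, h2] at h; omega
  have hX' : ∀ e ∈ G.edgeSet, ∀ f ∈ G.edgeSet, X e < X f → x e < x f := by
    intro u hu v hv h
    by_contra h1
    rcases (not_lt.1 h1).lt_or_eq with h2 | h2
    · have := hX _ hv _ hu h2; omega
    · simp only [X, h2] at h; omega
  have hXe : ∀ e ∈ G.edgeSet, ∀ f ∈ G.edgeSet, (X e = X f ↔ x e = x f) := by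
    intro e he f hf
    refine ⟨fun h => ?_, fun h => by simp only [X, h]⟩
    rcases lt_trichotomy (x e) (x f) with h1 | h1 | h1
    · have := hX _ he _ hf h1; omega
    · exact h1
    · have := hX _ hf _ he h1; omega
  refine ⟨Y, X, ⟨?_, ?_, ?_, ?_, ?_, ?_, ?_⟩⟩
  · intro u v h
    rcases lt_trichotomy (y u) (y v) with h1 | h1 | h1
    · have := hY _ _ h1; omega
    · exact L.yinj h1
    · have := hY _ _ h1; omega
  · exact fun u v h => hY u v (hY' u v h)
  · exact fun e he f hf h => hX e he f hf (hX' e he f hf h)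
  · intro v
    have : (Q.filter (· < y v)).card ≤ Q.card := Finset.card_filter_le _ _
    simp only [Y]; omega
  · intro e he
    have : (S.filter (· < x e)).card ≤ S.card := Finset.card_filter_le _ _
    simp only [X]; omega
  · exact fun e he f hf h => (hXe e he f hf).trans (L.cr_iff e he f hf h)
  · intro e he e' he' f hf f' hf' a b w h h1 h2 h3 h4 h5 h6 h7 h8
    exact L.star e he e' he' f hf f' hf' a b w ((hXe e he e' he').1 h) h1 h2 h3 h4 (hY' _ _ h5) (hY' _ _ h6) (hX' f hf e he h7)
      (hX' e he f' hf' h8)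
end E1
end RAC

namespace RAC
section E2
structure Itm {V : Type*} (T : ℤ → V → Prop) (Y : V → ℤ) : Prop where
  yinj : Function.Injective Y
  ygap : ∀ u v, Y u < Y v → Y u + 4 ≤ Y v
  gap : ∀ g h a b, T g a → T h b → g < h → g + 8 ≤ h
  lb : ∀ g a, T g a → 8 ≤ g
  star : ∀ g f h a b w, T g a → T g b → Y a < Y w → Y w < Y b → T f w → T h w → f < g → g < h → False
def Mid {V : Type*} (T : ℤ → V → Prop) (Y : V → ℤ) (g : ℤ) (w : V) : Prop :=
  T g w ∧ ∃ a b, T g a ∧ T g b ∧ Y a < Y w ∧ Y w < Y b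
structure Anc {V : Type*} (T : ℤ → V → Prop) (Y : V → ℤ) (Z : V → ℤ) : Prop where
  bd : ∀ w, Z w = 2 ∨ ∃ g, T g w ∧ g - 2 ≤ Z w ∧ Z w ≤ g + 2
  far : ∀ g a w, T g a → Z w ≤ g - 2 ∨ g + 2 ≤ Z w
  side : ∀ g h s t w, T g s → T g t → Y s < Y w → Y w < Y t → T h w → g ≠ h →
    (g + 8 ≤ h ∧ g + 2 ≤ Z w) ∨ (h ≤ g - 8 ∧ Z w ≤ g - 2)
  anch : ∀ g A B, Mid T Y g A → Mid T Y g B → A ≠ B → (∀ C, Mid T Y g C → C = A ∨ C = B) →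
    (Z A = g + 2 ∨ Z A = g - 2) ∨ (Z B = g + 2 ∨ Z B = g - 2)
theorem mid_le_two {V : Type*} {T : ℤ → V → Prop} {Y : V → ℤ} (I : Itm T Y) (w : V) (s : Finset ℤ)
    (hs : ∀ g ∈ s, Mid T Y g w) : s.card ≤ 2 := by
  by_contra h
  have h3 : 3 ≤ s.card := by omega
  have h0 : s.Nonempty := Finset.card_pos.1 (by omega)
  have h1 : 1 < s.card := by omega
  have hm := Finset.min'_lt_max'_of_card s h1
  have : (s \ {s.min' h0, s.max' h0}).Nonempty := by
    rw [← Finset.card_pos]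
    have a := Finset.le_card_sdiff {s.min' h0, s.max' h0} s
    have b : ({s.min' h0, s.max' h0} : Finset ℤ).card ≤ 2 := Finset.card_le_two
    omega
  obtain ⟨g, hg⟩ := this
  simp only [Finset.mem_sdiff, Finset.mem_insert, Finset.mem_singleton, not_or] at hg
  obtain ⟨hg, g1, g2⟩ := hg
  obtain ⟨-, a, b, ha, hb, hab⟩ := hs g hg
  exact I.star g _ _ a b w ha hb hab.1 hab.2 (hs _ (s.min'_mem h0)).1 (hs _ (s.max'_mem h0)).1
    (lt_of_le_of_ne (s.min'_le g hg) (Ne.symm g1)) (lt_of_le_of_ne (s.le_max' g hg) g2)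
theorem exists_anc {V : Type*} [Fintype V] {T : ℤ → V → Prop} {Y : V → ℤ} (I : Itm T Y) : ∃ Z, Anc T Y Z := by
  classical
  let M := {g : ℤ // ∃ A B, Mid T Y g A ∧ Mid T Y g B ∧ A ≠ B}
  let t : M → Finset V := fun g => Finset.univ.filter (fun w => Mid T Y g.1 w)
  have hall : ∀ s : Finset M, s.card ≤ (s.biUnion t).card := by
    intro s
    have := Finset.card_mul_le_card_mul (s := s) (t := s.biUnion t) (fun (g : M) w => Mid T Y g.1 w) (m := 2) (n := 2) ?_ ?_
    · omega
    · rintro ⟨g, A, B, hA, hB, hAB⟩ hg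
      have : ({A, B} : Finset V).card = 2 := Finset.card_pair hAB
      rw [← this]
      apply Finset.card_le_card
      intro w hw
      have hw' : Mid T Y g w := by
        rcases Finset.mem_insert.1 hw with rfl | hw
        · exact hA
        · rw [Finset.mem_singleton] at hw; rw [hw]; exact hB
      rw [Finset.mem_bipartiteAbove]
      exact ⟨Finset.mem_biUnion.2 ⟨_, hg, Finset.mem_filter.2 ⟨Finset.mem_univ _, hw'⟩⟩, hw'⟩
    · intro w hw
      have := mid_le_two I w ((Finset.bipartiteBelow (fun (g : M) w => Mid T Y g.1 w) s w).image Subtype.val) (by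
        intro g hg
        obtain ⟨g', hg', rfl⟩ := Finset.mem_image.1 hg
        exact (Finset.mem_filter.1 hg').2)
      rwa [Finset.card_image_of_injective _ Subtype.val_injective] at this
  obtain ⟨f, hfi, hf⟩ := (Finset.all_card_le_biUnion_card_iff_exists_injective t).1 hall
  have hf : ∀ g : M, Mid T Y g.1 (f g) := fun g => (Finset.mem_filter.1 (hf g)).2
  have han : ∀ w, ∃ k : ℤ, (∀ g, f g = w → k = g.1) ∧ ((∃ h, T h w) → T k w) ∧ (T k w ∨ k = 0) := by
    intro w
    by_cases h1 : ∃ g, f g = w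
    · obtain ⟨g, rfl⟩ := h1
      exact ⟨g.1, fun g' h => by rw [hfi h], fun _ => (hf g).1, Or.inl (hf g).1⟩
    · by_cases h2 : ∃ h, T h w
      · obtain ⟨h, hh⟩ := h2
        exact ⟨h, fun g' e => absurd ⟨g', e⟩ h1, fun _ => hh, Or.inl hh⟩
      · exact ⟨0, fun g' e => absurd ⟨g', e⟩ h1, fun h => absurd h h2, Or.inr rfl⟩
  choose an a1 a2 a3 using han
  let sg : V → ℤ := fun w => if ∀ h, T h w → an w ≤ h then 1 else -1
  have hsg : ∀ w, sg w = 1 ∨ sg w = -1 := by intro w; simp only [sg]; split_ifs <;> simp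
  refine ⟨fun w => an w + 2 * sg w, ⟨?_, ?_, ?_, ?_⟩⟩
  · intro w
    by_cases h : T (an w) w
    · right; refine ⟨an w, h, ?_⟩
      rcases hsg w with e | e <;> rw [e] <;> constructor <;> omega
    · left
      have h0 := (a3 w).resolve_left h
      have : sg w = 1 := if_pos (fun k hk => absurd (a2 w ⟨k, hk⟩) h)
      rw [this, h0]; rfl
  · intro g a w hg
    show an w + 2 * sg w ≤ _ ∨ _ ≤ an w + 2 * sg w
    by_cases h : T (an w) w
    · rcases lt_trichotomy (an w) g with l | l | l
      · have := I.gap _ _ _ _ h hg l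
        rcases hsg w with e | e <;> omega
      · rcases hsg w with e | e <;> omega
      · have := I.gap _ _ _ _ hg h l
        rcases hsg w with e | e <;> omega
    · have h0 := (a3 w).resolve_left h
      have := I.lb g a hg
      rcases hsg w with e | e <;> omega
  · intro g h s t w hs ht l1 l2 hw hne
    show (_ ∧ _ ≤ an w + 2 * sg w) ∨ (_ ∧ an w + 2 * sg w ≤ _)
    have ha := a2 w ⟨h, hw⟩
    rcases lt_or_gt_of_ne hne with hl | hl
    · left
      refine ⟨I.gap g h s w hs hw hl, ?_⟩
      have hge : ∀ k, T k w → g ≤ k := fun k hk => by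
        by_contra hc
        exact I.star g k h s t w hs ht l1 l2 hk hw (not_le.1 hc) hl
      rcases (hge _ ha).lt_or_eq with e | e
      · have := I.gap g _ s w hs ha e
        rcases hsg w with e | e <;> omega
      · have : sg w = 1 := if_pos (fun k hk => e ▸ hge k hk)
        omega
    · right
      have := I.gap h g w s hw hs hl
      refine ⟨by omega, ?_⟩
      have hge : ∀ k, T k w → k ≤ g := fun k hk => by
        by_contra hc
        exact I.star g h k s t w hs ht l1 l2 hw hk hl (not_le.1 hc)
      rcases (hge _ ha).lt_or_eq with e | e
      · have := I.gap _ g w s ha hs e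
        rcases hsg w with e | e <;> omega
      · have : sg w = -1 := if_neg (fun hk => by have := hk h hw; omega)
        omega
  · intro g A B hA hB hAB hC
    show (an A + 2 * sg A = _ ∨ an A + 2 * sg A = _) ∨ (an B + 2 * sg B = _ ∨ an B + 2 * sg B = _)
    let m : M := ⟨g, A, B, hA, hB, hAB⟩
    rcases hC _ (hf m) with e | e
    · left
      have := a1 A m e
      rcases hsg A with e | e <;> simp only [m] at this <;> omega
    · right
      have := a1 B m e
      rcases hsg B with e | e <;> simp only [m] at this <;> omega
def vp {V : Type*} (Y Z : V → ℤ) (w : V) : Pt := ((Z w : ℝ), (Y w : ℝ))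
def Near {V : Type*} (T : ℤ → V → Prop) (Y Z : V → ℤ) (w : V) (g : ℤ) (p : Pt) : Prop :=
  T g w ∧ ∃ d e r : ℝ, -1 ≤ d ∧ d ≤ 1 ∧ 0 ≤ r ∧ r ≤ 1 ∧ (e = 1 ∨ e = -1 ∨ (e = 0 ∧ d = 0 ∧ Mid T Y g w)) ∧
    p.1 = Z w + r * (g + d - Z w) ∧ p.2 = Y w + r * e
def Tube {V : Type*} (T : ℤ → V → Prop) (Y : V → ℤ) (g : ℤ) (p : Pt) : Prop :=
  ∃ s t, T g s ∧ T g t ∧ (Y s : ℝ) + 1 ≤ p.2 ∧ p.2 ≤ Y t - 1 ∧ g - 2 < p.1 ∧ p.1 < g + 2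
def Reg {V : Type*} (T : ℤ → V → Prop) (Y Z : V → ℤ) (u v : V) (g : ℤ) : Set Pt :=
  {p | p = vp Y Z u ∨ p = vp Y Z v ∨ Tube T Y g p ∨ Near T Y Z u g p ∨ Near T Y Z v g p}
section
variable {V : Type*} {T : ℤ → V → Prop} {Y Z : V → ℤ}
theorem Near.row {w : V} {g : ℤ} {p : Pt} (h : Near T Y Z w g p) : (Y w : ℝ) - 1 ≤ p.2 ∧ p.2 ≤ Y w + 1 := by
  obtain ⟨-, d, e, r, -, -, h0, h1, he, -, hp⟩ := h
  rcases he with rfl | rfl | ⟨rfl, -⟩ <;> constructor <;> linarith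
theorem row_eq (I : Itm T Y) {w u : V} {y : ℝ} (h1 : (Y w : ℝ) - 1 ≤ y) (h2 : y ≤ Y w + 1)
    (h3 : (Y u : ℝ) - 1 ≤ y) (h4 : y ≤ Y u + 1) : w = u := by
  rcases lt_trichotomy (Y w) (Y u) with h | h | h
  · have : (Y w : ℝ) + 4 ≤ Y u := by exact_mod_cast I.ygap _ _ h
    linarith
  · exact I.yinj h
  · have : (Y u : ℝ) + 4 ≤ Y w := by exact_mod_cast I.ygap _ _ h
    linarith
theorem near_tube (I : Itm T Y) (A : Anc T Y Z) {w : V} {g h : ℤ} {p : Pt} (hn : Near T Y Z w h p) (ht : Tube T Y g p)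
    (hne : g ≠ h) : False := by
  have hrow := hn.row
  obtain ⟨hw, d, e, r, hd1, hd2, h0, h1, he, hx, hy⟩ := hn
  obtain ⟨s, t, hs, ht, y1, y2, x1, x2⟩ := ht
  have hgap : (g : ℝ) + 8 ≤ h ∨ (h : ℝ) + 8 ≤ g := by
    rcases lt_or_gt_of_ne hne with l | l
    · left; exact_mod_cast I.gap _ _ _ _ hs hw l
    · right; exact_mod_cast I.gap _ _ _ _ hw hs l
  have hone : r = 1 → False := by
    rintro rfl
    rcases hgap with l | l <;> linarith
  have hr : ∀ x : ℝ, x = 1 ∨ x = -1 → r * e = x → r = 1 := by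
    intro x hx h
    rcases he with rfl | rfl | ⟨rfl, -⟩ <;> rcases hx with rfl | rfl <;> linarith
  rcases lt_trichotomy (Y w) (Y s) with l | l | l
  · have : (Y w : ℝ) + 4 ≤ Y s := by exact_mod_cast I.ygap _ _ l
    linarith
  · have : (Y w : ℝ) = Y s := by exact_mod_cast l
    refine hone (hr 1 (Or.inl rfl) ?_)
    linarith
  rcases lt_trichotomy (Y w) (Y t) with l' | l' | l'
  · rcases A.side g h s t w hs ht l l' hw hne with ⟨k1, k2⟩ | ⟨k1, k2⟩
    · have k1 : (g : ℝ) + 8 ≤ h := by exact_mod_cast k1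
      have k2 : (g : ℝ) + 2 ≤ Z w := by exact_mod_cast k2
      nlinarith
    · have k1 : (h : ℝ) ≤ g - 8 := by exact_mod_cast k1
      have k2 : (Z w : ℝ) ≤ g - 2 := by exact_mod_cast k2
      nlinarith
  · have : (Y w : ℝ) = Y t := by exact_mod_cast l'
    refine hone (hr (-1) (Or.inr rfl) ?_)
    linarith
  · have : (Y t : ℝ) + 4 ≤ Y w := by exact_mod_cast I.ygap _ _ l'
    linarith
theorem near_near (I : Itm T Y) (A : Anc T Y Z) {w : V} {g h : ℤ} {p : Pt} (hn : Near T Y Z w g p) (hn' : Near T Y Z w h p)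
    (hne : g ≠ h) : p = vp Y Z w := by
  obtain ⟨hw, d, e, r, hd1, hd2, h0, h1, he, hx, hy⟩ := hn
  obtain ⟨hw', d', e', r', hd1', hd2', h0', h1', he', hx', hy'⟩ := hn'
  have hgap : (g : ℝ) + 8 ≤ h ∨ (h : ℝ) + 8 ≤ g := by
    rcases lt_or_gt_of_ne hne with l | l
    · left; exact_mod_cast I.gap _ _ _ _ hw hw' l
    · right; exact_mod_cast I.gap _ _ _ _ hw' hw l
  suffices hr : r = 0 ∨ r' = 0 by
    rcases hr with rfl | rfl
    · exact Prod.ext (by simp only [vp]; linarith) (by simp only [vp]; linarith)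
    · exact Prod.ext (by simp only [vp]; linarith) (by simp only [vp]; linarith)
  have same : r = r' → r = 0 ∨ r' = 0 := by
    rintro rfl
    left
    have : r * ((g + d) - (h + d')) = 0 := by linarith
    rcases mul_eq_zero.1 this with k | k
    · exact k
    · rcases hgap with l | l <;> linarith
  by_cases hm : e = 0 ∧ e' = 0
  · obtain ⟨rfl, rfl⟩ := hm
    have he := he.resolve_left (by norm_num)
    have he := he.resolve_left (by norm_num)
    have he' := he'.resolve_left (by norm_num)
    have he' := he'.resolve_left (by norm_num)
    obtain ⟨-, rfl, -, a, b, ha, hb, l1, l2⟩ := he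
    obtain ⟨-, rfl, -, a', b', ha', hb', l1', l2'⟩ := he'
    have k1 := A.side g h a b w ha hb l1 l2 hw' hne
    have k2 := A.side h g a' b' w ha' hb' l1' l2' hw (Ne.symm hne)
    left
    have k : ((g : ℝ) + 2 ≤ Z w ∧ (Z w : ℝ) ≤ h - 2) ∨ ((h : ℝ) + 2 ≤ Z w ∧ (Z w : ℝ) ≤ g - 2) := by
      rcases k1 with ⟨k1, k3⟩ | ⟨k1, k3⟩ <;> rcases k2 with ⟨k2, k4⟩ | ⟨k2, k4⟩
      · omega
      · left; constructor <;> assumption_mod_cast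
      · right; constructor <;> assumption_mod_cast
      · omega
    rcases k with ⟨k1, k2⟩ | ⟨k1, k2⟩ <;> nlinarith
  · rcases he with rfl | rfl | ⟨rfl, -⟩ <;> rcases he' with rfl | rfl | ⟨rfl, -⟩
    · exact same (by linarith)
    · left; linarith
    · left; linarith
    · left; linarith
    · exact same (by linarith)
    · left; linarith
    · right; linarith
    · right; linarith
    · exact absurd ⟨rfl, rfl⟩ hm
theorem cross_item (I : Itm T Y) (A : Anc T Y Z) {u v u' v' : V} {g h : ℤ} {p : Pt} (h1 : p ∈ Reg T Y Z u v g)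
    (h2 : p ∈ Reg T Y Z u' v' h) (hne : g ≠ h) : p ∈ range (vp Y Z) := by
  have NN : ∀ w w', Near T Y Z w g p → Near T Y Z w' h p → p ∈ range (vp Y Z) := by
    intro w w' n n'
    have := row_eq I n.row.1 n.row.2 n'.row.1 n'.row.2
    subst this
    exact ⟨w, (near_near I A n n' hne).symm⟩
  rcases h1 with rfl | rfl | h1 | h1 | h1
  · exact ⟨_, rfl⟩
  · exact ⟨_, rfl⟩
  all_goals rcases h2 with rfl | rfl | h2 | h2 | h2
  all_goals first | exact ⟨_, rfl⟩ | exact NN _ _ h1 h2 | exact (near_tube I A h2 h1 hne).elim |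
    exact (near_tube I A h1 h2 (Ne.symm hne)).elim | skip
  obtain ⟨s, t, hs, -, -, -, x1, x2⟩ := h1
  obtain ⟨s', t', hs', -, -, -, x3, x4⟩ := h2
  rcases lt_or_gt_of_ne hne with l | l
  · have : (g : ℝ) + 8 ≤ h := by exact_mod_cast I.gap _ _ _ _ hs hs' l
    linarith
  · have : (h : ℝ) + 8 ≤ g := by exact_mod_cast I.gap _ _ _ _ hs' hs l
    linarith
theorem vp_inj (I : Itm T Y) : Function.Injective (vp Y Z) := by
  intro a b h
  have := congrArg Prod.snd h
  simp only [vp, Int.cast_inj] at this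
  exact I.yinj this
theorem reg_avoid (I : Itm T Y) (A : Anc T Y Z) {u v w : V} {g : ℤ} (h : vp Y Z w ∈ Reg T Y Z u v g) : w = u ∨ w = v := by
  have hN : ∀ x, Near T Y Z x g (vp Y Z w) → w = x := fun x n =>
    row_eq I (by simp [vp]) (by simp [vp]) n.row.1 n.row.2
  rcases h with h | h | h | h | h
  · exact Or.inl (vp_inj I h)
  · exact Or.inr (vp_inj I h)
  · obtain ⟨s, t, hs, -, -, -, x1, x2⟩ := h
    simp only [vp] at x1 x2
    exfalso
    rcases A.far g s w hs with k | k
    · have : (Z w : ℝ) ≤ g - 2 := by exact_mod_cast k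
      linarith
    · have : (g : ℝ) + 2 ≤ Z w := by exact_mod_cast k
      linarith
  · exact Or.inl (hN _ h)
  · exact Or.inr (hN _ h)
theorem reg_box {N : ℕ} (hz : ∀ w, 0 ≤ Z w ∧ Z w ≤ N) (hy : ∀ w, 2 ≤ Y w ∧ Y w + 2 ≤ N)
    (hg : ∀ g w, T g w → 2 ≤ g ∧ g + 2 ≤ N) {u v : V} {g : ℤ} : Reg T Y Z u v g ⊆ box N N := by
  have hz1 : ∀ w, (0 : ℝ) ≤ Z w := fun w => by exact_mod_cast (hz w).1
  have hz2 : ∀ w, (Z w : ℝ) ≤ N := fun w => by exact_mod_cast (hz w).2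
  have hy1 : ∀ w, (2 : ℝ) ≤ Y w := fun w => by exact_mod_cast (hy w).1
  have hy2 : ∀ w, (Y w : ℝ) + 2 ≤ N := fun w => by exact_mod_cast (hy w).2
  have hp : ∀ w, vp Y Z w ∈ box N N := fun w => ⟨⟨hz1 w, hz2 w⟩, ⟨by have := hy1 w; simp only [vp]; linarith, by
    have := hy2 w; simp only [vp]; linarith⟩⟩
  have hN : ∀ w p, Near T Y Z w g p → p ∈ box N N := by
    intro w p n
    have hr := n.row
    obtain ⟨hw, d, e, r, hd1, hd2, h0, h1, -, hx, -⟩ := n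
    have a1 : (2 : ℝ) ≤ g := by exact_mod_cast (hg g w hw).1
    have a2 : (g : ℝ) + 2 ≤ N := by exact_mod_cast (hg g w hw).2
    have b1 := hz1 w
    have b2 := hz2 w
    have b3 := hy1 w
    have b4 := hy2 w
    have c1 : 0 ≤ (1 - r) * Z w := mul_nonneg (by linarith) b1
    have c2 : 0 ≤ r * (g + d) := mul_nonneg h0 (by linarith)
    have c3 : 0 ≤ (1 - r) * (N - Z w) := mul_nonneg (by linarith) (by linarith)
    have c4 : 0 ≤ r * (N - (g + d)) := mul_nonneg h0 (by linarith)
    exact ⟨⟨by linarith, by linarith⟩, ⟨by linarith, by linarith⟩⟩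
  rintro p (rfl | rfl | h | h | h)
  · exact hp _
  · exact hp _
  · obtain ⟨s, t, hs, -, y1, y2, x1, x2⟩ := h
    have a1 : (2 : ℝ) ≤ g := by exact_mod_cast (hg g s hs).1
    have a2 : (g : ℝ) + 2 ≤ N := by exact_mod_cast (hg g s hs).2
    have b3 := hy1 s
    have b4 := hy2 t
    exact ⟨⟨by linarith, by linarith⟩, ⟨by linarith, by linarith⟩⟩
  · exact hN _ _ h
  · exact hN _ _ h
end
end E2
end RAC

namespace RAC
section E3
def poly (a b c d : Pt) : Set Pt := segment ℝ a b ∪ segment ℝ b c ∪ segment ℝ c d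
def psegs (a b c d : Pt) : Set (Pt × Pt) := {(a, b), (b, c), (c, d)}
def HS (L : Set (Pt × Pt)) (q : Pt) : Prop := ∃ s ∈ L, q ∈ segment ℝ s.1 s.2 ∧ s.1 ≠ s.2 ∧ s.1.2 = s.2.2
def VS (L : Set (Pt × Pt)) (q : Pt) : Prop := ∃ s ∈ L, q ∈ segment ℝ s.1 s.2 ∧ s.1 ≠ s.2 ∧ s.1.1 = s.2.1
def PairOK (g : ℝ) (a b c d a' b' c' d' : Pt) : Prop :=
  ∃ q : Pt, q.1 = g ∧ q ∈ poly a b c d ∧ q ∈ poly a' b' c' d' ∧ (∀ p ∈ poly a b c d, p ∈ poly a' b' c' d' → p = q) ∧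
    ((HS (psegs a b c d) q ∧ VS (psegs a' b' c' d') q) ∨ (VS (psegs a b c d) q ∧ HS (psegs a' b' c' d') q))
theorem poly_rev (a b c d : Pt) : poly d c b a = poly a b c d := by
  rw [poly, poly, segment_symm ℝ d c, segment_symm ℝ c b, segment_symm ℝ b a]
  ext p; simp only [mem_union]; tauto
theorem HS_rev {a b c d q : Pt} (h : HS (psegs a b c d) q) : HS (psegs d c b a) q := by
  obtain ⟨s, hs, h1, h2, h3⟩ := h
  refine ⟨s.swap, ?_, by rw [segment_symm]; exact h1, Ne.symm h2, h3.symm⟩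
  rcases hs with rfl | rfl | rfl <;> simp [psegs]
theorem VS_rev {a b c d q : Pt} (h : VS (psegs a b c d) q) : VS (psegs d c b a) q := by
  obtain ⟨s, hs, h1, h2, h3⟩ := h
  refine ⟨s.swap, ?_, by rw [segment_symm]; exact h1, Ne.symm h2, h3.symm⟩
  rcases hs with rfl | rfl | rfl <;> simp [psegs]
theorem PairOK.rev {g : ℝ} {a b c d a' b' c' d' : Pt} (h : PairOK g a b c d a' b' c' d') :
    PairOK g d c b a a' b' c' d' := by
  obtain ⟨q, h1, h2, h3, h4, h5⟩ := h
  refine ⟨q, h1, ?_, h3, ?_, ?_⟩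
  · rwa [poly_rev]
  · rwa [poly_rev]
  · exact h5.imp (And.imp HS_rev id) (And.imp VS_rev id)
theorem PairOK.symm {g : ℝ} {a b c d a' b' c' d' : Pt} (h : PairOK g a b c d a' b' c' d') :
    PairOK g a' b' c' d' a b c d := by
  obtain ⟨q, h1, h2, h3, h4, h5⟩ := h
  exact ⟨q, h1, h3, h2, fun p k1 k2 => h4 p k2 k1, h5.symm.imp And.symm And.symm⟩
theorem seg_par {p a b : Pt} (h : p ∈ segment ℝ a b) : ∃ r : ℝ, 0 ≤ r ∧ r ≤ 1 ∧ p.1 = a.1 + r * (b.1 - a.1) ∧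
    p.2 = a.2 + r * (b.2 - a.2) := by
  rw [segment_eq_image'] at h
  obtain ⟨r, ⟨h0, h1⟩, rfl⟩ := h
  exact ⟨r, h0, h1, by simp, by simp⟩
theorem seg_xle {p a b : Pt} (h : p ∈ segment ℝ a b) {c : ℝ} (h1 : a.1 ≤ c) (h2 : b.1 ≤ c) : p.1 ≤ c := by
  obtain ⟨r, h3, h4, h5, -⟩ := seg_par h; nlinarith
theorem seg_xge {p a b : Pt} (h : p ∈ segment ℝ a b) {c : ℝ} (h1 : c ≤ a.1) (h2 : c ≤ b.1) : c ≤ p.1 := by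
  obtain ⟨r, h3, h4, h5, -⟩ := seg_par h; nlinarith
theorem seg_yle {p a b : Pt} (h : p ∈ segment ℝ a b) {c : ℝ} (h1 : a.2 ≤ c) (h2 : b.2 ≤ c) : p.2 ≤ c := by
  obtain ⟨r, h3, h4, -, h5⟩ := seg_par h; nlinarith
theorem seg_yge {p a b : Pt} (h : p ∈ segment ℝ a b) {c : ℝ} (h1 : c ≤ a.2) (h2 : c ≤ b.2) : c ≤ p.2 := by
  obtain ⟨r, h3, h4, -, h5⟩ := seg_par h; nlinarith
theorem seg_xeq {p a b : Pt} (h : p ∈ segment ℝ a b) (h1 : a.1 ≠ b.1) (h2 : p.1 = a.1) : p.2 = a.2 := by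
  obtain ⟨r, h3, h4, h5, h6⟩ := seg_par h
  have : r * (b.1 - a.1) = 0 := by linarith
  rcases mul_eq_zero.1 this with k | k
  · rw [k] at h6; linarith
  · exact absurd (sub_eq_zero.1 k).symm h1
theorem seg_yeq {p a b : Pt} (h : p ∈ segment ℝ a b) (h1 : a.2 ≠ b.2) (h2 : p.2 = a.2) : p.1 = a.1 := by
  obtain ⟨r, h3, h4, h5, h6⟩ := seg_par h
  have : r * (b.2 - a.2) = 0 := by linarith
  rcases mul_eq_zero.1 this with k | k
  · rw [k] at h5; linarith
  · exact absurd (sub_eq_zero.1 k).symm h1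
theorem seg_vert {g y a b : ℝ} (h1 : a ≤ y) (h2 : y ≤ b) : ((g, y) : Pt) ∈ segment ℝ ((g, a) : Pt) (g, b) := by
  rcases h1.eq_or_lt with rfl | h
  · exact left_mem_segment _ _ _
  · rw [segment_eq_image']
    refine ⟨(y - a) / (b - a), ⟨div_nonneg (by linarith) (by linarith), ?_⟩, ?_⟩
    · rw [div_le_one (by linarith)]; linarith
    · apply Prod.ext
      · simp
      · have : b - a ≠ 0 := by linarith
        simp only [Prod.snd_add, Prod.smul_snd, Prod.snd_sub, smul_eq_mul]; field_simp; ring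
theorem ne_snd {a b : Pt} (h : a.2 ≠ b.2) : a ≠ b := fun e => h (by rw [e])
theorem ne_fst {a b : Pt} (h : a.1 ≠ b.1) : a ≠ b := fun e => h (by rw [e])
theorem geo1 {g ys yA yB yt xs xA xB xt σ : ℝ} (h1 : ys + 4 ≤ yA) (h2 : yA + 4 ≤ yB) (h3 : yB + 4 ≤ yt) (hA : xA ≠ g)
    (hB : (σ = 1 ∧ g + 2 ≤ xB) ∨ (σ = -1 ∧ xB ≤ g - 2)) :
    PairOK g (xs, ys) (g, ys + 1) (g, yB - 1) (xB, yB) (xA, yA) (g, yA) (g - σ, yt - 1) (xt, yt) := by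
  have hσ : σ ≠ 0 := by rcases hB with ⟨rfl, -⟩ | ⟨rfl, -⟩ <;> norm_num
  have hq : ((g, yA) : Pt) ∈ segment ℝ ((g, ys + 1) : Pt) (g, yB - 1) := seg_vert (by linarith) (by linarith)
  refine ⟨(g, yA), rfl, Or.inl (Or.inr hq), Or.inl (Or.inl (right_mem_segment _ _ _)), ?_, Or.inr ⟨
    ⟨_, Or.inr (Or.inl rfl), hq, ne_snd ?_, rfl⟩, ⟨_, Or.inl rfl, right_mem_segment _ _ _, ne_fst hA, rfl⟩⟩⟩
  swap
  · simp only; linarith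
  rintro p ((h | h) | h) ((k | k) | k)
  · have a1 := seg_yle h (c := ys + 1) (by simp) (by simp)
    have a2 := seg_yge k (c := yA) (by simp) (by simp)
    linarith
  · have a1 := seg_yle h (c := ys + 1) (by simp) (by simp)
    have a2 := seg_yge k (c := yA) (by simp) (by simp only; linarith)
    linarith
  · have a1 := seg_yle h (c := ys + 1) (by simp) (by simp)
    have a2 := seg_yge k (c := yA) (by simp only; linarith) (by simp only; linarith)
    linarith
  · have a1 := seg_yle k (c := yA) (by simp) (by simp)
    have a2 := seg_yge k (c := yA) (by simp) (by simp)
    have a3 := seg_xle h (c := g) (by simp) (by simp)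
    have a4 := seg_xge h (c := g) (by simp) (by simp)
    exact Prod.ext (le_antisymm a3 a4) (le_antisymm a1 a2)
  · have a3 := seg_xle h (c := g) (by simp) (by simp)
    have a4 := seg_xge h (c := g) (by simp) (by simp)
    exact Prod.ext (le_antisymm a3 a4) (seg_xeq k (fun e => hσ (by simp only at e; linarith)) (le_antisymm a3 a4))
  · have a1 := seg_yle h (c := yB - 1) (by simp only; linarith) (by simp)
    have a2 := seg_yge k (c := yt - 1) (by simp) (by simp)
    linarith
  · have a1 := seg_yge h (c := yB - 1) (by simp) (by simp)
    have a2 := seg_yle k (c := yA) (by simp) (by simp)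
    linarith
  · exfalso
    have a1 := seg_yge h (c := yB - 1) (by simp) (by simp)
    have a2 : p.1 = g := by
      rcases hB with ⟨rfl, hB⟩ | ⟨rfl, hB⟩
      · have b1 := seg_xge h (c := g) (by simp) (by simp only; linarith)
        have b2 := seg_xle k (c := g) (by simp) (by simp)
        linarith
      · have b1 := seg_xle h (c := g) (by simp) (by simp only; linarith)
        have b2 := seg_xge k (c := g) (by simp) (by simp)
        linarith
    have a3 : p.2 = yA := seg_xeq k (fun e => hσ (by simp only at e; linarith)) a2
    linarith
  · have a1 := seg_yle h (c := yB) (by simp) (by simp)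
    have a2 := seg_yge k (c := yt - 1) (by simp) (by simp)
    linarith
theorem geo2 {g ys yA yB yt xs xA xB xt σ : ℝ} (h1 : ys + 4 ≤ yA) (h2 : yA + 4 ≤ yB) (h3 : yB + 4 ≤ yt) (hA : xA ≠ g)
    (hB : (σ = 1 ∧ g + 2 ≤ xB) ∨ (σ = -1 ∧ xB ≤ g - 2)) :
    PairOK g (xs, ys) (g, ys + 1) (g, yt - 1) (xt, yt) (xA, yA) (g, yA) (g + σ, yB - 1) (xB, yB) := by
  have hσ : σ ≠ 0 := by rcases hB with ⟨rfl, -⟩ | ⟨rfl, -⟩ <;> norm_num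
  have hq : ((g, yA) : Pt) ∈ segment ℝ ((g, ys + 1) : Pt) (g, yt - 1) := seg_vert (by linarith) (by linarith)
  refine ⟨(g, yA), rfl, Or.inl (Or.inr hq), Or.inl (Or.inl (right_mem_segment _ _ _)), ?_, Or.inr ⟨
    ⟨_, Or.inr (Or.inl rfl), hq, ne_snd ?_, rfl⟩, ⟨_, Or.inl rfl, right_mem_segment _ _ _, ne_fst hA, rfl⟩⟩⟩
  swap
  · simp only; linarith
  intro p h k
  have b1 : yA ≤ p.2 ∧ p.2 ≤ yB := by
    rcases k with (k | k) | k
    · exact ⟨seg_yge k (by simp) (by simp), seg_yle k (by simp only; linarith) (by simp only; linarith)⟩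
    · exact ⟨seg_yge k (by simp) (by simp only; linarith), seg_yle k (by simp only; linarith) (by simp only; linarith)⟩
    · exact ⟨seg_yge k (by simp only; linarith) (by simp only; linarith), seg_yle k (by simp) (by simp)⟩
  have b2 : p.1 = g := by
    rcases h with (h | h) | h
    · have a1 := seg_yle h (c := ys + 1) (by simp) (by simp)
      linarith
    · exact le_antisymm (seg_xle h (by simp) (by simp)) (seg_xge h (by simp) (by simp))
    · have a1 := seg_yge h (c := yt - 1) (by simp) (by simp)
      linarith
  refine Prod.ext b2 ?_
  rcases k with (k | k) | k
  · exact le_antisymm (seg_yle k (by simp) (by simp)) (seg_yge k (by simp) (by simp))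
  · exact seg_xeq k (by simpa using hσ) b2
  · exfalso
    rcases hB with ⟨rfl, hB⟩ | ⟨rfl, hB⟩
    · have b1 := seg_xge k (c := g + 1) (by simp) (by simp only; linarith)
      linarith
    · have b1 := seg_xle k (c := g + -1) (by simp) (by simp only; linarith)
      linarith
theorem geo3a {g ys yA yB yt xs xA xB xt : ℝ} (h1 : ys + 4 ≤ yA) (h2 : yA + 4 ≤ yB) (h3 : yB + 4 ≤ yt) (hB : xB ≠ g) :
    PairOK g (xs, ys) (g, ys + 1) (g, yB) (xA, yA) (xB, yB) (g, yB) (g, yt - 1) (xt, yt) := by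
  refine ⟨(g, yB), rfl, Or.inl (Or.inr (right_mem_segment _ _ _)), Or.inl (Or.inl (right_mem_segment _ _ _)), ?_, Or.inr ⟨
    ⟨_, Or.inr (Or.inl rfl), right_mem_segment _ _ _, ne_snd ?_, rfl⟩, ⟨_, Or.inl rfl, right_mem_segment _ _ _, ne_fst hB, rfl⟩⟩⟩
  swap
  · simp only; linarith
  intro p h k
  have b1 : yB ≤ p.2 := by
    rcases k with (k | k) | k
    · exact seg_yge k (by simp) (by simp)
    · exact seg_yge k (by simp) (by simp only; linarith)
    · exact seg_yge k (by simp only; linarith) (by simp only; linarith)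
  have b2 : p.2 ≤ yB := by
    rcases h with (h | h) | h
    · exact seg_yle h (by simp only; linarith) (by simp only; linarith)
    · exact seg_yle h (by simp only; linarith) (by simp)
    · exact seg_yle h (by simp) (by simp only; linarith)
  have b3 : p.2 = yB := le_antisymm b2 b1
  refine Prod.ext ?_ b3
  rcases h with (h | h) | h
  · have a1 := seg_yle h (c := ys + 1) (by simp) (by simp)
    linarith
  · exact le_antisymm (seg_xle h (by simp) (by simp)) (seg_xge h (by simp) (by simp))
  · exact seg_yeq h (by simp only; linarith) b3
theorem geo3b {g ys yA yB yt xs xA xB xt : ℝ} (h1 : ys + 4 ≤ yA) (h2 : yA + 4 ≤ yB) (h3 : yB + 4 ≤ yt) (hA : xA ≠ g) :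
    PairOK g (xs, ys) (g, ys + 1) (g, yA) (xA, yA) (xB, yB) (g, yA) (g, yt - 1) (xt, yt) := by
  refine ⟨(g, yA), rfl, Or.inl (Or.inr (right_mem_segment _ _ _)), Or.inl (Or.inl (right_mem_segment _ _ _)), ?_, Or.inl ⟨
    ⟨_, Or.inr (Or.inr rfl), left_mem_segment _ _ _, ne_fst (Ne.symm hA), rfl⟩,
    ⟨_, Or.inr (Or.inl rfl), left_mem_segment _ _ _, ne_snd ?_, rfl⟩⟩⟩
  swap
  · simp only; linarith
  intro p h k
  have b1 : yA ≤ p.2 := by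
    rcases k with (k | k) | k
    · exact seg_yge k (by simp only; linarith) (by simp)
    · exact seg_yge k (by simp) (by simp only; linarith)
    · exact seg_yge k (by simp only; linarith) (by simp only; linarith)
  have b2 : p.2 ≤ yA := by
    rcases h with (h | h) | h
    · exact seg_yle h (by simp only; linarith) (by simp only; linarith)
    · exact seg_yle h (by simp only; linarith) (by simp)
    · exact seg_yle h (by simp) (by simp)
  have b3 : p.2 = yA := le_antisymm b2 b1
  refine Prod.ext ?_ b3
  rcases k with (k | k) | k
  · rw [segment_symm] at k
    exact seg_yeq k (by simp only; linarith) b3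
  · exact le_antisymm (seg_xle k (by simp) (by simp)) (seg_xge k (by simp) (by simp))
  · have a1 := seg_yge k (c := yt - 1) (by simp) (by simp)
    linarith
section
variable {V : Type*} {T : ℤ → V → Prop} {Y Z : V → ℤ}
def EndOK (T : ℤ → V → Prop) (Y Z : V → ℤ) (g : ℤ) (w : V) (b : Pt) : Prop :=
  ∀ p ∈ segment ℝ (vp Y Z w) b, p = vp Y Z w ∨ Tube T Y g p ∨ Near T Y Z w g p
theorem reg_of {g : ℤ} {u v : V} {b c : Pt} (h1 : EndOK T Y Z g u b) (h2 : ∀ p ∈ segment ℝ b c, Tube T Y g p)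
    (h3 : EndOK T Y Z g v c) : poly (vp Y Z u) b c (vp Y Z v) ⊆ Reg T Y Z u v g := by
  rintro p ((h | h) | h)
  · rcases h1 p h with h | h | h
    · exact Or.inl h
    · exact Or.inr (Or.inr (Or.inl h))
    · exact Or.inr (Or.inr (Or.inr (Or.inl h)))
  · exact Or.inr (Or.inr (Or.inl (h2 p h)))
  · rw [segment_symm] at h
    rcases h3 p h with h | h | h
    · exact Or.inr (Or.inl h)
    · exact Or.inr (Or.inr (Or.inl h))
    · exact Or.inr (Or.inr (Or.inr (Or.inr h)))
theorem end_near {g : ℤ} {w : V} {b : Pt} (d e : ℝ) (hw : T g w) (hd1 : -1 ≤ d) (hd2 : d ≤ 1)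
    (he : e = 1 ∨ e = -1 ∨ (e = 0 ∧ d = 0 ∧ Mid T Y g w)) (hb1 : b.1 = g + d) (hb2 : b.2 = Y w + e) : EndOK T Y Z g w b := by
  intro p hp
  obtain ⟨r, h0, h1, hx, hy⟩ := seg_par hp
  refine Or.inr (Or.inr ⟨hw, d, e, r, hd1, hd2, h0, h1, he, ?_, ?_⟩)
  · rw [hx, hb1]; rfl
  · rw [hy, hb2]; simp only [vp]; ring
theorem end_up {g : ℤ} {w : V} (hw : T g w) : EndOK T Y Z g w ((g : ℝ), (Y w : ℝ) + 1) :=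
  end_near 0 1 hw (by norm_num) (by norm_num) (Or.inl rfl) (by simp) rfl
theorem end_down {g : ℤ} {w : V} (hw : T g w) : EndOK T Y Z g w ((g : ℝ), (Y w : ℝ) - 1) :=
  end_near 0 (-1) hw (by norm_num) (by norm_num) (Or.inr (Or.inl rfl)) (by simp) (by simp only; ring)
theorem end_mid {g : ℤ} {w : V} (hw : Mid T Y g w) : EndOK T Y Z g w ((g : ℝ), (Y w : ℝ)) :=
  end_near 0 0 hw.1 (by norm_num) (by norm_num) (Or.inr (Or.inr ⟨rfl, rfl, hw⟩)) (by simp) (by simp)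
theorem tube_seg {g : ℤ} {s t : V} (hs : T g s) (ht : T g t) {a b : Pt} (a1 : (Y s : ℝ) + 1 ≤ a.2) (a2 : a.2 ≤ Y t - 1)
    (b1 : (Y s : ℝ) + 1 ≤ b.2) (b2 : b.2 ≤ Y t - 1) (a3 : (g : ℝ) - 1 ≤ a.1) (a4 : a.1 ≤ g + 1) (b3 : (g : ℝ) - 1 ≤ b.1)
    (b4 : b.1 ≤ g + 1) : ∀ p ∈ segment ℝ a b, Tube T Y g p := by
  intro p hp
  refine ⟨s, t, hs, ht, seg_yge hp a1 b1, seg_yle hp a2 b2, ?_, ?_⟩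
  · have := seg_xge hp a3 b3; linarith
  · have := seg_xle hp a4 b4; linarith
theorem end_slant {g : ℤ} {s t w : V} (hs : T g s) (ht : T g t) (hz : Z w = g + 2 ∨ Z w = g - 2) {b : Pt} (hb : b.1 = g)
    (a1 : (Y s : ℝ) + 1 ≤ Y w) (a2 : (Y w : ℝ) ≤ Y t - 1)
    (b1 : (Y s : ℝ) + 1 ≤ b.2) (b2 : b.2 ≤ Y t - 1) : EndOK T Y Z g w b := by
  intro p hp
  have y1 := seg_yge hp a1 b1
  have y2 := seg_yle hp a2 b2
  obtain ⟨r, h0, h1, hx, hy⟩ := seg_par hp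
  rcases h0.eq_or_lt with rfl | h0
  · left; exact Prod.ext (by linarith) (by linarith)
  right; left
  refine ⟨s, t, hs, ht, y1, y2, ?_, ?_⟩ <;> rw [hx, hb] <;> simp only [vp] <;> rcases hz with hz | hz <;> rw [hz] <;> push_cast <;>
    linarith
end
end E3
end RAC

namespace RAC
section E4
variable {V : Type*} {T : ℤ → V → Prop} {Y Z : V → ℤ}
def ItemOK (T : ℤ → V → Prop) (Y Z : V → ℤ) (g : ℤ) (E : V → V → Prop) : Prop :=
  ∃ β : V → Pt, (∀ w, IsGridPoint (β w)) ∧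
    (∀ u v, E u v → poly (vp Y Z u) (β u) (β v) (vp Y Z v) ⊆ Reg T Y Z u v g) ∧
    ∀ u v x y, E u v → E x y → s(u, v) ≠ s(x, y) →
      PairOK g (vp Y Z u) (β u) (β v) (vp Y Z v) (vp Y Z x) (β x) (β y) (vp Y Z y)
theorem reg_symm {u v : V} {g : ℤ} : Reg T Y Z v u g = Reg T Y Z u v g := by
  ext p; simp only [Reg, mem_setOf_eq]; tauto
theorem mk2 {g : ℤ} {E : V → V → Prop} {a b : V} (hab : a ≠ b) (hall : ∀ u v, E u v → s(u, v) = s(a, b))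
    {pa pb : Pt} (ga : IsGridPoint pa) (gb : IsGridPoint pb) (h1 : poly (vp Y Z a) pa pb (vp Y Z b) ⊆ Reg T Y Z a b g) :
    ItemOK T Y Z g E := by
  classical
  refine ⟨fun w => if w = a then pa else pb, fun w => ?_, ?_, ?_⟩
  · simp only; split_ifs <;> assumption
  · intro u v h
    rcases Sym2.eq_iff.1 (hall u v h) with ⟨rfl, rfl⟩ | ⟨rfl, rfl⟩
    · simpa [Ne.symm hab] using h1
    · rw [poly_rev, reg_symm]; simpa [Ne.symm hab] using h1
  · intro u v x y h k hne
    exact absurd ((hall u v h).trans (hall x y k).symm) hne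
theorem mk4 {g : ℤ} {E : V → V → Prop} {a b c d : V} (hab : a ≠ b) (hac : a ≠ c) (had : a ≠ d) (hbc : b ≠ c) (hbd : b ≠ d)
    (hcd : c ≠ d) (hall : ∀ u v, E u v → s(u, v) = s(a, b) ∨ s(u, v) = s(c, d)) {pa pb pc pd : Pt}
    (ga : IsGridPoint pa) (gb : IsGridPoint pb) (gc : IsGridPoint pc) (gd : IsGridPoint pd)
    (h1 : poly (vp Y Z a) pa pb (vp Y Z b) ⊆ Reg T Y Z a b g) (h2 : poly (vp Y Z c) pc pd (vp Y Z d) ⊆ Reg T Y Z c d g)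
    (h3 : PairOK g (vp Y Z a) pa pb (vp Y Z b) (vp Y Z c) pc pd (vp Y Z d)) : ItemOK T Y Z g E := by
  classical
  obtain ⟨β, b1, b2, b3, b4, hβ⟩ : ∃ β : V → Pt, β a = pa ∧ β b = pb ∧ β c = pc ∧ β d = pd ∧ ∀ w, IsGridPoint (β w) := by
    refine ⟨fun w => if w = a then pa else if w = b then pb else if w = c then pc else pd, ?_, ?_, ?_, ?_, fun w => ?_⟩
    · simp
    · simp [Ne.symm hab]
    · simp [Ne.symm hac, Ne.symm hbc]
    · simp [Ne.symm had, Ne.symm hbd, Ne.symm hcd]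
    · simp only; split_ifs <;> assumption
  rw [← b1, ← b2] at h1
  rw [← b3, ← b4] at h2
  rw [← b1, ← b2, ← b3, ← b4] at h3
  refine ⟨β, hβ, ?_, ?_⟩
  · intro u v h
    rcases hall u v h with e | e <;> rcases Sym2.eq_iff.1 e with ⟨rfl, rfl⟩ | ⟨rfl, rfl⟩
    · exact h1
    · rw [poly_rev, reg_symm]; exact h1
    · exact h2
    · rw [poly_rev, reg_symm]; exact h2
  · have key : ∀ u v x y, s(u, v) = s(a, b) → s(x, y) = s(c, d) →
      PairOK g (vp Y Z u) (β u) (β v) (vp Y Z v) (vp Y Z x) (β x) (β y) (vp Y Z y) := by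
      intro u v x y e f
      rcases Sym2.eq_iff.1 e with ⟨rfl, rfl⟩ | ⟨rfl, rfl⟩ <;> rcases Sym2.eq_iff.1 f with ⟨rfl, rfl⟩ | ⟨rfl, rfl⟩
      · exact h3
      · exact h3.symm.rev.symm
      · exact h3.rev
      · exact h3.rev.symm.rev.symm
    intro u v x y h k hne
    rcases hall u v h with e | e <;> rcases hall x y k with f | f
    · exact absurd (e.trans f.symm) hne
    · exact key _ _ _ _ e f
    · exact (key _ _ _ _ f e).symm
    · exact absurd (e.trans f.symm) hne
theorem grd {p : Pt} (a b : ℤ) (h1 : p.1 = a) (h2 : p.2 = b) : IsGridPoint p := ⟨⟨a, h1⟩, ⟨b, h2⟩⟩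
theorem item_ok (I : Itm T Y) (A : Anc T Y Z) (g : ℤ) (E : V → V → Prop) (hs : ∀ u v, E u v → E v u)
    (hne : ∀ u v, E u v → u ≠ v) (hT : ∀ w, T g w ↔ ∃ v, E w v)
    (hd : ∀ u v x y, E u v → E x y → s(u, v) ≠ s(x, y) → u ≠ x ∧ u ≠ y ∧ v ≠ x ∧ v ≠ y)
    (h2 : ∀ u v x y z w, E u v → E x y → E z w → s(u, v) ≠ s(x, y) → s(z, w) = s(u, v) ∨ s(z, w) = s(x, y)) :
    ItemOK T Y Z g E := by
  classical
  have zero : IsGridPoint (0 : Pt) := grd 0 0 (by simp) (by simp)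
  by_cases h0 : ∃ u v, E u v
  swap
  · exact ⟨fun _ => 0, fun _ => zero, fun u v h => absurd ⟨u, v, h⟩ h0, fun u v _ _ h => absurd ⟨u, v, h⟩ h0⟩
  have ori : ∀ u v, E u v → ∃ a b, E a b ∧ s(u, v) = s(a, b) ∧ Y a < Y b := by
    intro u v h
    rcases lt_trichotomy (Y u) (Y v) with l | l | l
    · exact ⟨u, v, h, rfl, l⟩
    · exact absurd (I.yinj l) (hne u v h)
    · exact ⟨v, u, hs u v h, Sym2.eq_swap, l⟩
  have T1 : ∀ a b, E a b → T g a := fun a b h => (hT a).2 ⟨b, h⟩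
  have gap : ∀ a b, Y a < Y b → (Y a : ℝ) + 4 ≤ Y b := fun a b h => by exact_mod_cast I.ygap a b h
  have far : ∀ w, T g w → (Z w : ℝ) ≠ g := by
    intro w hw h
    have h : Z w = g := by exact_mod_cast h
    have := A.far g w w hw
    omega
  obtain ⟨u, v, huv⟩ := h0
  obtain ⟨a, b, hab, -, lab⟩ := ori u v huv
  have gup : ∀ w, IsGridPoint ((g : ℝ), (Y w : ℝ) + 1) := fun w => grd g (Y w + 1) rfl (by simp)
  have gdn : ∀ w, IsGridPoint ((g : ℝ), (Y w : ℝ) - 1) := fun w => grd g (Y w - 1) rfl (by simp)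
  have gmd : ∀ w, IsGridPoint ((g : ℝ), (Y w : ℝ)) := fun w => grd g (Y w) rfl rfl
  by_cases h1 : ∃ x y, E x y ∧ s(x, y) ≠ s(a, b)
  swap
  · push Not at h1
    have := gap a b lab
    exact mk2 (hne a b hab) h1 (gup a) (gdn b) (reg_of (end_up (T1 a b hab))
      (tube_seg (T1 a b hab) (T1 b a (hs _ _ hab)) (by simp) (by simp only; linarith) (by simp only; linarith) (by simp)
        (by simp) (by simp) (by simp) (by simp)) (end_down (T1 b a (hs _ _ hab))))
  obtain ⟨c, d, hab, hcd, lab, lcd, hne2, lac⟩ : ∃ c d, E a b ∧ E c d ∧ Y a < Y b ∧ Y c < Y d ∧ s(a, b) ≠ s(c, d) ∧ True := by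
    obtain ⟨x, y, h3, h4⟩ := h1
    obtain ⟨c, d, h5, h6, h7⟩ := ori x y h3
    exact ⟨c, d, hab, h5, lab, h7, by rw [← h6]; exact Ne.symm h4, trivial⟩
  clear h1 huv
  obtain ⟨a, b, c, d, hab, hcd, lab, lcd, hne2, lac⟩ : ∃ a b c d, E a b ∧ E c d ∧ Y a < Y b ∧ Y c < Y d ∧ s(a, b) ≠ s(c, d) ∧
      Y a < Y c := by
    rcases lt_trichotomy (Y a) (Y c) with l | l | l
    · exact ⟨a, b, c, d, hab, hcd, lab, lcd, hne2, l⟩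
    · exact absurd (I.yinj l) (hd _ _ _ _ hab hcd hne2).1
    · exact ⟨c, d, a, b, hcd, hab, lcd, lab, Ne.symm hne2, l⟩
  obtain ⟨n1, n2, n3, n4⟩ := hd _ _ _ _ hab hcd hne2
  have ta := T1 _ _ hab
  have tb := T1 _ _ (hs _ _ hab)
  have tc := T1 _ _ hcd
  have td := T1 _ _ (hs _ _ hcd)
  have hall : ∀ u v, E u v → s(u, v) = s(a, b) ∨ s(u, v) = s(c, d) := fun u v h => h2 _ _ _ _ _ _ hab hcd h hne2
  have sgn : ∀ w, T g w → ∃ σ : ℤ, ((σ : ℝ) = 1 ∧ (g : ℝ) + 2 ≤ Z w) ∨ ((σ : ℝ) = -1 ∧ (Z w : ℝ) ≤ g - 2) := by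
    intro w hw
    rcases A.far g w w hw with h | h
    · exact ⟨-1, Or.inr ⟨by simp, by exact_mod_cast h⟩⟩
    · exact ⟨1, Or.inl ⟨by simp, by exact_mod_cast h⟩⟩
  have g1 := gap _ _ lab
  have g2 := gap _ _ lcd
  have g3 := gap _ _ lac
  rcases lt_trichotomy (Y b) (Y c) with l | l | l
  · have g4 := gap _ _ l
    have mb : Mid T Y g b := ⟨tb, a, d, ta, td, lab, l.trans lcd⟩
    have mc : Mid T Y g c := ⟨tc, a, d, ta, td, lac, lcd⟩
    have hC : ∀ C, Mid T Y g C → C = b ∨ C = c := by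
      rintro C ⟨hC, p, q, hp, hq, l1, l2⟩
      have tt : ∀ w, T g w → w = a ∨ w = b ∨ w = c ∨ w = d := by
        intro w hw
        obtain ⟨v, hv⟩ := (hT w).1 hw
        rcases hall w v hv with e | e <;> rcases Sym2.eq_iff.1 e with ⟨rfl, -⟩ | ⟨rfl, -⟩ <;> simp
      have low : ∀ w, T g w → Y a ≤ Y w ∧ Y w ≤ Y d := by
        intro w hw
        rcases tt w hw with rfl | rfl | rfl | rfl <;> constructor <;> omega
      have := low p hp
      have := low q hq
      rcases tt C hC with rfl | rfl | rfl | rfl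
      · omega
      · exact Or.inl rfl
      · exact Or.inr rfl
      · omega
    rcases A.anch g b c mb mc n3 hC with hz | hz
    · refine mk4 (hne _ _ hab) n1 n2 n3 n4 (hne _ _ hcd) hall (gup a) (gmd c) (gmd c) (gdn d)
        (reg_of (end_up ta) ?_ (end_slant ta td hz rfl ?_ ?_ ?_ ?_)) (reg_of (end_mid mc) ?_ (end_down td))
        (geo3a (by linarith) (by linarith) (by linarith) (far c tc))
      · refine tube_seg ta td ?_ ?_ ?_ ?_ ?_ ?_ ?_ ?_ <;> simp only <;> linarith
      · linarith
      · linarith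
      · simp only; linarith
      · simp only; linarith
      · refine tube_seg ta td ?_ ?_ ?_ ?_ ?_ ?_ ?_ ?_ <;> simp only <;> linarith
    · refine mk4 (hne _ _ hab) n1 n2 n3 n4 (hne _ _ hcd) hall (gup a) (gmd b) (gmd b) (gdn d)
        (reg_of (end_up ta) ?_ (end_mid mb)) (reg_of (end_slant ta td hz rfl ?_ ?_ ?_ ?_) ?_ (end_down td))
        (geo3b (by linarith) (by linarith) (by linarith) (far b tb))
      · refine tube_seg ta td ?_ ?_ ?_ ?_ ?_ ?_ ?_ ?_ <;> simp only <;> linarith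
      · linarith
      · linarith
      · simp only; linarith
      · simp only; linarith
      · refine tube_seg ta td ?_ ?_ ?_ ?_ ?_ ?_ ?_ ?_ <;> simp only <;> linarith
  · exact absurd (I.yinj l) n3
  have g4 := gap _ _ l
  have mc : Mid T Y g c := ⟨tc, a, b, ta, tb, lac, l⟩
  rcases lt_trichotomy (Y b) (Y d) with l' | l' | l'
  · have g5 := gap _ _ l'
    obtain ⟨σ, hσ⟩ := sgn b tb
    have hσ' : -1 ≤ (σ : ℝ) ∧ (σ : ℝ) ≤ 1 := by rcases hσ with ⟨e, -⟩ | ⟨e, -⟩ <;> rw [e] <;> norm_num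
    refine mk4 (hne _ _ hab) n1 n2 n3 n4 (hne _ _ hcd) hall (gup a) (gdn b) (gmd c)
      (pd := ((g : ℝ) - σ, (Y d : ℝ) - 1)) (grd (g - σ) (Y d - 1) (by simp) (by simp))
      (reg_of (end_up ta) ?_ (end_down tb)) (reg_of (end_mid mc) ?_ (end_near (-σ) (-1) td ?_ ?_ (Or.inr (Or.inl rfl)) ?_ ?_))
      (geo1 (by linarith) (by linarith) (by linarith) (far c tc) hσ)
    · refine tube_seg ta td ?_ ?_ ?_ ?_ ?_ ?_ ?_ ?_ <;> simp only <;> linarith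
    · refine tube_seg ta td ?_ ?_ ?_ ?_ ?_ ?_ ?_ ?_ <;> simp only <;> linarith
    · linarith
    · linarith
    · simp only; ring
    · simp only; ring
  · exact absurd (I.yinj l') n4
  · have g5 := gap _ _ l'
    have md : Mid T Y g d := ⟨td, a, b, ta, tb, lac.trans lcd, l'⟩
    obtain ⟨σ, hσ⟩ := sgn d td
    have hσ' : -1 ≤ (σ : ℝ) ∧ (σ : ℝ) ≤ 1 := by rcases hσ with ⟨e, -⟩ | ⟨e, -⟩ <;> rw [e] <;> norm_num
    refine mk4 (hne _ _ hab) n1 n2 n3 n4 (hne _ _ hcd) hall (gup a) (gdn b) (gmd c)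
      (pd := ((g : ℝ) + σ, (Y d : ℝ) - 1)) (grd (g + σ) (Y d - 1) (by simp) (by simp))
      (reg_of (end_up ta) ?_ (end_down tb)) (reg_of (end_mid mc) ?_ (end_near σ (-1) td ?_ ?_ (Or.inr (Or.inl rfl)) ?_ ?_))
      (geo2 (by linarith) (by linarith) (by linarith) (far c tc) hσ)
    · refine tube_seg ta tb ?_ ?_ ?_ ?_ ?_ ?_ ?_ ?_ <;> simp only <;> linarith
    · refine tube_seg ta tb ?_ ?_ ?_ ?_ ?_ ?_ ?_ ?_ <;> simp only <;> linarith
    · linarith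
    · linarith
    · rfl
    · simp only; ring
end E4
end RAC

namespace RAC
section E5
theorem final_aux {V : Type*} [Fintype V] {G : SimpleGraph V} (D : ICDrawing G) :
    ∃ (Y Z : V → ℤ) (X : Sym2 V → ℤ) (β : ℤ → V → Pt) (T : ℤ → V → Prop), Itm T Y ∧ Anc T Y Z ∧
      (∀ w, 0 ≤ Z w ∧ Z w ≤ (40 * Fintype.card V : ℕ)) ∧ (∀ w, 2 ≤ Y w ∧ Y w + 2 ≤ (40 * Fintype.card V : ℕ)) ∧
      (∀ g w, T g w → 2 ≤ g ∧ g + 2 ≤ (40 * Fintype.card V : ℕ)) ∧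
      (∀ e w, e ∈ G.edgeSet → w ∈ e → T (X e) w) ∧
      (∀ g w, IsGridPoint (β g w)) ∧
      (∀ u v, G.Adj u v → poly (vp Y Z u) (β (X s(u, v)) u) (β (X s(u, v)) v) (vp Y Z v) ⊆ Reg T Y Z u v (X s(u, v))) ∧
      (∀ u v x y, G.Adj u v → G.Adj x y → s(u, v) ≠ s(x, y) → X s(u, v) = X s(x, y) →
        PairOK (X s(u, v)) (vp Y Z u) (β (X s(u, v)) u) (β (X s(u, v)) v) (vp Y Z v)
          (vp Y Z x) (β (X s(x, y)) x) (β (X s(x, y)) y) (vp Y Z y)) ∧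
      (∀ u v x y, ∀ h1 : G.Adj u v, ∀ h2 : G.Adj x y, s(u, v) ≠ s(x, y) →
        (X s(u, v) = X s(x, y) ↔ D.toDrawing.Crosses h1 h2)) := by
  obtain ⟨y, x, L⟩ := exists_lay D
  obtain ⟨Y, X, L⟩ := exists_layZ L
  let T : ℤ → V → Prop := fun g w => ∃ e ∈ G.edgeSet, X e = g ∧ w ∈ e
  have I : Itm T Y := by
    refine ⟨L.yinj, L.ygap, ?_, ?_, ?_⟩
    · rintro g h a b ⟨e, he, rfl, -⟩ ⟨f, hf, rfl, -⟩ l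
      exact L.xgap e he f hf l
    · rintro g a ⟨e, he, rfl, -⟩
      exact (L.xbd e he).1
    · rintro g f h a b w ⟨e, he, rfl, ha⟩ ⟨e', he', hee, hb⟩ l1 l2 ⟨k, hk, rfl, hw⟩ ⟨k', hk', rfl, hw'⟩ l3 l4
      exact L.star e he e' he' k hk k' hk' a b w hee.symm ha hb hw hw' l1 l2 l3 l4
  obtain ⟨Z, A⟩ := exists_anc I
  have hcr : ∀ u v x y, ∀ h1 : G.Adj u v, ∀ h2 : G.Adj x y, s(u, v) ≠ s(x, y) →
        (X s(u, v) = X s(x, y) ↔ D.toDrawing.Crosses h1 h2) := by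
    intro u v x y h1 h2 hne
    rw [L.cr_iff _ h1 _ h2 hne, crossE_iff, Drawing.Crosses]
    simp only [mem_carr h1, mem_carr h2]
  have hit : ∀ g, ItemOK T Y Z g (fun u v => G.Adj u v ∧ X s(u, v) = g) := by
    intro g
    apply item_ok I A
    · rintro u v ⟨h, e⟩
      exact ⟨h.symm, by rwa [Sym2.eq_swap]⟩
    · rintro u v ⟨h, e⟩
      exact h.ne
    · intro w
      constructor
      · rintro ⟨e, he, hx, hw⟩
        induction e with
        | _ a b =>
          rcases Sym2.mem_iff.1 hw with rfl | rfl
          · exact ⟨b, he, hx⟩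
          · exact ⟨a, SimpleGraph.Adj.symm he, by rwa [Sym2.eq_swap]⟩
      · rintro ⟨v, h, e⟩
        exact ⟨s(w, v), h, e, Sym2.mem_mk_left _ _⟩
    · rintro u v x y ⟨h1, e1⟩ ⟨h2, e2⟩ hne
      exact D.indep h1 h2 hne ((hcr u v x y h1 h2 hne).1 (e1.trans e2.symm))
    · rintro u v x y z w ⟨h1, e1⟩ ⟨h2, e2⟩ ⟨h3, e3⟩ hne
      by_cases hzu : s(z, w) = s(u, v)
      · exact Or.inl hzu
      right
      refine D.once h1 ⟨hzu, ?_⟩ ⟨Ne.symm hne, ?_⟩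
      · exact (L.cr_iff _ h1 _ h3 (Ne.symm hzu)).1 (e1.trans e3.symm)
      · exact (L.cr_iff _ h1 _ h2 hne).1 (e1.trans e2.symm)
  choose β hβ1 hβ2 hβ3 using hit
  refine ⟨Y, Z, X, β, T, I, A, ?_, ?_, ?_, ?_, hβ1, ?_, ?_, hcr⟩
  · intro w
    have := L.ybd w
    push_cast
    rcases A.bd w with h | ⟨g, ⟨e, he, rfl, -⟩, h1, h2⟩
    · omega
    · have := L.xbd e he
      omega
  · exact fun w => by have := L.ybd w; push_cast; exact this
  · rintro g w ⟨e, he, rfl, -⟩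
    have := L.xbd e he
    push_cast
    omega
  · exact fun e w he hw => ⟨e, he, rfl, hw⟩
  · exact fun u v h => hβ2 _ u v ⟨h, rfl⟩
  · intro u v x y h1 h2 hne e
    have := hβ3 (X s(u, v)) u v x y ⟨h1, rfl⟩ ⟨h2, e.symm⟩ hne
    rw [← e]
    exact this
end E5
end RAC
/-- **Corollary 1 (RAC drawings of IC-plane graphs).**
Every `n`-vertex IC-plane graph admits a RAC drawing with at most two bends per edge
on an integer grid whose width and height are both `O(n)` (hence of `O(n²)` area):
vertices and bend points are grid points, the drawing has the same pairs of crossing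
edges as the given IC-planar embedding (each edge is crossed at most once, in a single
point, and no two crossed edges share an end-vertex), and any two crossing edges cross
at a right angle. -/
theorem rac_two_bends_of_ic_plane :
    ∃ C : ℕ, 0 < C ∧
      ∀ (V : Type) [Fintype V] (G : SimpleGraph V) (D : ICDrawing G),
        ∃ Δ : PolyDrawing G,
          (∀ w : V, IsGridPoint (Δ.pos w) ∧
            Δ.pos w ∈ box (C * Fintype.card V) (C * Fintype.card V)) ∧
          (∀ {u v : V} (h : G.Adj u v),
            IsGridPoint (Δ.bend h).1 ∧ IsGridPoint (Δ.bend h).2 ∧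
            Δ.carrier h ⊆ box (C * Fintype.card V) (C * Fintype.card V)) ∧
          (∀ {u v : V} (h : G.Adj u v) (w : V), Δ.pos w ∈ Δ.carrier h → w = u ∨ w = v) ∧
          (∀ {u v x y : V} (h1 : G.Adj u v) (h2 : G.Adj x y), s(u, v) ≠ s(x, y) →
            (Δ.Crosses h1 h2 ↔ D.toDrawing.Crosses h1 h2)) ∧
          (∀ {u v : V} (h : G.Adj u v),
            {f : Sym2 V | f ≠ s(u, v) ∧ Δ.CrossE s(u, v) f}.Subsingleton) ∧
          (∀ {u v x y : V} (h1 : G.Adj u v) (h2 : G.Adj x y), s(u, v) ≠ s(x, y) →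
            {p : Pt | p ∈ Δ.carrier h1 ∧ p ∈ Δ.carrier h2 ∧
              p ∉ Set.range Δ.pos}.Subsingleton) ∧
          (∀ {u v x y : V} (h1 : G.Adj u v) (h2 : G.Adj x y), s(u, v) ≠ s(x, y) →
            Δ.Crosses h1 h2 → u ≠ x ∧ u ≠ y ∧ v ≠ x ∧ v ≠ y) ∧
          (∀ {u v x y : V} (h1 : G.Adj u v) (h2 : G.Adj x y), s(u, v) ≠ s(x, y) →
            ∀ p : Pt, p ∈ Δ.carrier h1 → p ∈ Δ.carrier h2 → p ∉ Set.range Δ.pos →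
              ∃ s1 ∈ Δ.segs h1, ∃ s2 ∈ Δ.segs h2,
                p ∈ segment ℝ s1.1 s1.2 ∧ p ∈ segment ℝ s2.1 s2.2 ∧
                s1.1 ≠ s1.2 ∧ s2.1 ≠ s2.2 ∧ dot (s1.2 - s1.1) (s2.2 - s2.1) = 0) := by
  refine ⟨40, by norm_num, ?_⟩
  intro V _ G D
  obtain ⟨Y, Z, X, β, T, I, A, hZ, hY, hg, hT, hβ, hreg, hpair, hcr⟩ := RAC.final_aux D
  let Δ : PolyDrawing G :=
    { pos := RAC.vp Y Z
      pos_inj := RAC.vp_inj I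
      bend := fun {u v} _ => (β (X s(u, v)) u, β (X s(u, v)) v)
      bend_symm := fun {u v} h => by simp only; rw [Sym2.eq_swap] }
  have hbox : ∀ u v g, RAC.Reg T Y Z u v g ⊆ box (40 * Fintype.card V) (40 * Fintype.card V) := fun u v g =>
    RAC.reg_box hZ hY hg
  have hXeq : ∀ {u v x y : V} (h1 : G.Adj u v) (h2 : G.Adj x y) (p : Pt), p ∈ Δ.carrier h1 → p ∈ Δ.carrier h2 →
      p ∉ Set.range Δ.pos → X s(u, v) = X s(x, y) := by
    intro u v x y h1 h2 p k1 k2 k3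
    by_contra hne
    exact k3 (RAC.cross_item I A (hreg u v h1 k1) (hreg x y h2 k2) hne)
  have hC : ∀ {u v x y : V} (h1 : G.Adj u v) (h2 : G.Adj x y), s(u, v) ≠ s(x, y) →
            (Δ.Crosses h1 h2 ↔ D.toDrawing.Crosses h1 h2) := by
    intro u v x y h1 h2 hne
    rw [← hcr u v x y h1 h2 hne]
    constructor
    · rintro ⟨p, k1, k2, k3⟩
      exact hXeq h1 h2 p k1 k2 k3
    · intro e
      obtain ⟨q, q1, q2, q3, -⟩ := hpair u v x y h1 h2 hne e
      refine ⟨q, q2, q3, ?_⟩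
      rintro ⟨w, rfl⟩
      have q1 : (Z w : ℝ) = X s(u, v) := q1
      have q1 : Z w = X s(u, v) := by exact_mod_cast q1
      have := A.far _ u w (hT s(u, v) u h1 (Sym2.mem_mk_left _ _))
      omega
  have hCE : ∀ {u v : V}, G.Adj u v → ∀ f, f ≠ s(u, v) → Δ.CrossE s(u, v) f → D.toDrawing.CrossE s(u, v) f := by
    rintro u v h f hf ⟨a, b, c, d, h1, h2, e1, rfl, k⟩
    exact ⟨a, b, c, d, h1, h2, e1, rfl, (hC h1 h2 (by rw [← e1]; exact hf.symm)).1 k⟩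
  refine ⟨Δ, ?_, ?_, ?_, hC, ?_, ?_, ?_, ?_⟩
  · intro w
    exact ⟨⟨⟨Z w, rfl⟩, ⟨Y w, rfl⟩⟩, hbox w w 0 (Or.inl rfl)⟩
  · intro u v h
    exact ⟨hβ _ _, hβ _ _, (hreg u v h).trans (hbox _ _ _)⟩
  · intro u v h w hw
    exact RAC.reg_avoid I A (hreg u v h hw)
  · intro u v h f hf f' hf'
    exact D.once h ⟨hf.1, hCE h f hf.1 hf.2⟩ ⟨hf'.1, hCE h f' hf'.1 hf'.2⟩
  · intro u v x y h1 h2 hne p hp p' hp'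
    obtain ⟨q, -, -, -, hq, -⟩ := hpair u v x y h1 h2 hne (hXeq h1 h2 p hp.1 hp.2.1 hp.2.2)
    rw [hq p hp.1 hp.2.1, hq p' hp'.1 hp'.2.1]
  · intro u v x y h1 h2 hne k
    exact D.indep h1 h2 hne ((hC h1 h2 hne).1 k)
  · intro u v x y h1 h2 hne p k1 k2 k3
    obtain ⟨q, -, -, -, hq, hr⟩ := hpair u v x y h1 h2 hne (hXeq h1 h2 p k1 k2 k3)
    rw [hq p k1 k2]
    rcases hr with ⟨⟨s1, m1, a1, b1, c1⟩, ⟨s2, m2, a2, b2, c2⟩⟩ | ⟨⟨s1, m1, a1, b1, c1⟩, ⟨s2, m2, a2, b2, c2⟩⟩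
    · refine ⟨s1, m1, s2, m2, a1, a2, b1, b2, ?_⟩
      simp [dot, c1, c2]
    · refine ⟨s1, m1, s2, m2, a1, a2, b1, b2, ?_⟩
      simp [dot, c1, c2]
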